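/- (Fractional Leibniz rule in mixed norms) Let α > 0 and 1 < p,q < ∞. For all smooth space-time functions f, g ∈ S(ℝ²), ‖D_x^α(fg)‖_{L^p_x L^q_T} ≲ ‖f‖_{L^{p₁}_x L^{q₁}_T} ‖D_x^α g‖_{L^{p₂}_x L^{q₂}_T} + ‖g‖_{L^{p̃₁}_x L^{q̃₁}_T} ‖D_x^α f‖_{L^{p̃₂}_x L^{q̃₂}_T}, where 1 < p₁,p₂,q₂,p̃₁,p̃₂,q̃₂ < ∞, 1 < q₁,q̃₁ ≤ ∞, 1/p₁ + 1/p₂ = 1/p̃₁ + 1/p̃₂ = 1/p and 1/q₁ + 1/q₂ = 1/q̃₁ + 1/q̃₂ = 1/q; moreover the cases (p₁,q₁) = (∞,∞) and (p̃₁,q̃₁) = (∞,∞) are also allowed. -/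

import Mathlib

open MeasureTheory Real Set Filter
open scoped FourierTransform ENNReal NNReal Topology

noncomputable section

/-- Fourier multiplier operator with symbol `m`. -/
def FMul (m : ℝ → ℂ) (f : ℝ → ℂ) : ℝ → ℂ :=
  𝓕⁻ fun ξ => m ξ * 𝓕 f ξ

/-- `D_x^α`, the Fourier multiplier with symbol `|ξ|^α`. -/
def Dop (α : ℝ) (f : ℝ → ℂ) : ℝ → ℂ :=
  FMul (fun ξ => ((|ξ| ^ α : ℝ) : ℂ)) f

/-- The free Benjamin–Ono group `V(t) = 𝓕⁻¹ e^{itξ|ξ|} 𝓕`. -/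
def BOGroup (t : ℝ) (f : ℝ → ℂ) : ℝ → ℂ :=
  FMul (fun ξ => Complex.exp (Complex.I * (t * ξ * |ξ|))) f

/-- The derivative `∂ₓ` as the Fourier multiplier with symbol `iξ`. -/
def Dx1 (f : ℝ → ℂ) : ℝ → ℂ :=
  FMul (fun ξ => Complex.I * ξ) f

/-- Projection on nonnegative frequencies. -/
def Pplus (f : ℝ → ℂ) : ℝ → ℂ :=
  FMul (fun ξ => if 0 ≤ ξ then 1 else 0) f

/-- Projection on nonpositive frequencies. -/
def Pminus (f : ℝ → ℂ) : ℝ → ℂ :=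
  FMul (fun ξ => if ξ ≤ 0 then 1 else 0) f

/-- The Sobolev `H^s` norm. -/
def HsNorm (s : ℝ) (f : ℝ → ℂ) : ℝ≥0∞ :=
  eLpNorm (fun ξ => (((1 + ξ ^ 2) ^ (s / 2) : ℝ) : ℂ) * 𝓕 f ξ) 2 volume

/-- The mixed space-time norm `L^p_x L^q_T`. -/
def LpLq (p q : ℝ≥0∞) (T : ℝ) (f : ℝ → ℝ → ℂ) : ℝ≥0∞ :=
  eLpNorm (fun x => (eLpNorm (fun t => f x t) q (volume.restrict (Ioc (0:ℝ) T))).toReal) p volume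

/-- The mixed space-time norm `L^q_T L^p_x`. -/
def LqLp (q p : ℝ≥0∞) (T : ℝ) (f : ℝ → ℝ → ℂ) : ℝ≥0∞ :=
  eLpNorm (fun t => (eLpNorm (fun x => f x t) p volume).toReal) q (volume.restrict (Ioc (0:ℝ) T))

/-- The norm `L^∞_T H^s_x`. -/
def LinfHs (s : ℝ) (T : ℝ) (f : ℝ → ℝ → ℂ) : ℝ≥0∞ :=
  eLpNorm (fun t => (HsNorm s (fun x => f x t)).toReal) ∞ (volume.restrict (Ioc (0:ℝ) T))

/-- Apply a spatial operator slice-wise in time. -/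
def sliceOp (A : (ℝ → ℂ) → (ℝ → ℂ)) (f : ℝ → ℝ → ℂ) : ℝ → ℝ → ℂ :=
  fun x t => A (fun y => f y t) x

/-- A smooth nonnegative bump `η` supported in `{1/2 ≤ |ξ| ≤ 2}` giving a dyadic
partition of unity `Σ_k η(2^{-k} ξ) = 1` for `ξ ≠ 0`. -/
structure IsLPBump (η : ℝ → ℝ) : Prop where
  smooth : ContDiff ℝ (⊤ : ℕ∞) η
  nonneg : ∀ ξ, 0 ≤ η ξ
  support : ∀ ξ, η ξ ≠ 0 → 1/2 ≤ |ξ| ∧ |ξ| ≤ 2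
  partition : ∀ ξ : ℝ, ξ ≠ 0 → ∑' k : ℤ, η ((2:ℝ) ^ (-k) * ξ) = 1

/-- The low-frequency symbol `p(ξ) = Σ_{j ≤ -3} η(2^{-j} ξ)`. -/
def lowSymbol (η : ℝ → ℝ) (ξ : ℝ) : ℝ :=
  ∑' j : ℤ, if j ≤ -3 then η ((2:ℝ) ^ (-j) * ξ) else 0

/-- The low-frequency projection `P₀`. -/
def P0 (η : ℝ → ℝ) (f : ℝ → ℂ) : ℝ → ℂ :=
  FMul (fun ξ => ((lowSymbol η ξ : ℝ) : ℂ)) f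

/-- The `X^s_T` norm. -/
def XNorm (η : ℝ → ℝ) (s T : ℝ) (u : ℝ → ℝ → ℂ) : ℝ≥0∞ :=
  LinfHs s T u + LpLq ∞ 2 T (sliceOp (Dop (s + 1/2)) u)
    + LpLq 4 ∞ T (sliceOp (Dop (s - 1/4)) u)
    + LpLq 2 ∞ T (sliceOp (P0 η) u)

/-- The Duhamel integral `∫₀ᵗ V(t-τ) f(τ) dτ`. -/
def duhamel (f : ℝ → ℝ → ℂ) : ℝ → ℝ → ℂ :=
  fun x t => ∫ τ in Ioc (0:ℝ) t, BOGroup (t - τ) (fun y => f y τ) x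

/-- The uncentred maximal function over intervals with rational endpoints, with respect to `ν`. -/
def intervalMax (ν : Measure ℝ) (f : ℝ → ℝ≥0∞) (x : ℝ) : ℝ≥0∞ :=
  ⨆ (a : ℚ) (b : ℚ) (_ : x ∈ Ioo (a : ℝ) b), (∫⁻ y in Ioo (a : ℝ) b, f y ∂ν) / ν (Ioo (a : ℝ) b)

lemma le_intervalMax (ν : Measure ℝ) (f : ℝ → ℝ≥0∞) {x : ℝ} {a b : ℚ} (h : x ∈ Ioo (a : ℝ) b) :
    (∫⁻ y in Ioo (a : ℝ) b, f y ∂ν) / ν (Ioo (a : ℝ) b) ≤ intervalMax ν f x :=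
  le_iSup_of_le a <| le_iSup_of_le b <| le_iSup_of_le h le_rfl

lemma intervalMax_le {ν : Measure ℝ} {f : ℝ → ℝ≥0∞} {x : ℝ} {c : ℝ≥0∞}
    (h : ∀ a b : ℚ, x ∈ Ioo (a : ℝ) b →
      (∫⁻ y in Ioo (a : ℝ) b, f y ∂ν) / ν (Ioo (a : ℝ) b) ≤ c) : intervalMax ν f x ≤ c :=
  iSup_le fun a => iSup_le fun b => iSup_le fun hx => h a b hx

lemma intervalMax_mono {ν : Measure ℝ} {f g : ℝ → ℝ≥0∞} (h : f ≤ᵐ[ν] g) (x : ℝ) :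
    intervalMax ν f x ≤ intervalMax ν g x := by
  refine intervalMax_le fun a b hx => le_trans ?_ (le_intervalMax ν g hx)
  exact ENNReal.div_le_div_right (lintegral_mono_ae (ae_restrict_of_ae h)) _

lemma measurable_intervalMax_prod {Y : Type*} [MeasurableSpace Y] (ν : Measure ℝ) [SFinite ν]
    {f : ℝ → Y → ℝ≥0∞} (hf : Measurable (Function.uncurry f)) :
    Measurable (fun z : ℝ × Y => intervalMax ν (fun y => f y z.2) z.1) := by
  unfold intervalMax
  refine Measurable.iSup fun a => Measurable.iSup fun b => ?_
  have h1 : (fun z : ℝ × Y => ⨆ (_ : z.1 ∈ Ioo (a : ℝ) b),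
      (∫⁻ y in Ioo (a : ℝ) b, f y z.2 ∂ν) / ν (Ioo (a : ℝ) b)) =
      (Prod.fst ⁻¹' Ioo (a : ℝ) b).indicator
        (fun z : ℝ × Y => (∫⁻ y in Ioo (a : ℝ) b, f y z.2 ∂ν) / ν (Ioo (a : ℝ) b)) := by
    ext z
    by_cases h : z.1 ∈ Ioo (a : ℝ) b
    · rw [indicator_of_mem (by exact h)]; simp only [h, iSup_pos]
    · rw [indicator_of_notMem (by exact h)]; simp only [h, iSup_false]; rfl
  rw [h1]
  refine Measurable.indicator ?_ (measurable_fst measurableSet_Ioo)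
  refine Measurable.div_const ?_ _
  have h2 : Measurable (fun t : Y => ∫⁻ y in Ioo (a : ℝ) b, f y t ∂ν) :=
    Measurable.lintegral_prod_left' (f := fun p : ℝ × Y => f p.1 p.2) hf
  exact h2.comp measurable_snd

lemma measurable_intervalMax (ν : Measure ℝ) [SFinite ν] {f : ℝ → ℝ≥0∞} (hf : Measurable f) :
    Measurable (intervalMax ν f) := by
  have h0 : Measurable (Function.uncurry fun (y : ℝ) (_ : Unit) => f y) := by
    simp only [Function.uncurry_def]
    exact hf.comp measurable_fst
  have h := measurable_intervalMax_prod (Y := Unit) ν h0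
  have h1 : Measurable fun x : ℝ => (x, ()) := measurable_id.prodMk measurable_const
  have h2 := h.comp h1
  simp only [Function.comp_def] at h2
  exact h2

lemma exists_subcover_overlap_two {ι : Type*} (a b : ι → ℝ) (s : Finset ι) :
    ∃ t ⊆ s, (⋃ i ∈ t, Ioo (a i) (b i)) = (⋃ i ∈ s, Ioo (a i) (b i)) ∧
      ∀ x, ∑ i ∈ t, (Ioo (a i) (b i)).indicator (1 : ℝ → ℝ≥0∞) x ≤ 2 := by
  classical
  induction s using Finset.strongInductionOn with
  | _ s ih =>
    by_cases hs : ∀ x, (s.filter fun i => x ∈ Ioo (a i) (b i)).card ≤ 2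
    · refine ⟨s, subset_rfl, rfl, fun x => ?_⟩
      have : ∑ i ∈ s, (Ioo (a i) (b i)).indicator (1 : ℝ → ℝ≥0∞) x
          = ((s.filter fun i => x ∈ Ioo (a i) (b i)).card : ℝ≥0∞) := by
        rw [Finset.card_filter, Nat.cast_sum]
        refine Finset.sum_congr rfl fun i _ => ?_
        by_cases h : x ∈ Ioo (a i) (b i)
        · rw [indicator_of_mem h, if_pos h]; simp
        · rw [indicator_of_notMem h, if_neg h]; simp
      rw [this]
      exact_mod_cast hs x
    · push Not at hs
      obtain ⟨x, hx⟩ := hs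
      set F := s.filter fun i => x ∈ Ioo (a i) (b i) with hF
      have hne : F.Nonempty := Finset.card_pos.1 (by omega)
      obtain ⟨i, hi, hi'⟩ := F.exists_min_image a hne
      obtain ⟨j, hj, hj'⟩ := F.exists_max_image b hne
      have : ((F.erase i).erase j).Nonempty := by
        apply Finset.card_pos.1
        have h1 := Finset.pred_card_le_card_erase (s := F) (a := i)
        have h2 := Finset.pred_card_le_card_erase (s := F.erase i) (a := j)
        omega
      obtain ⟨k, hk⟩ := this
      have hkj : k ≠ j := Finset.ne_of_mem_erase hk
      have hk1 := Finset.mem_of_mem_erase hk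
      have hki : k ≠ i := Finset.ne_of_mem_erase hk1
      have hkF := Finset.mem_of_mem_erase hk1
      have hks : k ∈ s := (Finset.mem_filter.1 hkF).1
      obtain ⟨t, hts, htu, ht2⟩ := ih (s.erase k) (Finset.erase_ssubset hks)
      refine ⟨t, hts.trans (Finset.erase_subset _ _), ?_, ht2⟩
      rw [htu]
      apply subset_antisymm
      · exact biUnion_subset_biUnion_left (Finset.erase_subset _ _)
      · intro y hy
        simp only [mem_iUnion] at hy ⊢
        obtain ⟨l, hl, hyl⟩ := hy
        by_cases hlk : l = k
        · subst hlk
          have hiF := Finset.mem_filter.1 hi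
          have hjF := Finset.mem_filter.1 hj
          have hlF := Finset.mem_filter.1 hkF
          rcases le_or_gt y x with hyx | hyx
          · exact ⟨i, Finset.mem_erase.2 ⟨hki.symm, hiF.1⟩,
              lt_of_le_of_lt (hi' l hkF) hyl.1, lt_of_le_of_lt hyx hiF.2.2⟩
          · exact ⟨j, Finset.mem_erase.2 ⟨hkj.symm, hjF.1⟩,
              lt_trans hjF.2.1 hyx, lt_of_lt_of_le hyl.2 (hj' l hkF)⟩
        · exact ⟨l, Finset.mem_erase.2 ⟨hlk, hl⟩, hyl⟩

lemma measure_finset_cover_le (ν : Measure ℝ) {f : ℝ → ℝ≥0∞} (hf : Measurable f)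
    {ι : Type*} (a b : ι → ℝ) (s : Finset ι) (c : ℝ≥0∞)
    (h : ∀ i ∈ s, c * ν (Ioo (a i) (b i)) ≤ ∫⁻ y in Ioo (a i) (b i), f y ∂ν) :
    c * ν (⋃ i ∈ s, Ioo (a i) (b i)) ≤ 2 * ∫⁻ y, f y ∂ν := by
  obtain ⟨t, hts, htu, ht⟩ := exists_subcover_overlap_two a b s
  rw [← htu]
  calc c * ν (⋃ i ∈ t, Ioo (a i) (b i)) ≤ c * ∑ i ∈ t, ν (Ioo (a i) (b i)) := by
        gcongr; exact measure_biUnion_finset_le _ _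
    _ = ∑ i ∈ t, c * ν (Ioo (a i) (b i)) := Finset.mul_sum _ _ _
    _ ≤ ∑ i ∈ t, ∫⁻ y in Ioo (a i) (b i), f y ∂ν := Finset.sum_le_sum fun i hi => h i (hts hi)
    _ = ∑ i ∈ t, ∫⁻ y, (Ioo (a i) (b i)).indicator (1 : ℝ → ℝ≥0∞) y * f y ∂ν := by
        refine Finset.sum_congr rfl fun i _ => ?_
        rw [← lintegral_indicator measurableSet_Ioo]
        refine lintegral_congr fun y => ?_
        by_cases hy : y ∈ Ioo (a i) (b i)
        · simp [indicator_of_mem hy]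
        · simp [indicator_of_notMem hy]
    _ = ∫⁻ y, ∑ i ∈ t, (Ioo (a i) (b i)).indicator (1 : ℝ → ℝ≥0∞) y * f y ∂ν := by
        rw [lintegral_finsetSum]
        exact fun i _ => (measurable_one.indicator measurableSet_Ioo).mul hf
    _ ≤ ∫⁻ y, 2 * f y ∂ν := by
        refine lintegral_mono fun y => ?_
        simp only [← Finset.sum_mul]
        gcongr
        exact ht y
    _ = 2 * ∫⁻ y, f y ∂ν := lintegral_const_mul _ hf

lemma intervalMax_weak_type (ν : Measure ℝ) {f : ℝ → ℝ≥0∞} (hf : Measurable f) (c : ℝ≥0∞) :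
    c * ν {x | c < intervalMax ν f x} ≤ 2 * ∫⁻ y, f y ∂ν := by
  set S : Set (ℚ × ℚ) := {p | c * ν (Ioo (p.1 : ℝ) p.2) ≤ ∫⁻ y in Ioo (p.1 : ℝ) p.2, f y ∂ν}
  have hsub : {x | c < intervalMax ν f x} ⊆ ⋃ p : S, Ioo (p.1.1 : ℝ) p.1.2 := by
    intro x hx
    simp only [mem_ofPred_eq, intervalMax, lt_iSup_iff] at hx
    obtain ⟨a, b, hab, h⟩ := hx
    exact mem_iUnion.2 ⟨⟨(a, b), (ENNReal.mul_lt_of_lt_div h).le⟩, hab⟩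
  calc c * ν {x | c < intervalMax ν f x} ≤ c * ν (⋃ p : S, Ioo (p.1.1 : ℝ) p.1.2) := by
        gcongr
    _ ≤ 2 * ∫⁻ y, f y ∂ν := by
        rw [iUnion_eq_iUnion_finset, (Monotone.directed_le ?_).measure_iUnion, ENNReal.mul_iSup]
        · refine iSup_le fun t => ?_
          exact measure_finset_cover_le ν hf (fun p : S => (p.1.1 : ℝ)) (fun p : S => (p.1.2 : ℝ)) t c
            fun i _ => i.2
        · intro s t hst
          exact biUnion_subset_biUnion_left hst

lemma lintegral_rpow_lt_eq {s : ℝ} (hs : 0 < s) (y : ℝ≥0∞) :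
    ENNReal.ofReal s * ∫⁻ t in Ioi (0 : ℝ),
      {z | z < y}.indicator 1 (ENNReal.ofReal t) * ENNReal.ofReal (t ^ (s - 1)) = y ^ s := by
  have key : ∀ r : ℝ≥0, ENNReal.ofReal s * ∫⁻ t in Ioi (0 : ℝ),
      {z : ℝ≥0∞ | z < r}.indicator 1 (ENNReal.ofReal t) * ENNReal.ofReal (t ^ (s - 1))
        = (r : ℝ≥0∞) ^ s := by
    intro r
    have h := lintegral_rpow_eq_lintegral_meas_lt_mul (Measure.dirac ()) (f := fun _ => (r : ℝ))
      (ae_of_all _ fun _ => r.2) aemeasurable_const hs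
    simp only [lintegral_dirac] at h
    rw [← ENNReal.ofReal_rpow_of_nonneg r.coe_nonneg hs.le, ENNReal.ofReal_coe_nnreal] at h
    rw [h]
    congr 1
    refine setLIntegral_congr_fun measurableSet_Ioi fun t ht => ?_
    congr 1
    rw [Measure.dirac_apply]
    have : ENNReal.ofReal t < r ↔ t < r := by
      rw [← ENNReal.ofReal_coe_nnreal, ENNReal.ofReal_lt_ofReal_iff_of_nonneg (le_of_lt ht)]
    by_cases h : t < r
    · rw [indicator_of_mem (by exact this.2 h), indicator_of_mem (by exact h)]; simp
    · rw [indicator_of_notMem (by simpa [this] using h), indicator_of_notMem (by simpa using h)]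
  induction y with
  | coe r => exact key r
  | top =>
    rw [ENNReal.top_rpow_of_pos hs]
    refine ENNReal.eq_top_of_forall_nnreal_le fun r => ?_
    have h1 := key (r ^ (1 / s))
    rw [← ENNReal.coe_rpow_of_nonneg _ hs.le, ← NNReal.rpow_mul, one_div_mul_cancel hs.ne',
      NNReal.rpow_one] at h1
    rw [← h1]
    refine mul_le_mul_right (lintegral_mono fun t => mul_le_mul_left ?_ _) _
    refine indicator_le_indicator_of_subset ?_ (fun _ => by simp) _
    intro z hz
    exact lt_trans hz ENNReal.coe_lt_top

/-- The strong type constant of `intervalMax` on `L^q`. -/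
def maxConst (q : ℝ) : ℝ≥0∞ := ENNReal.ofReal q * (ENNReal.ofReal (q - 1))⁻¹ * 4 * 2 ^ (q - 1)

lemma maxConst_ne_top {q : ℝ} (hq : 1 < q) : maxConst q ≠ ∞ := by
  unfold maxConst
  have : (ENNReal.ofReal (q - 1))⁻¹ ≠ ∞ := by
    rw [ENNReal.inv_ne_top]; simpa using hq
  have h2 : (2 : ℝ≥0∞) ^ (q - 1) ≠ ∞ := ENNReal.rpow_ne_top_of_nonneg (by linarith) (by simp)
  finiteness

lemma intervalMax_le_add (ν : Measure ℝ) {f : ℝ → ℝ≥0∞} (hf : Measurable f) (c : ℝ≥0∞) (x : ℝ) :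
    intervalMax ν f x ≤ intervalMax ν ({y | c < f y}.indicator f) x + c := by
  refine intervalMax_le fun a b hx => ?_
  refine le_trans ?_ (add_le_add_left (le_intervalMax ν _ hx) _)
  have hm : Measurable ({y | c < f y}.indicator f) :=
    hf.indicator (measurableSet_lt measurable_const hf)
  calc (∫⁻ y in Ioo (a : ℝ) b, f y ∂ν) / ν (Ioo (a : ℝ) b)
      ≤ (∫⁻ y in Ioo (a : ℝ) b, ({y | c < f y}.indicator f y + c) ∂ν) / ν (Ioo (a : ℝ) b) := by
        gcongr with y
        by_cases h : c < f y
        · rw [indicator_of_mem (by exact h)]; exact le_self_add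
        · rw [indicator_of_notMem (by exact h), zero_add]; exact not_lt.1 h
    _ = (∫⁻ y in Ioo (a : ℝ) b, {y | c < f y}.indicator f y ∂ν) / ν (Ioo (a : ℝ) b)
        + c * ν (Ioo (a : ℝ) b) / ν (Ioo (a : ℝ) b) := by
        rw [lintegral_add_left hm, ENNReal.add_div, setLIntegral_const]
    _ ≤ _ := by
        gcongr
        rw [mul_div_assoc]
        calc c * (ν (Ioo (a : ℝ) b) / ν (Ioo (a : ℝ) b)) ≤ c * 1 := by
              gcongr; exact ENNReal.div_self_le_one
          _ = c := mul_one c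

theorem lintegral_intervalMax_rpow_le (ν : Measure ℝ) [SFinite ν] {q : ℝ} (hq : 1 < q)
    {f : ℝ → ℝ≥0∞} (hf : Measurable f) :
    ∫⁻ x, intervalMax ν f x ^ q ∂ν ≤ maxConst q * ∫⁻ x, f x ^ q ∂ν := by
  have hMm := measurable_intervalMax ν hf
  have hq1 : 0 < q - 1 := by linarith
  have hdist : ∀ t : ℝ, 0 < t → ν {x | ENNReal.ofReal t < intervalMax ν f x} * ENNReal.ofReal (t ^ (q - 1))
      ≤ 4 * ∫⁻ x, f x * ({z | z < 2 * f x}.indicator 1 (ENNReal.ofReal t)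
        * ENNReal.ofReal (t ^ (q - 1 - 1))) ∂ν := by
    intro t ht
    have hc : ENNReal.ofReal t = ENNReal.ofReal (t / 2) + ENNReal.ofReal (t / 2) := by
      rw [← ENNReal.ofReal_add (by positivity) (by positivity), add_halves]
    have h1 := intervalMax_weak_type ν
      (hf.indicator (measurableSet_lt (measurable_const (a := ENNReal.ofReal (t / 2))) hf))
      (ENNReal.ofReal (t / 2))
    have hsub : {x | ENNReal.ofReal t < intervalMax ν f x} ⊆ {x | ENNReal.ofReal (t / 2) <
        intervalMax ν ({y | ENNReal.ofReal (t / 2) < f y}.indicator f) x} := by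
      intro x hx
      have := lt_of_lt_of_le hx (intervalMax_le_add ν hf (ENNReal.ofReal (t / 2)) x)
      rw [hc] at this
      exact lt_of_add_lt_add_right this
    have hpow : ENNReal.ofReal (t ^ (q - 1)) =
        2 * ENNReal.ofReal (t ^ (q - 1 - 1)) * ENNReal.ofReal (t / 2) := by
      rw [← ENNReal.ofReal_ofNat, ← ENNReal.ofReal_mul (by positivity),
        ← ENNReal.ofReal_mul (by positivity), Real.rpow_sub_one ht.ne' (q - 1)]
      congr 1
      field_simp
    calc ν {x | ENNReal.ofReal t < intervalMax ν f x} * ENNReal.ofReal (t ^ (q - 1))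
        = 2 * ENNReal.ofReal (t ^ (q - 1 - 1)) *
          (ENNReal.ofReal (t / 2) * ν {x | ENNReal.ofReal t < intervalMax ν f x}) := by
          rw [hpow]; ring
      _ ≤ 2 * ENNReal.ofReal (t ^ (q - 1 - 1)) *
          (2 * ∫⁻ x, {y | ENNReal.ofReal (t / 2) < f y}.indicator f x ∂ν) := by
          refine mul_le_mul_right (le_trans ?_ h1) _
          exact mul_le_mul_right (measure_mono hsub) _
      _ = 4 * ∫⁻ x, ENNReal.ofReal (t ^ (q - 1 - 1)) *
            {y | ENNReal.ofReal (t / 2) < f y}.indicator f x ∂ν := by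
          rw [lintegral_const_mul _
            (hf.indicator (measurableSet_lt (measurable_const (a := ENNReal.ofReal (t / 2))) hf))]
          ring
      _ ≤ _ := by
          refine mul_le_mul_right (lintegral_mono fun x => ?_) _
          by_cases h : ENNReal.ofReal (t / 2) < f x
          · have : ENNReal.ofReal t < 2 * f x := by
              rw [hc, two_mul]; exact ENNReal.add_lt_add h h
            rw [indicator_of_mem (by exact h), indicator_of_mem (by exact this)]
            simp only [Pi.one_apply, one_mul]; rw [mul_comm]
          · rw [indicator_of_notMem (by exact h)]; simp
  have hJ : ∀ {F : ℝ → ℝ≥0∞} (r : ℝ), Measurable F → Measurable (Function.uncurry fun (x : ℝ) (t : ℝ) =>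
      {z | z < F x}.indicator (1 : ℝ≥0∞ → ℝ≥0∞) (ENNReal.ofReal t)
        * ENNReal.ofReal (t ^ r)) := by
    intro F r hF
    have : Measurable fun z : ℝ × ℝ => {z : ℝ × ℝ | ENNReal.ofReal z.2 < F z.1}.indicator
        (1 : ℝ × ℝ → ℝ≥0∞) z * ENNReal.ofReal (z.2 ^ r) := by
      refine Measurable.mul (measurable_one.indicator (measurableSet_lt ?_ ?_)) ?_ <;> fun_prop
    exact this
  have h2f : Measurable fun x => 2 * f x := hf.const_mul 2
  calc ∫⁻ x, intervalMax ν f x ^ q ∂ν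
      = ENNReal.ofReal q * ∫⁻ x, (∫⁻ t in Ioi (0 : ℝ),
        {z | z < intervalMax ν f x}.indicator 1 (ENNReal.ofReal t) * ENNReal.ofReal (t ^ (q - 1))) ∂ν := by
        have hq0 : 0 < q := by linarith
        refine Eq.trans (lintegral_congr fun x => (lintegral_rpow_lt_eq hq0 _).symm) ?_
        exact lintegral_const_mul _ (hJ _ hMm).lintegral_prod_right
    _ = ENNReal.ofReal q * ∫⁻ t in Ioi (0 : ℝ),
          ν {x | ENNReal.ofReal t < intervalMax ν f x} * ENNReal.ofReal (t ^ (q - 1)) := by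
        rw [lintegral_lintegral_swap (hJ _ hMm).aemeasurable]
        congr 1
        refine lintegral_congr fun t => ?_
        rw [lintegral_mul_const]
        · congr 1
          rw [← lintegral_indicator_one (measurableSet_lt measurable_const hMm)]
          rfl
        · exact measurable_one.indicator (measurableSet_lt measurable_const hMm)
    _ ≤ ENNReal.ofReal q * ∫⁻ t in Ioi (0 : ℝ), 4 * ∫⁻ x, f x *
          ({z | z < 2 * f x}.indicator 1 (ENNReal.ofReal t) * ENNReal.ofReal (t ^ (q - 1 - 1))) ∂ν :=
        mul_le_mul_right (setLIntegral_mono' measurableSet_Ioi fun t ht => hdist t ht) _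
    _ = ENNReal.ofReal q * 4 * ∫⁻ x, f x * (∫⁻ t in Ioi (0 : ℝ),
          {z | z < 2 * f x}.indicator 1 (ENNReal.ofReal t) * ENNReal.ofReal (t ^ (q - 1 - 1))) ∂ν := by
        have hm := (hf.comp measurable_fst).mul (hJ (q - 1 - 1) h2f)
        rw [lintegral_const_mul _ hm.lintegral_prod_left, lintegral_lintegral_swap
          (f := fun t x => f x * ({z | z < 2 * f x}.indicator 1 (ENNReal.ofReal t)
            * ENNReal.ofReal (t ^ (q - 1 - 1)))) (hm.comp measurable_swap).aemeasurable, ← mul_assoc]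
        congr 1
        refine lintegral_congr fun x => ?_
        exact lintegral_const_mul _ ((hJ (q - 1 - 1) h2f).comp measurable_prodMk_left)
    _ = ENNReal.ofReal q * 4 * ∫⁻ x, (ENNReal.ofReal (q - 1))⁻¹ * 2 ^ (q - 1) * f x ^ q ∂ν := by
        congr 1
        refine lintegral_congr fun x => ?_
        have h0 : ENNReal.ofReal (q - 1) ≠ 0 := by simpa using hq
        have h := lintegral_rpow_lt_eq hq1 (2 * f x)
        have h' : ∀ z : ℝ≥0∞, z = (ENNReal.ofReal (q - 1))⁻¹ * (ENNReal.ofReal (q - 1) * z) :=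
          fun z => by rw [← mul_assoc, ENNReal.inv_mul_cancel h0 ENNReal.ofReal_ne_top, one_mul]
        rw [h' (∫⁻ t in Ioi (0 : ℝ), _), h, ENNReal.mul_rpow_of_nonneg _ _ hq1.le]
        have : f x ^ q = f x * f x ^ (q - 1) := by
          nth_rewrite 2 [← ENNReal.rpow_one (f x)]
          rw [← ENNReal.rpow_add_of_nonneg _ _ zero_le_one hq1.le]
          congr 1; ring
        rw [this]; ring
    _ = maxConst q * ∫⁻ x, f x ^ q ∂ν := by
        rw [lintegral_const_mul _ (hf.pow_const q), maxConst]; ring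

lemma lintegral_rpow_le_measure_univ_mul {X : Type*} [MeasurableSpace X] (ν : Measure X) {p : ℝ}
    (hp : 1 < p) {g : X → ℝ≥0∞} (hg : AEMeasurable g ν) :
    (∫⁻ x, g x ∂ν) ^ p ≤ ν univ ^ (p - 1) * ∫⁻ x, g x ^ p ∂ν := by
  have hpq := Real.HolderConjugate.conjExponent hp
  have h := ENNReal.lintegral_mul_le_Lp_mul_Lq ν hpq.symm
    (aemeasurable_const (b := (1 : ℝ≥0∞))) hg
  simp only [Pi.mul_apply, one_mul, ENNReal.one_rpow, lintegral_const] at h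
  calc (∫⁻ x, g x ∂ν) ^ p
      ≤ (ν univ ^ (1 / p.conjExponent) * (∫⁻ x, g x ^ p ∂ν) ^ (1 / p)) ^ p :=
        ENNReal.rpow_le_rpow h hpq.nonneg
    _ = _ := by
        rw [ENNReal.mul_rpow_of_nonneg _ _ hpq.nonneg, ← ENNReal.rpow_mul, ← ENNReal.rpow_mul,
          one_div_mul_cancel hpq.ne_zero, ENNReal.rpow_one]
        congr 2
        rw [Real.conjExponent]; field_simp

lemma tsum_two_pow_neg_mul_rpow_le {p : ℝ} (hp : 1 < p) (b : ℕ → ℝ≥0∞) :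
    (∑' k, 2⁻¹ ^ k * b k) ^ p ≤ 2 ^ (p - 1) * ∑' k, 2⁻¹ ^ k * b k ^ p := by
  have h := lintegral_rpow_le_measure_univ_mul
    ((Measure.count : Measure ℕ).withDensity fun k => 2⁻¹ ^ k) hp (g := b) (by fun_prop)
  have key : ∀ g : ℕ → ℝ≥0∞, ∫⁻ k, g k ∂((Measure.count : Measure ℕ).withDensity fun k => 2⁻¹ ^ k)
      = ∑' k, 2⁻¹ ^ k * g k := fun g => by
    rw [lintegral_withDensity_eq_lintegral_mul _ (by fun_prop) (by fun_prop), lintegral_count]; rfl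
  rw [key, key, ← setLIntegral_one, setLIntegral_univ, key] at h
  simpa [ENNReal.tsum_geometric, ENNReal.one_sub_inv_two] using h

/-- The norm constant used in the Rubio de Francia iteration. -/
def iterConst (p : ℝ) : ℝ≥0∞ := maxConst p ^ (1 / p) + 1

lemma iterConst_ne_top {p : ℝ} (hp : 1 < p) : iterConst p ≠ ∞ :=
  ENNReal.add_ne_top.2 ⟨ENNReal.rpow_ne_top_of_nonneg (by positivity) (maxConst_ne_top hp), by simp⟩

lemma iterConst_ne_zero (p : ℝ) : iterConst p ≠ 0 := by simp [iterConst]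

/-- The Rubio de Francia iteration of the maximal function. -/
def rubioDeFrancia (p : ℝ) (F : ℝ → ℝ≥0∞) (x : ℝ) : ℝ≥0∞ :=
  ∑' k : ℕ, 2⁻¹ ^ k * ((iterConst p)⁻¹ ^ k * (intervalMax volume)^[k] F x)

lemma measurable_iterate_intervalMax {F : ℝ → ℝ≥0∞} (hF : Measurable F) (k : ℕ) :
    Measurable ((intervalMax volume)^[k] F) := by
  induction k with
  | zero => exact hF
  | succ k ih => rw [Function.iterate_succ_apply']; exact measurable_intervalMax _ ih

lemma measurable_rubioDeFrancia (p : ℝ) {F : ℝ → ℝ≥0∞} (hF : Measurable F) :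
    Measurable (rubioDeFrancia p F) :=
  Measurable.tsum fun k =>
    ((measurable_iterate_intervalMax hF k).const_mul _).const_mul _

lemma le_rubioDeFrancia (p : ℝ) (F : ℝ → ℝ≥0∞) (x : ℝ) : F x ≤ rubioDeFrancia p F x := by
  refine le_trans ?_ (ENNReal.le_tsum 0)
  simp

lemma intervalMax_tsum_le (ν : Measure ℝ) {g : ℕ → ℝ → ℝ≥0∞} (hg : ∀ k, Measurable (g k)) (x : ℝ) :
    intervalMax ν (fun y => ∑' k, g k y) x ≤ ∑' k, intervalMax ν (g k) x := by
  refine intervalMax_le fun a b hx => ?_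
  rw [lintegral_tsum fun k => (hg k).aemeasurable, div_eq_mul_inv, ← ENNReal.tsum_mul_right]
  exact ENNReal.tsum_le_tsum fun k => le_intervalMax ν (g k) hx

lemma intervalMax_const_mul_le (ν : Measure ℝ) {g : ℝ → ℝ≥0∞} (hg : Measurable g) (c : ℝ≥0∞) (x : ℝ) :
    intervalMax ν (fun y => c * g y) x ≤ c * intervalMax ν g x := by
  refine intervalMax_le fun a b hx => ?_
  rw [lintegral_const_mul _ hg, mul_div_assoc]
  exact mul_le_mul_right (le_intervalMax ν g hx) _

lemma intervalMax_rubioDeFrancia_le {p : ℝ} (hp : 1 < p) {F : ℝ → ℝ≥0∞} (hF : Measurable F) (x : ℝ) :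
    intervalMax volume (rubioDeFrancia p F) x ≤ 2 * iterConst p * rubioDeFrancia p F x := by
  have hm := measurable_iterate_intervalMax hF
  refine (intervalMax_tsum_le _ (fun k => ((hm k).const_mul _).const_mul _) x).trans ?_
  have hA := ENNReal.mul_inv_cancel (iterConst_ne_zero p) (iterConst_ne_top hp)
  have h2 : (2 : ℝ≥0∞) * 2⁻¹ = 1 := ENNReal.mul_inv_cancel (by simp) (by simp)
  calc ∑' k, intervalMax volume (fun y => 2⁻¹ ^ k * ((iterConst p)⁻¹ ^ k *
          (intervalMax volume)^[k] F y)) x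
      ≤ ∑' k, 2 * iterConst p * (2⁻¹ ^ (k + 1) * ((iterConst p)⁻¹ ^ (k + 1) *
          (intervalMax volume)^[k + 1] F x)) := by
        refine ENNReal.tsum_le_tsum fun k => ?_
        refine (intervalMax_const_mul_le _ ((hm k).const_mul _) _ _).trans ?_
        refine (mul_le_mul_right (intervalMax_const_mul_le _ (hm k) _ _) _).trans (le_of_eq ?_)
        rw [Function.iterate_succ_apply']
        calc _ = (2 * 2⁻¹) * (iterConst p * (iterConst p)⁻¹) * (2⁻¹ ^ k * ((iterConst p)⁻¹ ^ k *
              intervalMax volume ((intervalMax volume)^[k] F) x)) := by rw [hA, h2]; simp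
          _ = _ := by ring
    _ = 2 * iterConst p * ∑' k, (2⁻¹ ^ (k + 1) * ((iterConst p)⁻¹ ^ (k + 1) *
          (intervalMax volume)^[k + 1] F x)) := ENNReal.tsum_mul_left
    _ ≤ _ := by
        refine mul_le_mul_right ?_ _
        exact ENNReal.tsum_comp_le_tsum_of_injective (add_left_injective 1)
          (fun k => 2⁻¹ ^ k * ((iterConst p)⁻¹ ^ k * (intervalMax volume)^[k] F x))

lemma lintegral_rubioDeFrancia_rpow_le {p : ℝ} (hp : 1 < p) {F : ℝ → ℝ≥0∞} (hF : Measurable F) :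
    ∫⁻ x, rubioDeFrancia p F x ^ p ≤ 2 ^ p * ∫⁻ x, F x ^ p := by
  have hp0 : 0 < p := by linarith
  have hm := measurable_iterate_intervalMax hF
  have hk : ∀ k : ℕ, ∫⁻ x, ((iterConst p)⁻¹ ^ k * (intervalMax volume)^[k] F x) ^ p ≤ ∫⁻ x, F x ^ p := by
    intro k
    induction k with
    | zero => simp
    | succ k ih =>
      refine le_trans ?_ ih
      rw [Function.iterate_succ_apply']
      have hC : maxConst p ≤ iterConst p ^ p := by
        calc maxConst p = (maxConst p ^ (1 / p)) ^ p := by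
              rw [← ENNReal.rpow_mul, one_div_mul_cancel hp0.ne', ENNReal.rpow_one]
          _ ≤ _ := ENNReal.rpow_le_rpow le_self_add hp0.le
      calc ∫⁻ x, ((iterConst p)⁻¹ ^ (k + 1) * intervalMax volume ((intervalMax volume)^[k] F) x) ^ p
          = ((iterConst p)⁻¹ ^ (k + 1)) ^ p *
              ∫⁻ x, intervalMax volume ((intervalMax volume)^[k] F) x ^ p := by
            simp only [ENNReal.mul_rpow_of_nonneg _ _ hp0.le]
            rw [lintegral_const_mul _ ((measurable_intervalMax _ (hm k)).pow_const p)]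
        _ ≤ ((iterConst p)⁻¹ ^ (k + 1)) ^ p *
              (iterConst p ^ p * ∫⁻ x, (intervalMax volume)^[k] F x ^ p) := by
            gcongr
            exact (lintegral_intervalMax_rpow_le volume hp (hm k)).trans (by gcongr)
        _ = ((iterConst p)⁻¹ ^ k) ^ p * ∫⁻ x, (intervalMax volume)^[k] F x ^ p := by
            rw [← mul_assoc, ← ENNReal.mul_rpow_of_nonneg _ _ hp0.le, pow_succ, mul_assoc,
              ENNReal.inv_mul_cancel (iterConst_ne_zero p) (iterConst_ne_top hp), mul_one]
        _ = _ := by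
            simp only [ENNReal.mul_rpow_of_nonneg _ _ hp0.le]
            rw [lintegral_const_mul _ ((hm k).pow_const p)]
  calc ∫⁻ x, rubioDeFrancia p F x ^ p
      ≤ ∫⁻ x, 2 ^ (p - 1) * ∑' k, 2⁻¹ ^ k * ((iterConst p)⁻¹ ^ k * (intervalMax volume)^[k] F x) ^ p :=
        lintegral_mono fun x => tsum_two_pow_neg_mul_rpow_le hp _
    _ = 2 ^ (p - 1) * ∑' k, 2⁻¹ ^ k * ∫⁻ x, ((iterConst p)⁻¹ ^ k * (intervalMax volume)^[k] F x) ^ p := by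
        have h1 : ∀ k, Measurable fun x =>
            ((iterConst p)⁻¹ ^ k * (intervalMax volume)^[k] F x) ^ p :=
          fun k => ((hm k).const_mul _).pow_const p
        rw [lintegral_const_mul _ (Measurable.tsum fun k => (h1 k).const_mul _),
          lintegral_tsum fun k => ((h1 k).const_mul _).aemeasurable]
        simp only [lintegral_const_mul _ (h1 _)]
    _ ≤ 2 ^ (p - 1) * ∑' k : ℕ, 2⁻¹ ^ k * ∫⁻ x, F x ^ p := by
        exact mul_le_mul_right (ENNReal.tsum_le_tsum fun k => mul_le_mul_right (hk k) _) _
    _ = 2 ^ p * ∫⁻ x, F x ^ p := by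
        rw [ENNReal.tsum_mul_right, ENNReal.tsum_geometric, ENNReal.one_sub_inv_two, inv_inv,
          ← mul_assoc]
        congr 1
        nth_rewrite 2 [← ENNReal.rpow_one 2]
        rw [← ENNReal.rpow_add _ _ (by simp) (by simp)]; congr 1; ring

lemma intervalMax_volume_rpow_le {w : ℝ → ℝ≥0∞} (hw : Measurable w) {δ : ℝ} (h0 : 0 < δ) (h1 : δ < 1)
    (x : ℝ) : intervalMax volume (fun y => w y ^ δ) x ≤ intervalMax volume w x ^ δ := by
  refine intervalMax_le fun a b hx => ?_
  refine le_trans ?_ (ENNReal.rpow_le_rpow (le_intervalMax volume w hx) h0.le)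
  have hab : (a : ℝ) < b := hx.1.trans hx.2
  have hp : 1 < 1 / δ := by rw [lt_div_iff₀ h0]; simpa
  have h := lintegral_rpow_le_measure_univ_mul (volume.restrict (Ioo (a : ℝ) b)) hp
    (g := fun y => w y ^ δ) (hw.pow_const δ).aemeasurable
  simp only [← ENNReal.rpow_mul, mul_one_div_cancel h0.ne', ENNReal.rpow_one,
    Measure.restrict_apply_univ] at h
  set V := volume (Ioo (a : ℝ) b) with hV
  have hV0 : V ≠ 0 := by rw [hV, Real.volume_Ioo]; simpa using hab
  have hVt : V ≠ ∞ := by simp [hV]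
  have h' := ENNReal.rpow_le_rpow h h0.le
  rw [← ENNReal.rpow_mul, one_div_mul_cancel h0.ne', ENNReal.rpow_one,
    ENNReal.mul_rpow_of_nonneg _ _ h0.le, ← ENNReal.rpow_mul] at h'
  rw [ENNReal.div_rpow_of_nonneg _ _ h0.le, ENNReal.div_le_iff hV0 hVt]
  refine h'.trans (le_of_eq ?_)
  have he : (1 / δ - 1) * δ = -δ + 1 := by field_simp; ring
  rw [he, ENNReal.rpow_add _ _ hV0 hVt, ENNReal.rpow_neg, ENNReal.rpow_one, ENNReal.div_eq_inv_mul]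
  ring

/-- For an `A₁` weight the maximal function is dominated by the weighted one. -/
lemma lintegral_intervalMax_rpow_mul_le {w : ℝ → ℝ≥0∞} (hw : Measurable w) {C : ℝ≥0∞} (hC : C ≠ ∞)
    (hwM : ∀ x, intervalMax volume w x ≤ C * w x) (hwf : ∀ᵐ x, w x ≠ ∞)
    (hw0 : ∀ᵐ x, w x ≠ 0) {q : ℝ} (hq : 1 < q) {f : ℝ → ℝ≥0∞} (hf : Measurable f) :
    ∫⁻ x, intervalMax volume f x ^ q * w x ≤ C ^ q * maxConst q * ∫⁻ x, f x ^ q * w x := by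
  set ν := volume.withDensity w with hν
  have hq0 : 0 < q := by linarith
  have hconv : ∀ g : ℝ → ℝ≥0∞, Measurable g → ∫⁻ x, g x ∂ν = ∫⁻ x, g x * w x := fun g hg => by
    rw [hν, lintegral_withDensity_eq_lintegral_mul _ hw hg]
    exact lintegral_congr fun x => mul_comm _ _
  have hpt : ∀ x, intervalMax volume f x ≤ C * intervalMax ν f x := by
    intro x
    refine intervalMax_le fun a b hx => ?_
    refine le_trans ?_ (mul_le_mul_right (le_intervalMax ν f hx) _)
    have hab : (a : ℝ) < b := hx.1.trans hx.2
    set V := volume (Ioo (a : ℝ) b) with hV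
    have hV0 : V ≠ 0 := by rw [hV, Real.volume_Ioo]; simpa using hab
    have hVt : V ≠ ∞ := by simp [hV]
    have hνI : ν (Ioo (a : ℝ) b) = ∫⁻ y in Ioo (a : ℝ) b, w y := withDensity_apply _ measurableSet_Ioo
    have hle : ∀ y ∈ Ioo (a : ℝ) b, ν (Ioo (a : ℝ) b) / V ≤ C * w y := fun y hy => by
      rw [hνI]; exact (le_intervalMax volume w hy).trans (hwM y)
    have hνt : ν (Ioo (a : ℝ) b) ≠ ∞ := by
      intro htop
      have : ∀ᵐ y, y ∉ Ioo (a : ℝ) b := by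
        filter_upwards [hwf] with y hy hyI
        have := hle y hyI
        rw [htop, ENNReal.top_div_of_ne_top hVt, top_le_iff] at this
        exact ENNReal.mul_ne_top hC hy this
      rw [ae_iff] at this
      simp only [not_not] at this
      exact hV0 this
    have hν0 : ν (Ioo (a : ℝ) b) ≠ 0 := by
      rw [hνI]
      intro h
      rw [lintegral_eq_zero_iff hw] at h
      have h' := (ae_restrict_iff' measurableSet_Ioo).1 h
      have : ∀ᵐ y, y ∉ Ioo (a : ℝ) b := by
        filter_upwards [hw0, h'] with y hy h2 hyI
        exact hy (h2 hyI)
      rw [ae_iff] at this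
      simp only [not_not] at this
      exact hV0 this
    rw [hν, setLIntegral_withDensity_eq_setLIntegral_mul _ hw hf measurableSet_Ioo, ← hν]
    rw [ENNReal.div_le_iff hV0 hVt]
    calc ∫⁻ y in Ioo (a : ℝ) b, f y
        ≤ ∫⁻ y in Ioo (a : ℝ) b, C * V * (ν (Ioo (a : ℝ) b))⁻¹ * (w * f) y := by
          refine setLIntegral_mono' measurableSet_Ioo fun y hy => ?_
          have h1 : 1 ≤ C * V * (ν (Ioo (a : ℝ) b))⁻¹ * w y := by
            have := hle y hy
            rw [ENNReal.div_le_iff hV0 hVt] at this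
            calc (1 : ℝ≥0∞) = ν (Ioo (a : ℝ) b) * (ν (Ioo (a : ℝ) b))⁻¹ :=
                  (ENNReal.mul_inv_cancel hν0 hνt).symm
              _ ≤ C * w y * V * (ν (Ioo (a : ℝ) b))⁻¹ := by gcongr
              _ = _ := by ring
          calc f y = 1 * f y := (one_mul _).symm
            _ ≤ (C * V * (ν (Ioo (a : ℝ) b))⁻¹ * w y) * f y := by gcongr
            _ = _ := by simp only [Pi.mul_apply]; ring
      _ = C * V * (ν (Ioo (a : ℝ) b))⁻¹ * ∫⁻ y in Ioo (a : ℝ) b, (w * f) y :=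
          lintegral_const_mul _ (hw.mul hf)
      _ = _ := by rw [div_eq_mul_inv]; ring
  calc ∫⁻ x, intervalMax volume f x ^ q * w x
      = ∫⁻ x, intervalMax volume f x ^ q ∂ν :=
        (hconv _ ((measurable_intervalMax volume hf).pow_const q)).symm
    _ ≤ ∫⁻ x, C ^ q * intervalMax ν f x ^ q ∂ν := by
        refine lintegral_mono fun x => ?_
        rw [← ENNReal.mul_rpow_of_nonneg _ _ hq0.le]
        exact ENNReal.rpow_le_rpow (hpt x) hq0.le
    _ = C ^ q * ∫⁻ x, intervalMax ν f x ^ q ∂ν :=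
        lintegral_const_mul _ ((measurable_intervalMax ν hf).pow_const q)
    _ ≤ C ^ q * (maxConst q * ∫⁻ x, f x ^ q ∂ν) := by
        gcongr; exact lintegral_intervalMax_rpow_le ν hq hf
    _ = _ := by rw [hconv _ (hf.pow_const q), mul_assoc]

lemma lintegral_intervalMax_rpow_mul_rpow_le {σ : ℝ → ℝ≥0∞} (hσ : Measurable σ) {C : ℝ≥0∞}
    (hC : C ≠ ∞) (hσM : ∀ x, intervalMax volume σ x ≤ C * σ x) (hσf : ∀ᵐ x, σ x ≠ ∞)
    (hσ0 : ∀ᵐ x, σ x ≠ 0) {q : ℝ} (hq : 1 < q) {f : ℝ → ℝ≥0∞} (hf : Measurable f) :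
    ∫⁻ x, intervalMax volume f x ^ q * σ x ^ (1 - q)
      ≤ C ^ q * maxConst q * ∫⁻ x, f x ^ q * σ x ^ (1 - q) := by
  set ν := volume.withDensity σ with hν
  have hq0 : 0 < q := by linarith
  set h := fun x => f x / σ x with hh
  have hhm : Measurable h := hf.div hσ
  have hfh : ∀ᵐ x, f x = σ x * h x := by
    filter_upwards [hσf, hσ0] with x h1 h2
    rw [hh, ENNReal.mul_div_cancel h2 h1]
  have hconv : ∀ g : ℝ → ℝ≥0∞, Measurable g → ∫⁻ x, g x ∂ν = ∫⁻ x, g x * σ x := fun g hg => by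
    rw [hν, lintegral_withDensity_eq_lintegral_mul _ hσ hg]
    exact lintegral_congr fun x => mul_comm _ _
  have hpt : ∀ x, intervalMax volume f x ≤ intervalMax ν h x * (C * σ x) := by
    intro x
    refine intervalMax_le fun a b hx => ?_
    have hab : (a : ℝ) < b := hx.1.trans hx.2
    set V := volume (Ioo (a : ℝ) b) with hV
    have hV0 : V ≠ 0 := by rw [hV, Real.volume_Ioo]; simpa using hab
    have hVt : V ≠ ∞ := by simp [hV]
    have hνI : ν (Ioo (a : ℝ) b) = ∫⁻ y in Ioo (a : ℝ) b, σ y := withDensity_apply _ measurableSet_Ioo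
    have hle : ∀ y ∈ Ioo (a : ℝ) b, ν (Ioo (a : ℝ) b) / V ≤ C * σ y := fun y hy => by
      rw [hνI]; exact (le_intervalMax volume σ hy).trans (hσM y)
    have hνt : ν (Ioo (a : ℝ) b) ≠ ∞ := by
      intro htop
      have : ∀ᵐ y, y ∉ Ioo (a : ℝ) b := by
        filter_upwards [hσf] with y hy hyI
        have := hle y hyI
        rw [htop, ENNReal.top_div_of_ne_top hVt, top_le_iff] at this
        exact ENNReal.mul_ne_top hC hy this
      rw [ae_iff] at this
      simp only [not_not] at this
      exact hV0 this
    have hν0 : ν (Ioo (a : ℝ) b) ≠ 0 := by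
      rw [hνI]
      intro h
      rw [lintegral_eq_zero_iff hσ] at h
      have h' := (ae_restrict_iff' measurableSet_Ioo).1 h
      have : ∀ᵐ y, y ∉ Ioo (a : ℝ) b := by
        filter_upwards [hσ0, h'] with y hy h2 hyI
        exact hy (h2 hyI)
      rw [ae_iff] at this
      simp only [not_not] at this
      exact hV0 this
    calc (∫⁻ y in Ioo (a : ℝ) b, f y) / V
        = (∫⁻ y in Ioo (a : ℝ) b, h y ∂ν) / V := by
          rw [hν, setLIntegral_withDensity_eq_setLIntegral_mul _ hσ hhm measurableSet_Ioo]
          congr 1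
          exact lintegral_congr_ae (ae_restrict_of_ae hfh)
      _ = (∫⁻ y in Ioo (a : ℝ) b, h y ∂ν) / ν (Ioo (a : ℝ) b) * (ν (Ioo (a : ℝ) b) / V) := by
          rw [← mul_div_assoc, ENNReal.div_mul_cancel hν0 hνt]
      _ ≤ _ := mul_le_mul' (le_intervalMax ν h hx) (hle x hx)
  have hpow : ∀ᵐ x, ∀ z : ℝ≥0∞, (z * σ x) ^ q * σ x ^ (1 - q) = z ^ q * σ x := by
    filter_upwards [hσf, hσ0] with x h1 h2 z
    rw [ENNReal.mul_rpow_of_nonneg _ _ hq0.le, mul_assoc, ← ENNReal.rpow_add _ _ h2 h1]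
    simp
  calc ∫⁻ x, intervalMax volume f x ^ q * σ x ^ (1 - q)
      ≤ ∫⁻ x, C ^ q * (intervalMax ν h x ^ q * σ x) := by
        refine lintegral_mono_ae ?_
        filter_upwards [hpow] with x hx
        refine (mul_le_mul_left (ENNReal.rpow_le_rpow (hpt x) hq0.le) _).trans (le_of_eq ?_)
        rw [← mul_assoc, hx, ENNReal.mul_rpow_of_nonneg _ _ hq0.le]
        ring
    _ = C ^ q * ∫⁻ x, intervalMax ν h x ^ q ∂ν := by
        have hm := (measurable_intervalMax ν hhm).pow_const q
        exact (lintegral_const_mul _ (hm.mul hσ)).trans (by rw [hconv _ hm]; rfl)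
    _ ≤ C ^ q * (maxConst q * ∫⁻ x, h x ^ q ∂ν) := by
        gcongr; exact lintegral_intervalMax_rpow_le ν hq hhm
    _ = _ := by
        rw [hconv _ (hhm.pow_const q), mul_assoc]
        congr 2
        refine lintegral_congr_ae ?_
        filter_upwards [hpow, hfh] with x hx hfx
        rw [hfx, mul_comm (σ x), hx]

lemma intervalMax_ne_zero {f : ℝ → ℝ≥0∞} (hf : Measurable f) (h : ¬ f =ᵐ[volume] 0) (x : ℝ) :
    intervalMax volume f x ≠ 0 := by
  intro h0
  apply h
  obtain ⟨n₀, hn₀⟩ := exists_nat_gt |x|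
  have hn : ∀ n : ℕ, n₀ ≤ n → ∫⁻ y in Ioo (-(n : ℝ)) n, f y = 0 := by
    intro n hn
    have hnn : |x| < n := hn₀.trans_le (by exact_mod_cast hn)
    have := le_intervalMax volume f (x := x) (a := -(n : ℚ)) (b := (n : ℚ))
      ⟨by push_cast; exact (abs_lt.1 hnn).1, by push_cast; exact (abs_lt.1 hnn).2⟩
    rw [h0, nonpos_iff_eq_zero, ENNReal.div_eq_zero_iff] at this
    push_cast at this
    rcases this with h | h
    · exact h
    · simp at h
  have hae : ∀ᵐ y, ∀ n : ℕ, n₀ ≤ n → y ∈ Ioo (-(n : ℝ)) n → f y = 0 := by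
    rw [ae_all_iff]
    intro n
    by_cases hn' : n₀ ≤ n
    · have := (lintegral_eq_zero_iff hf).1 (hn n hn')
      filter_upwards [(ae_restrict_iff' measurableSet_Ioo).1 this] with y hy _ using hy
    · exact Eventually.of_forall fun y h => absurd h hn'
  filter_upwards [hae] with y hy
  obtain ⟨m, hm⟩ := exists_nat_gt |y|
  have : |y| < (max n₀ m : ℕ) := hm.trans_le (by exact_mod_cast le_max_right _ _)
  exact hy (max n₀ m) (le_max_left _ _) ⟨(abs_lt.1 this).1, (abs_lt.1 this).2⟩

lemma rubioDeFrancia_ne_zero {p : ℝ} (hp : 1 < p) {F : ℝ → ℝ≥0∞} (hF : Measurable F)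
    (h : ¬ F =ᵐ[volume] 0) (x : ℝ) : rubioDeFrancia p F x ≠ 0 := by
  intro h0
  have h1 := intervalMax_rubioDeFrancia_le hp hF x
  rw [h0, mul_zero, nonpos_iff_eq_zero] at h1
  have h2 := intervalMax_mono (ν := volume)
    (Eventually.of_forall fun y => le_rubioDeFrancia p F y) x
  rw [h1, nonpos_iff_eq_zero] at h2
  exact intervalMax_ne_zero hF h x h2

lemma rubioDeFrancia_ae_ne_top {p : ℝ} (hp : 1 < p) {F : ℝ → ℝ≥0∞} (hF : Measurable F)
    (h : ∫⁻ x, F x ^ p ≠ ∞) : ∀ᵐ x, rubioDeFrancia p F x ≠ ∞ := by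
  have h1 : ∫⁻ x, rubioDeFrancia p F x ^ p ≠ ∞ :=
    ((lintegral_rubioDeFrancia_rpow_le hp hF).trans_lt
      (ENNReal.mul_lt_top (by simp [ENNReal.rpow_lt_top_of_nonneg, (by linarith : 0 ≤ p)])
        h.lt_top)).ne
  filter_upwards [ae_lt_top ((measurable_rubioDeFrancia p hF).pow_const p) h1] with x hx hxt
  rw [hxt, ENNReal.top_rpow_of_pos (by linarith)] at hx
  exact lt_irrefl _ hx

/-- Extrapolation upwards: weighted bounds for all `A₁` weights imply `L^r` bounds, `r > 1`. -/
lemma lintegral_rpow_le_of_weighted {r s : ℝ} (hrs : r.HolderConjugate s) {a b : ℝ → ℝ≥0∞}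
    (ha : Measurable a) (hb : Measurable b) {K : ℝ≥0∞}
    (H : ∀ w : ℝ → ℝ≥0∞, Measurable w →
      (∀ x, intervalMax volume w x ≤ 2 * iterConst s * w x) → (∀ᵐ x, w x ≠ ∞) →
      (∀ᵐ x, w x ≠ 0) → ∫⁻ x, a x * w x ≤ K * ∫⁻ x, b x * w x) :
    ∫⁻ x, a x ^ r ≤ (2 * K) ^ r * ∫⁻ x, b x ^ r := by
  have hr := hrs.lt
  have hs := hrs.symm.lt
  have hr0 : 0 < r := by linarith
  have hs0 : 0 < s := by linarith
  set v : ℕ → ℝ → ℝ≥0∞ := fun n => (Icc (-(n : ℝ)) n).indicator fun x => min (a x) n with hv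
  have hvm : ∀ n, Measurable (v n) := fun n =>
    (ha.min measurable_const).indicator measurableSet_Icc
  have hva : ∀ n x, v n x ≤ a x := fun n x =>
    (indicator_le_self _ _ _).trans (min_le_left _ _)
  have hmono : Monotone fun n x => v n x ^ r := by
    intro m n hmn x
    refine ENNReal.rpow_le_rpow ?_ hr0.le
    have hmn' : (m : ℝ) ≤ n := by exact_mod_cast hmn
    by_cases hx : x ∈ Icc (-(m : ℝ)) m
    · have hx' : x ∈ Icc (-(n : ℝ)) n := ⟨by linarith [hx.1], by linarith [hx.2]⟩
      simp only [hv, indicator_of_mem hx, indicator_of_mem hx']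
      exact min_le_min_left _ (by exact_mod_cast hmn)
    · simp only [hv, indicator_of_notMem hx]
      exact zero_le
  have hsup : ∀ x, a x ^ r ≤ ⨆ n, v n x ^ r := by
    intro x
    obtain ⟨n₀, hn₀⟩ := exists_nat_ge |x|
    have hin : ∀ n : ℕ, n₀ ≤ n → v n x = min (a x) n := fun n hn => by
      have : |x| ≤ n := hn₀.trans (by exact_mod_cast hn)
      have hmem : x ∈ Icc (-(n : ℝ)) n := abs_le.1 this
      simp only [hv, indicator_of_mem hmem]
    refine le_of_forall_lt fun c hc => ?_
    have hc' : c ^ (1 / r) < a x := by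
      rw [one_div, ENNReal.rpow_inv_lt_iff hr0]; exact hc
    have hct : c ^ (1 / r) ≠ ∞ := hc'.ne_top
    obtain ⟨m, hm⟩ := ENNReal.exists_nat_gt hct
    refine lt_of_lt_of_le ?_ (le_iSup (fun n => v n x ^ r) (max n₀ m))
    rw [hin _ (le_max_left _ _), ← ENNReal.rpow_inv_lt_iff hr0, ← one_div]
    refine lt_min hc' (hm.trans_le ?_)
    exact_mod_cast le_max_right _ _
  have hY : ∀ n, ∫⁻ x, v n x ^ r ≤ (2 * K) ^ r * ∫⁻ x, b x ^ r := by
    intro n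
    set Y := ∫⁻ x, v n x ^ r with hYdef
    have hYt : Y ≠ ∞ := by
      have : ∀ x, v n x ^ r ≤ (Icc (-(n : ℝ)) n).indicator (fun _ => (n : ℝ≥0∞) ^ r) x := by
        intro x
        by_cases hx : x ∈ Icc (-(n : ℝ)) n
        · simp only [hv, indicator_of_mem hx]
          exact ENNReal.rpow_le_rpow (min_le_right _ _) hr0.le
        · simp only [hv, indicator_of_notMem hx]
          simp [hr0]
      refine ((lintegral_mono this).trans_lt ?_).ne
      rw [lintegral_indicator measurableSet_Icc, setLIntegral_const]
      exact ENNReal.mul_lt_top (ENNReal.rpow_lt_top_of_nonneg hr0.le (by simp)) (by simp)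
    by_cases hY0 : Y = 0
    · rw [hY0]; exact zero_le
    set u : ℝ → ℝ≥0∞ := fun x => v n x ^ (r - 1) with hu
    have hum : Measurable u := (hvm n).pow_const _
    have hus : ∀ x, u x ^ s = v n x ^ r := fun x => by
      rw [hu, ← ENNReal.rpow_mul, hrs.sub_one_mul_conj]
    have hu0 : ¬ u =ᵐ[volume] 0 := by
      intro h
      apply hY0
      rw [hYdef, lintegral_eq_zero_iff ((hvm n).pow_const r)]
      filter_upwards [h] with x hx
      rw [← hus, hx]; simp [hs0]
    have hRs := lintegral_rubioDeFrancia_rpow_le hs hum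
    simp only [hus] at hRs
    rw [← hYdef] at hRs
    have hRf := rubioDeFrancia_ae_ne_top hs hum (by simpa only [hus] using hYt)
    have h1 : Y ≤ K * ∫⁻ x, b x * rubioDeFrancia s u x := by
      refine le_trans (lintegral_mono fun x => ?_) (H _ (measurable_rubioDeFrancia s hum)
        (intervalMax_rubioDeFrancia_le hs hum) hRf
        (Eventually.of_forall (rubioDeFrancia_ne_zero hs hum hu0)))
      calc v n x ^ r = v n x * u x := by
            have := ENNReal.rpow_add_of_nonneg (x := v n x) 1 (r - 1) zero_le_one (by linarith)
            rwa [add_sub_cancel, ENNReal.rpow_one] at this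
        _ ≤ a x * rubioDeFrancia s u x := mul_le_mul' (hva n x) (le_rubioDeFrancia s u x)
    have h2 := ENNReal.lintegral_mul_le_Lp_mul_Lq volume hrs hb.aemeasurable
      (measurable_rubioDeFrancia s hum).aemeasurable
    have h3 : Y ≤ 2 * K * (∫⁻ x, b x ^ r) ^ (1 / r) * Y ^ (1 / s) := by
      calc Y ≤ K * ((∫⁻ x, b x ^ r) ^ (1 / r) * (∫⁻ x, rubioDeFrancia s u x ^ s) ^ (1 / s)) :=
            h1.trans (mul_le_mul_right h2 _)
        _ ≤ K * ((∫⁻ x, b x ^ r) ^ (1 / r) * (2 ^ s * Y) ^ (1 / s)) := by gcongr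
        _ = _ := by
          rw [ENNReal.mul_rpow_of_nonneg _ _ (by positivity), ← ENNReal.rpow_mul,
            mul_one_div_cancel hs0.ne', ENNReal.rpow_one]; ring
    have h4 : Y ^ (1 / r) ≤ 2 * K * (∫⁻ x, b x ^ r) ^ (1 / r) := by
      have hYs : Y ^ (1 / s) ≠ 0 := by simp [hY0, hYt]
      have hYs' : Y ^ (1 / s) ≠ ∞ := ENNReal.rpow_ne_top_of_nonneg (by positivity) hYt
      rw [← ENNReal.mul_le_mul_iff_left hYs hYs', ← ENNReal.rpow_add _ _ hY0 hYt]
      have : 1 / r + 1 / s = 1 := by simpa using hrs.inv_add_inv_eq_one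
      rw [this, ENNReal.rpow_one]
      exact h3
    have h5 := ENNReal.rpow_le_rpow h4 hr0.le
    rwa [← ENNReal.rpow_mul, one_div_mul_cancel hr0.ne', ENNReal.rpow_one,
      ENNReal.mul_rpow_of_nonneg _ _ hr0.le, ← ENNReal.rpow_mul, one_div_mul_cancel hr0.ne',
      ENNReal.rpow_one] at h5
  calc ∫⁻ x, a x ^ r ≤ ∫⁻ x, ⨆ n, v n x ^ r := lintegral_mono hsup
    _ = ⨆ n, ∫⁻ x, v n x ^ r := lintegral_iSup (fun n => (hvm n).pow_const r) hmono
    _ ≤ _ := iSup_le hY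

/-- Extrapolation downwards. -/
lemma lintegral_rpow_le_of_weighted_neg {p q : ℝ} (hp : 1 < p) (hpq : p < q) {a b : ℝ → ℝ≥0∞}
    (ha : Measurable a) (hb : Measurable b) {K : ℝ≥0∞}
    (H0 : b =ᵐ[volume] 0 → a =ᵐ[volume] 0)
    (H : ∀ σ : ℝ → ℝ≥0∞, Measurable σ →
      (∀ x, intervalMax volume σ x ≤ (2 * iterConst p) ^ ((q - p) / (q - 1)) * σ x) →
      (∀ᵐ x, σ x ≠ ∞) →
      (∀ᵐ x, σ x ≠ 0) → ∫⁻ x, a x * σ x ^ (1 - q) ≤ K * ∫⁻ x, b x * σ x ^ (1 - q)) :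
    ∫⁻ x, a x ^ (p / q) ≤ (K + 1) * 2 ^ p * ∫⁻ x, b x ^ (p / q) := by
  have hq : 1 < q := hp.trans hpq
  have hp0 : 0 < p := by linarith
  have hq0 : 0 < q := by linarith
  by_cases hbt : ∫⁻ x, b x ^ (p / q) = ∞
  · rw [hbt, ENNReal.mul_top]
    · exact le_top
    · simp [hp0]
  by_cases hb0 : b =ᵐ[volume] 0
  · have : ∫⁻ x, a x ^ (p / q) = 0 := by
      rw [lintegral_eq_zero_iff (ha.pow_const _)]
      filter_upwards [H0 hb0] with x hx
      rw [hx]; simp only [Pi.zero_apply]; exact ENNReal.zero_rpow_of_pos (by positivity)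
    rw [this]; exact zero_le
  set F : ℝ → ℝ≥0∞ := fun x => b x ^ (1 / q) with hF
  have hFm : Measurable F := hb.pow_const _
  have hFp : ∀ x, F x ^ p = b x ^ (p / q) := fun x => by
    rw [hF, ← ENNReal.rpow_mul]; congr 1; field_simp
  have hFq : ∀ x, F x ^ q = b x := fun x => by
    rw [hF, ← ENNReal.rpow_mul, one_div_mul_cancel hq0.ne', ENNReal.rpow_one]
  have hF0 : ¬ F =ᵐ[volume] 0 := by
    intro h; apply hb0
    filter_upwards [h] with x hx
    rw [← hFq, hx]; simp [hq0]
  set R := rubioDeFrancia p F with hR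
  have hRm : Measurable R := measurable_rubioDeFrancia p hFm
  have hR0 : ∀ x, R x ≠ 0 := rubioDeFrancia_ne_zero hp hFm hF0
  have hRt : ∀ᵐ x, R x ≠ ∞ := rubioDeFrancia_ae_ne_top hp hFm (by simpa only [hFp] using hbt)
  set δ := (q - p) / (q - 1) with hδ
  have hδ0 : 0 < δ := div_pos (by linarith) (by linarith)
  have hδ1 : δ < 1 := by rw [hδ, div_lt_one (by linarith)]; linarith
  have hpow : ∀ x, (R x ^ δ) ^ (1 - q) = R x ^ (p - q) := fun x => by
    rw [← ENNReal.rpow_mul]; congr 1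
    have : q - 1 ≠ 0 := by linarith
    rw [hδ]; field_simp; ring
  have h1 := H (fun x => R x ^ δ) (hRm.pow_const δ) (fun x => by
      refine (intervalMax_volume_rpow_le hRm hδ0 hδ1 x).trans ?_
      rw [← ENNReal.mul_rpow_of_nonneg _ _ hδ0.le]
      exact ENNReal.rpow_le_rpow (intervalMax_rubioDeFrancia_le hp hFm x) hδ0.le)
    (by filter_upwards [hRt] with x hx using ENNReal.rpow_ne_top_of_nonneg hδ0.le hx)
    (by filter_upwards [hRt] with x hx; simp [hR0 x, hx])
  simp only [hpow] at h1
  have h2 : ∫⁻ x, b x * R x ^ (p - q) ≤ ∫⁻ x, R x ^ p := by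
    refine lintegral_mono_ae ?_
    filter_upwards [hRt] with x hx
    calc b x * R x ^ (p - q) ≤ R x ^ q * R x ^ (p - q) := by
          gcongr
          rw [← hFq]
          exact ENNReal.rpow_le_rpow (le_rubioDeFrancia p F x) hq0.le
      _ = R x ^ p := by rw [← ENNReal.rpow_add _ _ (hR0 x) hx]; congr 1; ring
  have h3 : ∫⁻ x, R x ^ p ≤ 2 ^ p * ∫⁻ x, b x ^ (p / q) := by
    simpa only [hFp] using lintegral_rubioDeFrancia_rpow_le hp hFm
  set r := p / q with hr
  have hr0 : 0 < r := by positivity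
  have hr1 : r < 1 := by rw [hr, div_lt_one hq0]; exact hpq
  set Z := ∫⁻ x, R x ^ p with hZ
  have h4 : ∫⁻ x, a x ^ r ≤ (∫⁻ x, a x * R x ^ (p - q)) ^ r * Z ^ (1 - r) := by
    have := ENNReal.lintegral_mul_norm_pow_le (μ := volume) (f := fun x => a x * R x ^ (p - q))
      (g := fun x => R x ^ p) (ha.mul (hRm.pow_const _)).aemeasurable
      (hRm.pow_const p).aemeasurable hr0.le (sub_nonneg.2 hr1.le) (by ring)
    refine le_trans (le_of_eq (lintegral_congr_ae ?_)) this
    filter_upwards [hRt] with x hx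
    rw [ENNReal.mul_rpow_of_nonneg _ _ hr0.le, ← ENNReal.rpow_mul, ← ENNReal.rpow_mul, mul_assoc,
      ← ENNReal.rpow_add _ _ (hR0 x) hx]
    have : (p - q) * r + p * (1 - r) = 0 := by rw [hr]; field_simp; ring
    rw [this, ENNReal.rpow_zero, mul_one]
  have hK1 : K ^ r ≤ K + 1 := by
    rcases le_total K 1 with h | h
    · exact (ENNReal.rpow_le_one h hr0.le).trans le_add_self
    · refine le_trans ?_ le_self_add
      simpa using ENNReal.rpow_le_rpow_of_exponent_le h hr1.le
  calc ∫⁻ x, a x ^ r ≤ (K * Z) ^ r * Z ^ (1 - r) := by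
        refine h4.trans ?_
        gcongr
        exact h1.trans (mul_le_mul_right h2 _)
    _ = K ^ r * Z := by
        rw [ENNReal.mul_rpow_of_nonneg _ _ hr0.le, mul_assoc,
          ← ENNReal.rpow_add_of_nonneg _ _ hr0.le (sub_nonneg.2 hr1.le)]
        simp
    _ ≤ (K + 1) * (2 ^ p * ∫⁻ x, b x ^ r) := mul_le_mul' hK1 h3
    _ = _ := by ring

lemma lintegral_mixed_weighted_le {q : ℝ} {C : ℝ≥0∞} (μ : Measure ℝ) [SFinite μ]
    {f : ℝ → ℝ → ℝ≥0∞} (hf : Measurable (Function.uncurry f)) {w : ℝ → ℝ≥0∞} (hw : Measurable w)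
    (H : ∀ g : ℝ → ℝ≥0∞, Measurable g →
      ∫⁻ x, intervalMax volume g x ^ q * w x ≤ C * ∫⁻ x, g x ^ q * w x) :
    ∫⁻ x, (∫⁻ t, intervalMax volume (fun y => f y t) x ^ q ∂μ) * w x
      ≤ C * ∫⁻ x, (∫⁻ t, f x t ^ q ∂μ) * w x := by
  have sw : ∀ F : ℝ → ℝ → ℝ≥0∞, Measurable (Function.uncurry F) →
      ∫⁻ x, (∫⁻ t, F x t ^ q ∂μ) * w x = ∫⁻ t, (∫⁻ x, F x t ^ q * w x) ∂μ := by
    intro F hF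
    rw [← lintegral_lintegral_swap]
    · refine lintegral_congr fun x => ?_
      rw [lintegral_mul_const]
      exact hF.of_uncurry_left.pow_const q
    · exact ((hF.pow_const q).mul (hw.comp measurable_fst)).aemeasurable
  have hM : Measurable (Function.uncurry fun x t => intervalMax volume (fun y => f y t) x) :=
    measurable_intervalMax_prod volume hf
  have hG : Measurable fun t => ∫⁻ x, f x t ^ q * w x := by
    refine Measurable.lintegral_prod_left' (f := fun z : ℝ × ℝ => f z.1 z.2 ^ q * w z.1) ?_
    exact (hf.pow_const q).mul (hw.comp measurable_fst)
  rw [sw _ hM, sw _ hf, ← lintegral_const_mul _ hG]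
  exact lintegral_mono fun t => H _ hf.of_uncurry_right

/-- The vector-valued maximal inequality of Fefferman–Stein type, in `L^p_x L^q_t`. -/
theorem exists_lintegral_mixed_intervalMax_le {p q : ℝ} (hp : 1 < p) (hq : 1 < q) :
    ∃ C : ℝ≥0∞, C ≠ ∞ ∧ ∀ (μ : Measure ℝ) [SFinite μ] (f : ℝ → ℝ → ℝ≥0∞),
      Measurable (Function.uncurry f) →
      ∫⁻ x, (∫⁻ t, intervalMax volume (fun y => f y t) x ^ q ∂μ) ^ (p / q)
        ≤ C * ∫⁻ x, (∫⁻ t, f x t ^ q ∂μ) ^ (p / q) := by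
  have hq0 : 0 < q := by linarith
  have hp0 : 0 < p := by linarith
  have ma : ∀ (μ : Measure ℝ) [SFinite μ] (f : ℝ → ℝ → ℝ≥0∞), Measurable (Function.uncurry f) →
      Measurable fun x => ∫⁻ t, intervalMax volume (fun y => f y t) x ^ q ∂μ :=
    fun μ _ f hf => ((measurable_intervalMax_prod volume hf).pow_const q).lintegral_prod_right'
  have mb : ∀ (μ : Measure ℝ) [SFinite μ] (f : ℝ → ℝ → ℝ≥0∞), Measurable (Function.uncurry f) →
      Measurable fun x => ∫⁻ t, f x t ^ q ∂μ :=
    fun μ _ f hf => (hf.pow_const q).lintegral_prod_right'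
  have one : ∀ (μ : Measure ℝ) [SFinite μ] (f : ℝ → ℝ → ℝ≥0∞), Measurable (Function.uncurry f) →
      ∫⁻ x, (∫⁻ t, intervalMax volume (fun y => f y t) x ^ q ∂μ)
        ≤ maxConst q * ∫⁻ x, (∫⁻ t, f x t ^ q ∂μ) := by
    intro μ _ f hf
    simpa using lintegral_mixed_weighted_le (C := maxConst q) μ hf measurable_one
      (fun g hg => by simpa using lintegral_intervalMax_rpow_le volume hq hg)
  rcases lt_trichotomy p q with h | h | h
  · set D := (2 * iterConst p) ^ ((q - p) / (q - 1)) with hD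
    have hDt : D ≠ ∞ := ENNReal.rpow_ne_top_of_nonneg
      (div_nonneg (by linarith) (by linarith)) (ENNReal.mul_ne_top (by simp) (iterConst_ne_top hp))
    have hKt : D ^ q * maxConst q ≠ ∞ := ENNReal.mul_ne_top
      (ENNReal.rpow_ne_top_of_nonneg hq0.le hDt) (maxConst_ne_top hq)
    refine ⟨(D ^ q * maxConst q + 1) * 2 ^ p, ENNReal.mul_ne_top (by simp [hKt])
      (ENNReal.rpow_ne_top_of_nonneg hp0.le (by simp)), fun μ _ f hf => ?_⟩
    refine lintegral_rpow_le_of_weighted_neg hp h (ma μ f hf) (mb μ f hf) ?_ ?_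
    · intro h0
      have := one μ f hf
      rw [(lintegral_eq_zero_iff (mb μ f hf)).2 h0, mul_zero, nonpos_iff_eq_zero,
        lintegral_eq_zero_iff (ma μ f hf)] at this
      exact this
    · intro σ hσ h1 h2 h3
      exact lintegral_mixed_weighted_le μ hf (hσ.pow_const _) fun g hg =>
        lintegral_intervalMax_rpow_mul_rpow_le hσ hDt h1 h2 h3 hq hg
  · subst h
    refine ⟨maxConst p, maxConst_ne_top hp, fun μ _ f hf => ?_⟩
    simpa [div_self hp0.ne'] using one μ f hf
  · have hr : 1 < p / q := by rwa [one_lt_div hq0]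
    have hrs := Real.HolderConjugate.conjExponent hr
    set s := Real.conjExponent (p / q) with hs
    have hDt : 2 * iterConst s ≠ ∞ :=
      ENNReal.mul_ne_top (by simp) (iterConst_ne_top hrs.symm.lt)
    have hKt : (2 * iterConst s) ^ q * maxConst q ≠ ∞ := ENNReal.mul_ne_top
      (ENNReal.rpow_ne_top_of_nonneg hq0.le hDt) (maxConst_ne_top hq)
    refine ⟨(2 * ((2 * iterConst s) ^ q * maxConst q)) ^ (p / q),
      ENNReal.rpow_ne_top_of_nonneg (by positivity) (ENNReal.mul_ne_top (by simp) hKt),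
      fun μ _ f hf => ?_⟩
    refine lintegral_rpow_le_of_weighted hrs (ma μ f hf) (mb μ f hf) ?_
    intro w hw h1 h2 h3
    exact lintegral_mixed_weighted_le μ hf hw fun g hg =>
      lintegral_intervalMax_rpow_mul_le hw hDt h1 h2 h3 hq hg

/-- The maximal average of `f` over rational intervals containing `[c, c + h]`. -/
def scaleMax (f : ℝ → ℝ≥0∞) (h c : ℝ) : ℝ≥0∞ :=
  ⨆ (a : ℚ) (b : ℚ) (_ : (a : ℝ) < c ∧ c + h < b), (∫⁻ y in Ioo (a : ℝ) b, f y) / volume (Ioo (a : ℝ) b)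

lemma le_scaleMax (f : ℝ → ℝ≥0∞) {h c : ℝ} {a b : ℚ} (hab : (a : ℝ) < c ∧ c + h < b) :
    (∫⁻ y in Ioo (a : ℝ) b, f y) / volume (Ioo (a : ℝ) b) ≤ scaleMax f h c :=
  le_iSup_of_le a <| le_iSup_of_le b <| le_iSup_of_le hab le_rfl

lemma scaleMax_le {f : ℝ → ℝ≥0∞} {h c : ℝ} {K : ℝ≥0∞}
    (H : ∀ a b : ℚ, (a : ℝ) < c → c + h < b →
      (∫⁻ y in Ioo (a : ℝ) b, f y) / volume (Ioo (a : ℝ) b) ≤ K) : scaleMax f h c ≤ K :=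
  iSup_le fun a => iSup_le fun b => iSup_le fun hx => H a b hx.1 hx.2

lemma measurable_scaleMax (f : ℝ → ℝ≥0∞) (h : ℝ) : Measurable (scaleMax f h) := by
  unfold scaleMax
  refine Measurable.iSup fun a => Measurable.iSup fun b => ?_
  have h1 : (fun c : ℝ => ⨆ (_ : (a : ℝ) < c ∧ c + h < b),
      (∫⁻ y in Ioo (a : ℝ) b, f y) / volume (Ioo (a : ℝ) b)) =
      {c : ℝ | (a : ℝ) < c ∧ c + h < b}.indicator
        (fun _ => (∫⁻ y in Ioo (a : ℝ) b, f y) / volume (Ioo (a : ℝ) b)) := by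
    ext c
    by_cases hc : (a : ℝ) < c ∧ c + h < b
    · rw [indicator_of_mem (by exact hc)]; simp only [hc, and_self, iSup_pos]
    · rw [indicator_of_notMem (by exact hc)]; simp only [hc, iSup_false]; rfl
  rw [h1]
  refine Measurable.indicator measurable_const ?_
  exact (measurableSet_lt measurable_const measurable_id).inter
    (measurableSet_lt (measurable_id.add_const h) measurable_const)

lemma scaleMax_le_intervalMax (f : ℝ → ℝ≥0∞) {h : ℝ} (hh : 0 ≤ h) (c : ℝ) :
    scaleMax f h c ≤ intervalMax volume f c :=
  scaleMax_le fun a b ha hb => le_intervalMax volume f ⟨ha, by linarith⟩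

lemma scaleMax_le_mul (f : ℝ → ℝ≥0∞) {h h' c c' : ℝ} (hh : 0 ≤ h) (n : ℕ) (h1 : c - n * h ≤ c')
    (h2 : c' + h' ≤ c + h + n * h) : scaleMax f h c ≤ (2 * n + 1) * scaleMax f h' c' := by
  refine scaleMax_le fun a b ha hb => ?_
  have hn : (0 : ℝ) ≤ n := n.cast_nonneg
  have hL : h < (b : ℝ) - a := by linarith
  have hnL : n * h ≤ n * ((b : ℝ) - a) := mul_le_mul_of_nonneg_left hL.le hn
  have hL0 : 0 < (b : ℝ) - a := by linarith
  have hsub : Ioo (a : ℝ) b ⊆ Ioo (((a - n * (b - a) : ℚ)) : ℝ) ((b + n * (b - a) : ℚ) : ℝ) := by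
    push_cast
    exact Ioo_subset_Ioo (by nlinarith) (by nlinarith)
  have key := le_scaleMax f (h := h') (c := c') (a := a - n * (b - a)) (b := b + n * (b - a))
    ⟨by push_cast; linarith, by push_cast; linarith⟩
  refine le_trans ?_ (mul_le_mul_right key _)
  have hv : volume (Ioo (((a - n * (b - a) : ℚ)) : ℝ) ((b + n * (b - a) : ℚ) : ℝ))
      = (2 * n + 1) * volume (Ioo (a : ℝ) b) := by
    rw [Real.volume_Ioo, Real.volume_Ioo]
    have : (2 * n + 1 : ℝ≥0∞) = ENNReal.ofReal (2 * n + 1) := by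
      rw [ENNReal.ofReal_add (by positivity) zero_le_one, ENNReal.ofReal_mul (by norm_num)]; simp
    rw [this, ← ENNReal.ofReal_mul (by positivity)]
    push_cast; congr 1; ring
  rw [hv, div_eq_mul_inv, div_eq_mul_inv, ENNReal.mul_inv (Or.inl (by simp))
    (Or.inl (by finiteness))]
  calc _ ≤ (∫⁻ y in Ioo (((a - n * (b - a) : ℚ)) : ℝ) ((b + n * (b - a) : ℚ) : ℝ), f y)
        * (volume (Ioo (a : ℝ) b))⁻¹ := mul_le_mul_left (lintegral_mono_set hsub) _
    _ = ((2 * n + 1 : ℝ≥0∞) * (2 * n + 1 : ℝ≥0∞)⁻¹) * ((∫⁻ y in Ioo (((a - n * (b - a) : ℚ)) : ℝ)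
          ((b + n * (b - a) : ℚ) : ℝ), f y) * (volume (Ioo (a : ℝ) b))⁻¹) := by
        rw [ENNReal.mul_inv_cancel (by simp) (by finiteness), one_mul]
    _ = _ := by ring

lemma scaleMax_anti (f : ℝ → ℝ≥0∞) {h h' : ℝ} (hh : 0 ≤ h') (hle : h' ≤ h) (c : ℝ) :
    scaleMax f h c ≤ scaleMax f h' c := by
  simpa using scaleMax_le_mul f (c := c) (c' := c) (hh.trans hle) 0 (by simp) (by simpa)

/-- Harnack inequality for `scaleMax`. -/
lemma scaleMax_le_add_mul (f : ℝ → ℝ≥0∞) {h : ℝ} (hh : 0 ≤ h) (c y : ℝ) :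
    scaleMax f h c ≤ ENNReal.ofReal (3 + 2 * |y|) * scaleMax f h (c + h * y) := by
  have hy : |y| ≤ ⌈|y|⌉₊ := Nat.le_ceil _
  have hy' : (⌈|y|⌉₊ : ℝ) < |y| + 1 := Nat.ceil_lt_add_one (abs_nonneg y)
  have habs : |h * y| ≤ ⌈|y|⌉₊ * h := by
    rw [abs_mul, abs_of_nonneg hh, mul_comm]; gcongr
  have := abs_le.1 habs
  refine (scaleMax_le_mul f (c := c) (h' := h) (c' := c + h * y) hh ⌈|y|⌉₊ (by linarith)
    (by linarith)).trans ?_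
  gcongr
  rw [show (2 * (⌈|y|⌉₊ : ℝ≥0∞) + 1) = ENNReal.ofReal (2 * ⌈|y|⌉₊ + 1) by
    rw [ENNReal.ofReal_add (by positivity) zero_le_one, ENNReal.ofReal_mul (by norm_num)]; simp]
  exact ENNReal.ofReal_le_ofReal (by linarith)

lemma lintegral_Ioo_le_scaleMax (f : ℝ → ℝ≥0∞) {h R : ℝ} (hR : 0 < R) (hhR : h ≤ R) (c : ℝ) :
    ∫⁻ y in Ioo (c - R) (c + R), f y ≤ ENNReal.ofReal (4 * R) * scaleMax f h c := by
  obtain ⟨a, ha1, ha2⟩ := exists_rat_btwn (show c - 2 * R < c - R by linarith)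
  obtain ⟨b, hb1, hb2⟩ := exists_rat_btwn (show c + R < c + 2 * R by linarith)
  have key := le_scaleMax f (h := h) (c := c) (a := a) (b := b) ⟨by linarith, by linarith⟩
  rw [ENNReal.div_le_iff (by rw [Real.volume_Ioo]; simp; exact_mod_cast (by linarith : (a : ℝ) < b))
    (by simp), mul_comm] at key
  refine (lintegral_mono_set (Ioo_subset_Ioo ha2.le hb1.le)).trans (key.trans ?_)
  rw [Real.volume_Ioo]
  gcongr
  linarith

lemma lintegral_comp_sub_mul {h : ℝ} (hh : 0 < h) (c : ℝ) {f : ℝ → ℝ≥0∞} (hf : Measurable f) :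
    ∫⁻ y, f (c - h * y) = ENNReal.ofReal h⁻¹ * ∫⁻ y, f y := by
  have h1 := Real.smul_map_volume_mul_left (a := h⁻¹) (by positivity)
  have hm : Measurable fun y => f (c - y) := hf.comp (measurable_const.sub measurable_id)
  have h2 : ∫⁻ y, f (c - h * y) ∂(ENNReal.ofReal |h⁻¹| • Measure.map (fun y => h⁻¹ * y) volume)
      = ENNReal.ofReal h⁻¹ * ∫⁻ y, f y := by
    have hm' : Measurable fun y => f (c - h * y) := hm.comp (measurable_const_mul h)
    rw [lintegral_smul_measure, lintegral_map hm' (measurable_const_mul _), abs_of_pos (by positivity), smul_eq_mul]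
    congr 1
    simp only [mul_inv_cancel_left₀ hh.ne']
    exact lintegral_sub_left_eq_self f c
  rwa [h1] at h2

lemma lintegral_mul_comp_le_scaleMax {φ f : ℝ → ℝ≥0∞} (hf : Measurable f) {K : ℝ≥0∞}
    (hφ : ∀ y, φ y ≤ K * ENNReal.ofReal ((1 + |y|) ^ (-2 : ℤ))) {h : ℝ} (hh : 0 < h) (c : ℝ) :
    ∫⁻ y, φ y * f (c - h * y) ≤ 32 * K * scaleMax f h c := by
  have hdy : ∀ y : ℝ, ENNReal.ofReal ((1 + |y|) ^ (-2 : ℤ)) ≤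
      ∑' j : ℕ, 4 * 4⁻¹ ^ j * (Ioo (-(2 : ℝ) ^ j) (2 ^ j)).indicator 1 y := by
    intro y
    have hex : ∃ j : ℕ, |y| < 2 ^ j := pow_unbounded_of_one_lt _ one_lt_two
    classical
    set j := Nat.find hex with hj
    have hjs : |y| < 2 ^ j := Nat.find_spec hex
    refine le_trans ?_ (ENNReal.le_tsum j)
    have hmem : y ∈ Ioo (-(2 : ℝ) ^ j) (2 ^ j) := abs_lt.1 hjs
    rw [indicator_of_mem hmem, Pi.one_apply, mul_one]
    have h4 : (4 * 4⁻¹ ^ j : ℝ≥0∞) = ENNReal.ofReal (4 * 4⁻¹ ^ j) := by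
      rw [ENNReal.ofReal_mul (by norm_num), ENNReal.ofReal_pow (by norm_num),
        ENNReal.ofReal_inv_of_pos (by norm_num)]; simp
    rw [h4]
    refine ENNReal.ofReal_le_ofReal ?_
    rcases Nat.eq_zero_or_pos j with h0 | h0
    · rw [h0, pow_zero, mul_one]
      have : (1 + |y|) ^ (-2 : ℤ) ≤ 1 := zpow_le_one_of_nonpos₀ (by linarith [abs_nonneg y]) (by norm_num)
      linarith
    · have hmin : ¬ |y| < 2 ^ (j - 1) := Nat.find_min hex (by omega)
      obtain ⟨i, hi⟩ : ∃ i, j = i + 1 := ⟨j - 1, by omega⟩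
      rw [hi] at hmin ⊢
      simp only [add_tsub_cancel_right, not_lt] at hmin
      have hp : (0 : ℝ) < 2 ^ i := by positivity
      rw [zpow_neg, pow_succ, show (4 : ℝ) * (4⁻¹ ^ i * 4⁻¹) = (4 ^ i)⁻¹ by rw [inv_pow]; ring]
      refine inv_anti₀ (by positivity) ?_
      rw [show (4 : ℝ) ^ i = (2 ^ i) ^ 2 by rw [← pow_mul, mul_comm, pow_mul]; norm_num]
      norm_cast
      push_cast
      gcongr
      linarith
  have hterm : ∀ j : ℕ, ∫⁻ y, (Ioo (-(2 : ℝ) ^ j) (2 ^ j)).indicator 1 y * f (c - h * y) ≤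
      4 * 2 ^ j * scaleMax f h c := by
    intro j
    set R : ℝ := 2 ^ j * h with hR
    have hR0 : 0 < R := by positivity
    have hhR : h ≤ R := by
      rw [hR]; exact le_mul_of_one_le_left hh.le (one_le_pow₀ one_le_two)
    have heq : ∀ y, (Ioo (-(2 : ℝ) ^ j) (2 ^ j)).indicator (1 : ℝ → ℝ≥0∞) y * f (c - h * y) =
        (Ioo (c - R) (c + R)).indicator f (c - h * y) := by
      intro y
      have hiff : y ∈ Ioo (-(2 : ℝ) ^ j) (2 ^ j) ↔ c - h * y ∈ Ioo (c - R) (c + R) := by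
        simp only [mem_Ioo, hR]
        constructor
        · rintro ⟨h1, h2⟩; constructor <;> nlinarith
        · rintro ⟨h1, h2⟩; constructor <;> nlinarith
      by_cases hy : y ∈ Ioo (-(2 : ℝ) ^ j) (2 ^ j)
      · rw [indicator_of_mem hy, indicator_of_mem (hiff.1 hy)]; simp
      · rw [indicator_of_notMem hy, indicator_of_notMem (fun h => hy (hiff.2 h))]; simp
    rw [lintegral_congr heq, lintegral_comp_sub_mul hh c (hf.indicator measurableSet_Ioo),
      lintegral_indicator measurableSet_Ioo]
    refine (mul_le_mul_right (lintegral_Ioo_le_scaleMax f hR0 hhR c) _).trans (le_of_eq ?_)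
    rw [← mul_assoc, ← ENNReal.ofReal_mul (by positivity)]
    congr 1
    rw [show h⁻¹ * (4 * R) = 4 * 2 ^ j by rw [hR]; field_simp]
    rw [ENNReal.ofReal_mul (by norm_num), ENNReal.ofReal_pow (by norm_num)]; simp
  have hfm : Measurable fun y => f (c - h * y) :=
    hf.comp (measurable_const.sub (measurable_const_mul h))
  calc ∫⁻ y, φ y * f (c - h * y)
      ≤ ∫⁻ y, ∑' j : ℕ, K * (4 * 4⁻¹ ^ j) *
          ((Ioo (-(2 : ℝ) ^ j) (2 ^ j)).indicator 1 y * f (c - h * y)) := by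
        refine lintegral_mono fun y => ?_
        calc φ y * f (c - h * y) ≤ K * (∑' j : ℕ, 4 * 4⁻¹ ^ j *
              (Ioo (-(2 : ℝ) ^ j) (2 ^ j)).indicator 1 y) * f (c - h * y) :=
              mul_le_mul_left ((hφ y).trans (mul_le_mul_right (hdy y) _)) _
          _ = _ := by
              rw [← ENNReal.tsum_mul_left, ← ENNReal.tsum_mul_right]
              exact tsum_congr fun j => by ring
    _ = ∑' j : ℕ, K * (4 * 4⁻¹ ^ j) *
          ∫⁻ y, (Ioo (-(2 : ℝ) ^ j) (2 ^ j)).indicator 1 y * f (c - h * y) := by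
        have hm : ∀ j : ℕ, Measurable fun y =>
            (Ioo (-(2 : ℝ) ^ j) (2 ^ j)).indicator (1 : ℝ → ℝ≥0∞) y * f (c - h * y) := fun j =>
          (measurable_one.indicator measurableSet_Ioo).mul hfm
        rw [lintegral_tsum fun j => ((hm j).const_mul _).aemeasurable]
        exact tsum_congr fun j => lintegral_const_mul _ (hm j)
    _ ≤ ∑' j : ℕ, K * (4 * 4⁻¹ ^ j) * (4 * 2 ^ j * scaleMax f h c) :=
        ENNReal.tsum_le_tsum fun j => mul_le_mul_right (hterm j) _
    _ = ∑' j : ℕ, 16 * K * scaleMax f h c * 2⁻¹ ^ j := by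
        refine tsum_congr fun j => ?_
        have : (4⁻¹ ^ j * 2 ^ j : ℝ≥0∞) = 2⁻¹ ^ j := by
          rw [← mul_pow]; congr 1
          rw [show (4 : ℝ≥0∞) = 2 * 2 by norm_num, ENNReal.mul_inv (by simp) (by simp), mul_assoc,
            ENNReal.inv_mul_cancel (by simp) (by simp), mul_one]
        rw [← this]; ring
    _ = _ := by
        rw [ENNReal.tsum_mul_left, ENNReal.tsum_geometric, ENNReal.one_sub_inv_two, inv_inv]; ring

/-- The average of `G` over `[c, c + h]`. -/
def intervalAvg (G : ℝ → ℂ) (h c : ℝ) : ℂ := (h⁻¹ : ℝ) • ∫ y in c..(c + h), G y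

/-- Half the difference of the averages of `G` over the two halves of `[c, c + h]`. -/
def haarDiff (G : ℝ → ℂ) (h c : ℝ) : ℂ :=
  (2⁻¹ : ℝ) • (intervalAvg G (h / 2) c - intervalAvg G (h / 2) (c + h / 2))

lemma continuous_intervalAvg {G : ℝ → ℂ} (hG : ∀ a b, IntervalIntegrable G volume a b) (h : ℝ) :
    Continuous (intervalAvg G h) := by
  unfold intervalAvg
  have h0 := intervalIntegral.continuous_primitive hG 0
  have : (fun c => ∫ y in c..(c + h), G y) =
      fun c => (∫ y in (0 : ℝ)..(c + h), G y) - ∫ y in (0 : ℝ)..c, G y := by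
    ext c
    rw [intervalIntegral.integral_interval_sub_left (hG _ _) (hG _ _)]
  have h1 : Continuous fun c => ∫ y in c..(c + h), G y := by
    rw [this]
    exact (h0.comp (continuous_id.add continuous_const)).sub h0
  exact h1.const_smul (h⁻¹ : ℝ)

lemma continuous_haarDiff {G : ℝ → ℂ} (hG : ∀ a b, IntervalIntegrable G volume a b) (h : ℝ) :
    Continuous (haarDiff G h) := by
  have h1 := continuous_intervalAvg hG (h / 2)
  exact (h1.sub (h1.comp (continuous_id.add continuous_const))).const_smul (2⁻¹ : ℝ)

lemma intervalAvg_eq {G : ℝ → ℂ} (hG : ∀ a b, IntervalIntegrable G volume a b) (h c : ℝ) :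
    intervalAvg G h c =
      (2⁻¹ : ℝ) • (intervalAvg G (h / 2) c + intervalAvg G (h / 2) (c + h / 2)) := by
  unfold intervalAvg
  rw [← smul_add, show c + h / 2 + h / 2 = c + h by ring,
    intervalIntegral.integral_add_adjacent_intervals (hG _ _) (hG _ _), smul_smul]
  congr 1
  field_simp

lemma enorm_intervalAvg_le (G : ℝ → ℂ) {h : ℝ} (hh : 0 < h) (c : ℝ) :
    ‖intervalAvg G h c‖ₑ ≤ 8 * scaleMax (fun y => ‖G y‖ₑ) h c := by
  unfold intervalAvg
  rw [enorm_smul, intervalIntegral.integral_of_le (by linarith), Real.enorm_of_nonneg (by positivity)]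
  have h1 : ‖∫ y in Ioc c (c + h), G y‖ₑ ≤ ENNReal.ofReal (4 * (2 * h)) *
      scaleMax (fun y => ‖G y‖ₑ) h c := by
    have hsub : Ioc c (c + h) ⊆ Ioo (c - 2 * h) (c + 2 * h) := fun y hy =>
      ⟨by linarith [hy.1], by linarith [hy.2]⟩
    exact (enorm_integral_le_lintegral_enorm _).trans <| (lintegral_mono_set hsub).trans
      (lintegral_Ioo_le_scaleMax _ (R := 2 * h) (by linarith) (by linarith) c)
  refine (mul_le_mul_right h1 _).trans (le_of_eq ?_)
  rw [← mul_assoc, ← ENNReal.ofReal_mul (by positivity), show h⁻¹ * (4 * (2 * h)) = 8 by field_simp; norm_num]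
  simp

lemma enorm_haarDiff_le (G : ℝ → ℂ) {h : ℝ} (hh : 0 < h) (c : ℝ) :
    ‖haarDiff G h c‖ₑ ≤ 24 * scaleMax (fun y => ‖G y‖ₑ) h c := by
  unfold haarDiff
  set g := fun y => ‖G y‖ₑ
  have h1 : scaleMax g (h / 2) c ≤ 3 * scaleMax g h c := by
    have := scaleMax_le_mul g (h := h / 2) (h' := h) (c := c) (c' := c) (by positivity) 1
      (by push_cast; linarith) (by push_cast; linarith)
    norm_num at this; exact this
  have h2 : scaleMax g (h / 2) (c + h / 2) ≤ 3 * scaleMax g h c := by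
    have := scaleMax_le_mul g (h := h / 2) (h' := h) (c := c + h / 2) (c' := c) (by positivity) 1
      (by push_cast; linarith) (by push_cast; linarith)
    norm_num at this; exact this
  rw [enorm_smul, Real.enorm_of_nonneg (by positivity), ENNReal.ofReal_inv_of_pos two_pos]
  calc _ ≤ (ENNReal.ofReal 2)⁻¹ * (8 * (3 * scaleMax g h c) + 8 * (3 * scaleMax g h c)) := by
        refine mul_le_mul_right (enorm_sub_le.trans (add_le_add ?_ ?_)) _
        · exact (enorm_intervalAvg_le G (by positivity) _).trans (mul_le_mul_right h1 _)
        · exact (enorm_intervalAvg_le G (by positivity) _).trans (mul_le_mul_right h2 _)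
    _ = ((2 : ℝ≥0∞)⁻¹ * 2) * (24 * scaleMax g h c) := by simp only [ENNReal.ofReal_ofNat]; ring
    _ = _ := by rw [ENNReal.inv_mul_cancel (by simp) (by simp), one_mul]

lemma enorm_intervalAvg_parallelogram {G : ℝ → ℂ}
    (hG : ∀ a b, IntervalIntegrable G volume a b) (h c : ℝ) :
    2 * (‖haarDiff G h c‖ₑ ^ 2 + ‖intervalAvg G h c‖ₑ ^ 2) =
      ‖intervalAvg G (h / 2) c‖ₑ ^ 2 + ‖intervalAvg G (h / 2) (c + h / 2)‖ₑ ^ 2 := by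
  rw [intervalAvg_eq hG h c, haarDiff]
  set x := intervalAvg G (h / 2) c
  set y := intervalAvg G (h / 2) (c + h / 2)
  have key := parallelogram_law_with_norm ℝ x y
  simp only [enorm_smul, mul_pow]
  rw [← mul_add, Real.enorm_of_nonneg (by norm_num)]
  simp only [← ofReal_norm]
  rw [← ENNReal.ofReal_pow (norm_nonneg _), ← ENNReal.ofReal_pow (norm_nonneg _),
    ← ENNReal.ofReal_pow (norm_nonneg _), ← ENNReal.ofReal_pow (norm_nonneg _),
    ← ENNReal.ofReal_pow (by norm_num), ← ENNReal.ofReal_add (by positivity) (by positivity),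
    ← ENNReal.ofReal_add (by positivity) (by positivity), ← ENNReal.ofReal_mul (by norm_num),
    show (2 : ℝ≥0∞) = ENNReal.ofReal 2 by simp, ← ENNReal.ofReal_mul (by norm_num)]
  congr 1
  linarith

lemma div_mul_add_le_of_le_three_mul {mP mJ FP FJ v K : ℝ≥0∞} (h0 : mP ≠ 0) (hJ : mJ ≠ ∞)
    (hPJ : mP ≤ mJ) (hJP : mJ ≤ 3 * mP) (hF : FP ≤ FJ) (hFJ : FJ ≠ ∞) (hK : K ≠ ∞)
    (hv : v ≤ K * mJ ^ 2) :
    FP / mP * v + 3 * K * (FP * mP) ≤ FJ / mJ * v + 3 * K * (FJ * mJ) := by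
  have hP : mP ≠ ∞ := ne_top_of_le_ne_top hJ hPJ
  have hFP : FP ≠ ∞ := ne_top_of_le_ne_top hFJ hF
  have hJ0 : mJ ≠ 0 := fun h => h0 (le_zero_iff.1 (h ▸ hPJ))
  have hvt : v ≠ ∞ := ne_top_of_le_ne_top (by finiteness) hv
  lift mP to ℝ≥0 using hP
  lift mJ to ℝ≥0 using hJ
  lift FP to ℝ≥0 using hFP
  lift FJ to ℝ≥0 using hFJ
  lift K to ℝ≥0 using hK
  lift v to ℝ≥0 using hvt
  have h0' : mP ≠ 0 := by exact_mod_cast h0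
  have hJ0' : mJ ≠ 0 := by exact_mod_cast hJ0
  rw [← ENNReal.coe_div h0', ← ENNReal.coe_div hJ0']
  norm_cast at *
  rw [← NNReal.coe_le_coe] at *
  push_cast at *
  have hPp : (0 : ℝ) < mP := by exact_mod_cast pos_iff_ne_zero.2 h0'
  have hJp : (0 : ℝ) < mJ := by exact_mod_cast pos_iff_ne_zero.2 hJ0'
  have hFJ0 := FJ.coe_nonneg
  have hK0 := K.coe_nonneg
  have hv0 := v.coe_nonneg
  generalize (mP : ℝ) = a at *
  generalize (mJ : ℝ) = b at *
  generalize (FP : ℝ) = A at *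
  generalize (FJ : ℝ) = B at *
  generalize (K : ℝ) = k at *
  generalize (v : ℝ) = u at *
  have e1 : (A / a - B / b) * u ≤ B * (b - a) / (a * b) * u := by
    refine mul_le_mul_of_nonneg_right ?_ hv0
    rw [div_sub_div _ _ hPp.ne' hJp.ne']
    refine div_le_div_of_nonneg_right ?_ (by positivity)
    nlinarith
  have e2 : B * (b - a) / (a * b) * u ≤ B * (b - a) / (a * b) * (k * b ^ 2) :=
    mul_le_mul_of_nonneg_left hv (div_nonneg (mul_nonneg hFJ0 (by linarith)) (by positivity))
  have e3 : B * (b - a) / (a * b) * (k * b ^ 2) = k * (B * (b - a)) * (b / a) := by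
    field_simp
  have e4 : k * (B * (b - a)) * (b / a) ≤ k * (B * (b - a)) * 3 := by
    refine mul_le_mul_of_nonneg_left ?_ (mul_nonneg hK0 (mul_nonneg hFJ0 (by linarith)))
    rw [div_le_iff₀ hPp]; linarith
  have e5 : k * (B * (b - a)) ≤ k * (B * b - A * a) := by
    refine mul_le_mul_of_nonneg_left ?_ hK0
    nlinarith
  nlinarith

/-- One step of the weighted Haar square function estimate. -/
lemma lintegral_haarDiff_step {G : ℝ → ℂ} (hG : ∀ a b, IntervalIntegrable G volume a b)
    (hm0 : ∀ h c, scaleMax (fun y => ‖G y‖ₑ) h c ≠ 0)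
    (hmt : ∀ h c, 0 < h → scaleMax (fun y => ‖G y‖ₑ) h c ≠ ∞)
    {F : ℝ → ℝ → ℝ≥0∞} (hFm : ∀ h, Measurable (F h)) (hFt : ∀ h c, 0 < h → F h c ≠ ∞)
    (hFl : ∀ h c, 0 < h → F h c ≤ F (h / 2) c) (hFr : ∀ h c, 0 < h → F h c ≤ F (h / 2) (c + h / 2))
    {h : ℝ} (hh : 0 < h) :
    (∫⁻ c, F h c / scaleMax (fun y => ‖G y‖ₑ) h c * ‖haarDiff G h c‖ₑ ^ 2)
      + ((∫⁻ c, F h c / scaleMax (fun y => ‖G y‖ₑ) h c * ‖intervalAvg G h c‖ₑ ^ 2)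
        + 192 * ∫⁻ c, F h c * scaleMax (fun y => ‖G y‖ₑ) h c)
      ≤ (∫⁻ c, F (h / 2) c / scaleMax (fun y => ‖G y‖ₑ) (h / 2) c
            * ‖intervalAvg G (h / 2) c‖ₑ ^ 2)
        + 192 * ∫⁻ c, F (h / 2) c * scaleMax (fun y => ‖G y‖ₑ) (h / 2) c := by
  set g := fun y => ‖G y‖ₑ
  set m := scaleMax g
  have hmm : ∀ h, Measurable (m h) := measurable_scaleMax g
  have hAm : ∀ h, Measurable fun c => ‖intervalAvg G h c‖ₑ ^ 2 := fun h =>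
    (continuous_intervalAvg hG h).measurable.enorm.pow_const 2
  have hDm : Measurable fun c => ‖haarDiff G h c‖ₑ ^ 2 :=
    (continuous_haarDiff hG h).measurable.enorm.pow_const 2
  set Q : ℝ → ℝ≥0∞ := fun c => F (h / 2) c / m (h / 2) c * ‖intervalAvg G (h / 2) c‖ₑ ^ 2
    + 192 * (F (h / 2) c * m (h / 2) c) with hQ
  set P : ℝ → ℝ≥0∞ := fun c => F h c / m h c * (‖haarDiff G h c‖ₑ ^ 2 + ‖intervalAvg G h c‖ₑ ^ 2)
    + 192 * (F h c * m h c) with hP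
  have hQm : Measurable Q := (((hFm _).div (hmm _)).mul (hAm _)).add
    (((hFm _).mul (hmm _)).const_mul _)
  have hstep : ∀ c s, (s = 0 ∨ s = h / 2) →
      F h c / m h c * ‖intervalAvg G (h / 2) (c + s)‖ₑ ^ 2 + 192 * (F h c * m h c) ≤ Q (c + s) := by
    intro c s hs
    have hs0 : 0 ≤ s := by rcases hs with rfl | rfl <;> positivity
    have hs1 : s ≤ h / 2 := by rcases hs with rfl | rfl <;> linarith
    have h1 : m h c ≤ m (h / 2) (c + s) := by
      simpa using scaleMax_le_mul g (c := c) (c' := c + s) hh.le (h' := h / 2) 0 (by simpa)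
        (by simp only [CharP.cast_eq_zero, zero_mul]; linarith)
    have h2 : m (h / 2) (c + s) ≤ 3 * m h c := by
      have := scaleMax_le_mul g (h := h / 2) (h' := h) (c := c + s) (c' := c) (by positivity) 1
        (by push_cast; linarith) (by push_cast; linarith)
      norm_num at this; exact this
    have h3 : F h c ≤ F (h / 2) (c + s) := by
      rcases hs with rfl | rfl
      · simpa using hFl h c hh
      · exact hFr h c hh
    have h4 : ‖intervalAvg G (h / 2) (c + s)‖ₑ ^ 2 ≤ 64 * m (h / 2) (c + s) ^ 2 := by
      calc _ ≤ (8 * m (h / 2) (c + s)) ^ 2 := by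
            gcongr; exact enorm_intervalAvg_le G (by positivity) _
        _ = _ := by rw [mul_pow]; norm_num
    have := div_mul_add_le_of_le_three_mul (hm0 h c) (hmt (h / 2) (c + s) (by positivity)) h1 h2 h3
      (hFt _ _ (by positivity)) (by simp) h4
    norm_num at this
    exact this
  have hpt : ∀ c, 2 * P c ≤ Q c + Q (c + h / 2) := by
    intro c
    have e1 := hstep c 0 (Or.inl rfl)
    have e2 := hstep c (h / 2) (Or.inr rfl)
    rw [add_zero] at e1
    refine le_trans (le_of_eq ?_) (add_le_add e1 e2)
    calc 2 * P c = F h c / m h c * (2 * (‖haarDiff G h c‖ₑ ^ 2 + ‖intervalAvg G h c‖ₑ ^ 2))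
          + 2 * (192 * (F h c * m h c)) := by rw [hP]; ring
      _ = _ := by rw [enorm_intervalAvg_parallelogram hG]; ring
  have hint : 2 * ∫⁻ c, P c ≤ 2 * ∫⁻ c, Q c := by
    calc 2 * ∫⁻ c, P c = ∫⁻ c, 2 * P c := (lintegral_const_mul' _ _ (by simp)).symm
      _ ≤ ∫⁻ c, Q c + Q (c + h / 2) := lintegral_mono hpt
      _ = (∫⁻ c, Q c) + ∫⁻ c, Q (c + h / 2) := lintegral_add_left hQm _
      _ = 2 * ∫⁻ c, Q c := by rw [lintegral_add_right_eq_self Q]; ring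
  have hint' : ∫⁻ c, P c ≤ ∫⁻ c, Q c := by
    rwa [ENNReal.mul_le_mul_iff_right (by simp) (by simp)] at hint
  have hFmm : ∀ h, Measurable fun c => F h c * m h c := fun h => (hFm h).mul (hmm h)
  have hχA : ∀ h, Measurable fun c => F h c / m h c * ‖intervalAvg G h c‖ₑ ^ 2 := fun h =>
    ((hFm h).div (hmm h)).mul (hAm h)
  have hχD : Measurable fun c => F h c / m h c * ‖haarDiff G h c‖ₑ ^ 2 :=
    ((hFm h).div (hmm h)).mul hDm
  have eP : ∫⁻ c, P c = (∫⁻ c, F h c / m h c * ‖haarDiff G h c‖ₑ ^ 2)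
      + ((∫⁻ c, F h c / m h c * ‖intervalAvg G h c‖ₑ ^ 2) + 192 * ∫⁻ c, F h c * m h c) := by
    rw [← lintegral_const_mul _ (hFmm _), ← lintegral_add_left (hχA _), ← lintegral_add_left hχD]
    refine lintegral_congr fun c => ?_
    rw [hP]; ring
  have eQ : ∫⁻ c, Q c = (∫⁻ c, F (h / 2) c / m (h / 2) c * ‖intervalAvg G (h / 2) c‖ₑ ^ 2)
      + 192 * ∫⁻ c, F (h / 2) c * m (h / 2) c := by
    rw [← lintegral_const_mul _ (hFmm _), ← lintegral_add_left (hχA _)]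
  rw [← eP, ← eQ]
  exact hint'

/-- A weighted Haar square function estimate over finitely many consecutive dyadic scales. -/
lemma sum_lintegral_haarDiff_le {G : ℝ → ℂ} (hG : ∀ a b, IntervalIntegrable G volume a b)
    (hm0 : ∀ h c, scaleMax (fun y => ‖G y‖ₑ) h c ≠ 0)
    (hmt : ∀ h c, 0 < h → scaleMax (fun y => ‖G y‖ₑ) h c ≠ ∞)
    {F : ℝ → ℝ → ℝ≥0∞} (hFm : ∀ h, Measurable (F h)) (hFt : ∀ h c, 0 < h → F h c ≠ ∞)
    (hFl : ∀ h c, 0 < h → F h c ≤ F (h / 2) c) (hFr : ∀ h c, 0 < h → F h c ≤ F (h / 2) (c + h / 2))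
    {P : ℝ → ℝ≥0∞} (hP : ∀ h c, 0 < h → F h c * scaleMax (fun y => ‖G y‖ₑ) h c ≤ P c)
    {r : ℕ → ℝ} (hr0 : ∀ i, 0 < r i) (hr : ∀ i, r (i + 1) = r i / 2) (n : ℕ) :
    ∑ i ∈ Finset.range n, ∫⁻ c, F (r i) c / scaleMax (fun y => ‖G y‖ₑ) (r i) c
      * ‖haarDiff G (r i) c‖ₑ ^ 2 ≤ 256 * ∫⁻ c, P c := by
  set m := scaleMax (fun y => ‖G y‖ₑ)
  set X : ℕ → ℝ≥0∞ := fun i => (∫⁻ c, F (r i) c / m (r i) c * ‖intervalAvg G (r i) c‖ₑ ^ 2)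
        + 192 * ∫⁻ c, F (r i) c * m (r i) c with hX
  have tel : ∀ n, (∑ i ∈ Finset.range n, ∫⁻ c, F (r i) c / m (r i) c * ‖haarDiff G (r i) c‖ₑ ^ 2)
      + X 0 ≤ X n := by
    intro n
    induction n with
    | zero => simp
    | succ n ih =>
      rw [Finset.sum_range_succ, add_right_comm]
      refine (add_le_add_left ih _).trans ?_
      have := lintegral_haarDiff_step hG hm0 hmt hFm hFt hFl hFr (hr0 n)
      rw [← hr n] at this
      rw [add_comm]
      exact this
  refine (le_self_add.trans (tel n)).trans ?_
  have h1 : ∫⁻ c, F (r n) c / m (r n) c * ‖intervalAvg G (r n) c‖ₑ ^ 2 ≤ 64 * ∫⁻ c, P c := by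
    rw [← lintegral_const_mul' _ _ (by simp)]
    refine lintegral_mono fun c => ?_
    calc _ ≤ F (r n) c / m (r n) c * (8 * m (r n) c) ^ 2 := by
          gcongr; exact enorm_intervalAvg_le G (hr0 n) c
      _ = 64 * (F (r n) c / m (r n) c * m (r n) c * m (r n) c) := by ring
      _ = 64 * (F (r n) c * m (r n) c) := by
          rw [ENNReal.div_mul_cancel (hm0 _ _) (hmt _ _ (hr0 n))]
      _ ≤ _ := mul_le_mul_right (hP _ _ (hr0 n)) _
  calc X n ≤ 64 * (∫⁻ c, P c) + 192 * ∫⁻ c, P c :=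
        add_le_add h1 (mul_le_mul_right (lintegral_mono fun c => hP _ _ (hr0 n)) _)
    _ = _ := by ring

/-- Convolution with an integrable kernel at scale `h` is bounded on weighted `L²` for weights
varying slowly at scale `h`. -/
lemma lintegral_mul_conv_sq_le {η ω χ D : ℝ → ℝ≥0∞} (hη : Measurable η) (hω : Measurable ω)
    (hχ : Measurable χ) (hD : Measurable D) (h : ℝ)
    (H : ∀ c y, χ c ≤ ω y * χ (c - h * y)) :
    ∫⁻ c, χ c * (∫⁻ y, η y * D (c - h * y)) ^ 2
      ≤ (∫⁻ y, η y) * (∫⁻ y, η y * ω y) * ∫⁻ c, χ c * D c ^ 2 := by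
  have hDm : ∀ c, Measurable fun y => D (c - h * y) := fun c =>
    hD.comp (measurable_const.sub (measurable_const_mul h))
  have cs : ∀ c, (∫⁻ y, η y * D (c - h * y)) ^ 2
      ≤ (∫⁻ y, η y) * ∫⁻ y, η y * D (c - h * y) ^ 2 := by
    intro c
    have := lintegral_rpow_le_measure_univ_mul (volume.withDensity η) one_lt_two
      (hDm c).aemeasurable
    rw [lintegral_withDensity_eq_lintegral_mul _ hη (hDm c),
      lintegral_withDensity_eq_lintegral_mul _ hη ((hDm c).pow_const _),
      withDensity_apply _ MeasurableSet.univ, Measure.restrict_univ] at this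
    norm_num at this
    exact this
  have hm2 : Measurable fun z : ℝ × ℝ => D (z.1 - h * z.2) :=
    hD.comp (measurable_fst.sub (measurable_snd.const_mul h))
  calc ∫⁻ c, χ c * (∫⁻ y, η y * D (c - h * y)) ^ 2
      ≤ ∫⁻ c, (∫⁻ y, η y) * ∫⁻ y, χ c * (η y * D (c - h * y) ^ 2) := by
        refine lintegral_mono fun c => ?_
        refine (mul_le_mul_right (cs c) _).trans (le_of_eq ?_)
        have hmc : Measurable fun y => η y * D (c - h * y) ^ 2 := hη.mul ((hDm c).pow_const 2)
        rw [lintegral_const_mul _ hmc]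
        ring
    _ = (∫⁻ y, η y) * ∫⁻ c, ∫⁻ y, χ c * (η y * D (c - h * y) ^ 2) := by
        refine lintegral_const_mul _ (Measurable.lintegral_prod_right'
          (f := fun z : ℝ × ℝ => χ z.1 * (η z.2 * D (z.1 - h * z.2) ^ 2)) ?_)
        exact (hχ.comp measurable_fst).mul ((hη.comp measurable_snd).mul (hm2.pow_const 2))
    _ = (∫⁻ y, η y) * ∫⁻ y, ∫⁻ c, χ c * (η y * D (c - h * y) ^ 2) := by
        rw [lintegral_lintegral_swap]
        exact ((hχ.comp measurable_fst).mul
          ((hη.comp measurable_snd).mul (hm2.pow_const 2))).aemeasurable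
    _ ≤ (∫⁻ y, η y) * ∫⁻ y, η y * ω y * ∫⁻ c, χ c * D c ^ 2 := by
        refine mul_le_mul_right (lintegral_mono fun y => ?_) _
        calc ∫⁻ c, χ c * (η y * D (c - h * y) ^ 2)
            ≤ ∫⁻ c, η y * ω y * (χ (c - h * y) * D (c - h * y) ^ 2) := by
              refine lintegral_mono fun c => ?_
              refine (mul_le_mul_left (H c y) _).trans (le_of_eq ?_)
              ring
          _ = η y * ω y * ∫⁻ c, χ (c - h * y) * D (c - h * y) ^ 2 := by
              refine lintegral_const_mul _ ?_
              exact (hχ.mul (hD.pow_const 2)).comp (measurable_id.sub_const _)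
          _ = _ := by rw [lintegral_sub_right_eq_self fun c => χ c * D c ^ 2]
    _ = _ := by
        have hmη : Measurable fun y => η y * ω y := hη.mul hω
        rw [lintegral_mul_const _ hmη, mul_assoc]

lemma scaleMax_ne_zero {f : ℝ → ℝ≥0∞} (hf : Measurable f) (hf0 : ¬ f =ᵐ[volume] 0) (h c : ℝ) :
    scaleMax f h c ≠ 0 := by
  intro h0
  apply hf0
  have hae : ∀ᵐ y, ∀ n : ℕ, y ∈ Ioo (c - (n + 1 + |h|)) (c + (n + 1 + |h|)) → f y = 0 := by
    rw [ae_all_iff]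
    intro n
    have hR : 0 < n + 1 + |h| := by positivity
    have := lintegral_Ioo_le_scaleMax f hR
      (by have := le_abs_self h; linarith [(n.cast_nonneg : (0 : ℝ) ≤ n)]) c
    rw [h0, mul_zero, nonpos_iff_eq_zero, lintegral_eq_zero_iff hf] at this
    filter_upwards [(ae_restrict_iff' measurableSet_Ioo).1 this] with y hy using hy
  filter_upwards [hae] with y hy
  obtain ⟨n, hn⟩ := exists_nat_gt |y - c|
  have := abs_lt.1 (show |y - c| < n + 1 + |h| by linarith [abs_nonneg h])
  exact hy n ⟨by linarith, by linarith⟩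

lemma scaleMax_le_of_le {f : ℝ → ℝ≥0∞} {B : ℝ≥0∞} (hB : ∀ x, f x ≤ B) (h c : ℝ) :
    scaleMax f h c ≤ B := by
  refine scaleMax_le fun a b _ _ => ENNReal.div_le_of_le_mul ?_
  exact (lintegral_mono fun x => hB x).trans (by rw [setLIntegral_const])

lemma ENNReal.mul_le_mul_sq_add {a b l : ℝ≥0∞} (hl : l ≠ 0) (hl' : l ≠ ∞) :
    a * b ≤ l * a ^ 2 + l⁻¹ * b ^ 2 := by
  rcases le_total b (l * a) with h | h
  · refine le_trans ?_ le_self_add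
    calc a * b ≤ a * (l * a) := by gcongr
      _ = _ := by ring
  · refine le_trans ?_ le_add_self
    have h1 : a ≤ l⁻¹ * b := by
      calc a = l⁻¹ * (l * a) := by rw [← mul_assoc, ENNReal.inv_mul_cancel hl hl', one_mul]
        _ ≤ _ := by gcongr
    calc a * b ≤ l⁻¹ * b * b := by gcongr
      _ = _ := by ring

/-- The growth function in the Harnack inequality for `scaleMax`. -/
def harnackWeight (u : ℝ) : ℝ≥0∞ := ENNReal.ofReal (3 + 2 * |u|)

lemma harnackWeight_ne_zero (u : ℝ) : harnackWeight u ≠ 0 := by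
  have : 0 < 3 + 2 * |u| := by positivity
  simp [harnackWeight, this]

lemma measurable_harnackWeight : Measurable harnackWeight := by
  unfold harnackWeight; fun_prop

lemma scaleMax_harnack (f : ℝ → ℝ≥0∞) {h : ℝ} (hh : 0 ≤ h) (c u : ℝ) :
    scaleMax f h c ≤ harnackWeight u * scaleMax f h (c - h * u) := by
  have := scaleMax_le_add_mul f hh c (-u)
  rwa [abs_neg, mul_neg, ← sub_eq_add_neg] at this

lemma scaleMax_harnack' (f : ℝ → ℝ≥0∞) {h : ℝ} (hh : 0 ≤ h) (c u : ℝ) :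
    scaleMax f h (c - h * u) ≤ harnackWeight u * scaleMax f h c := by
  have := scaleMax_le_add_mul f hh (c - h * u) u
  rwa [sub_add_cancel] at this

/-- Bounded measurable and not almost everywhere zero. -/
structure IsBddNonzero (f : ℝ → ℂ) : Prop where
  measurable : Measurable f
  bdd : ∃ B : ℝ≥0, ∀ x, ‖f x‖ₑ ≤ B
  ne_zero : ¬ f =ᵐ[volume] 0

namespace IsBddNonzero

lemma scaleMax_ne_zero {f : ℝ → ℂ} (hf : IsBddNonzero f) (h c : ℝ) :
    scaleMax (fun y => ‖f y‖ₑ) h c ≠ 0 := by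
  refine _root_.scaleMax_ne_zero hf.measurable.enorm (fun h0 => hf.ne_zero ?_) h c
  filter_upwards [h0] with y hy
  simpa using hy

lemma scaleMax_ne_top {f : ℝ → ℂ} (hf : IsBddNonzero f) (h c : ℝ) :
    scaleMax (fun y => ‖f y‖ₑ) h c ≠ ∞ := by
  obtain ⟨B, hB⟩ := hf.bdd
  exact ne_top_of_le_ne_top ENNReal.coe_ne_top (scaleMax_le_of_le hB h c)

lemma intervalIntegrable {f : ℝ → ℂ} (hf : IsBddNonzero f) (a b : ℝ) :
    IntervalIntegrable f volume a b := by
  obtain ⟨B, hB⟩ := hf.bdd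
  have : IntegrableOn f (uIcc a b) := by
    refine Measure.integrableOn_of_bounded (M := B) (by simp) hf.measurable.aestronglyMeasurable
      (Eventually.of_forall fun x => ?_)
    have := hB x
    rw [← ofReal_norm, ENNReal.ofReal_le_coe] at this
    exact this
  exact this.intervalIntegrable

end IsBddNonzero

/-- The constant of the weighted estimate for the kernel `η`. -/
def kernelConst (η : ℝ → ℝ≥0∞) : ℝ≥0∞ := (∫⁻ u, η u) * ∫⁻ u, η u * harnackWeight u ^ 3

lemma sum_lintegral_weighted_sq_le {f h G : ℝ → ℂ} (hf : IsBddNonzero f) (hh : IsBddNonzero h)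
    (hG : IsBddNonzero G) {η : ℝ → ℝ≥0∞} (hη : Measurable η)
    {r : ℕ → ℝ} (hr0 : ∀ i, 0 < r i) (hr : ∀ i, r (i + 1) = r i / 2) {y : ℕ → ℝ → ℝ≥0∞}
    (hy : ∀ i c, y i c ≤ ∫⁻ u, η u * ‖haarDiff G (r i) (c - r i * u)‖ₑ) (n : ℕ) :
    ∑ i ∈ Finset.range n, ∫⁻ c, scaleMax (fun y => ‖f y‖ₑ) (r i) c
        * scaleMax (fun y => ‖h y‖ₑ) (r i) c / scaleMax (fun y => ‖G y‖ₑ) (r i) c * y i c ^ 2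
      ≤ kernelConst η * 256 * ∫⁻ c, intervalMax volume (fun y => ‖f y‖ₑ) c
        * intervalMax volume (fun y => ‖h y‖ₑ) c * intervalMax volume (fun y => ‖G y‖ₑ) c := by
  set f' := fun y => ‖f y‖ₑ
  set h' := fun y => ‖h y‖ₑ
  set G' := fun y => ‖G y‖ₑ
  set F : ℝ → ℝ → ℝ≥0∞ := fun r c => scaleMax f' r c * scaleMax h' r c with hF
  have child : ∀ (φ : ℝ → ℝ≥0∞) (h c s : ℝ), 0 < h → 0 ≤ s → s ≤ h / 2 →
      scaleMax φ h c ≤ scaleMax φ (h / 2) (c + s) := fun φ h c s hh h0 hs => by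
    simpa using scaleMax_le_mul φ (c := c) (c' := c + s) hh.le (h' := h / 2) 0 (by simpa)
        (by simp only [CharP.cast_eq_zero, zero_mul]; linarith)
  have key := sum_lintegral_haarDiff_le hG.intervalIntegrable hG.scaleMax_ne_zero
    (fun h c _ => hG.scaleMax_ne_top h c) (F := F)
    (fun r => (measurable_scaleMax _ _).mul (measurable_scaleMax _ _))
    (fun r c _ => ENNReal.mul_ne_top (hf.scaleMax_ne_top r c) (hh.scaleMax_ne_top r c))
    (fun r c hr => by
      have := mul_le_mul' (child f' r c 0 hr le_rfl (by positivity))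
        (child h' r c 0 hr le_rfl (by positivity))
      simpa using this)
    (fun r c hr => mul_le_mul' (child f' r c _ hr (by positivity) le_rfl)
        (child h' r c _ hr (by positivity) le_rfl))
    (P := fun c => intervalMax volume f' c * intervalMax volume h' c * intervalMax volume G' c)
    (fun r c hr => mul_le_mul' (mul_le_mul' (scaleMax_le_intervalMax _ hr.le _)
      (scaleMax_le_intervalMax _ hr.le _)) (scaleMax_le_intervalMax _ hr.le _)) hr0 hr n
  rw [mul_assoc]
  refine le_trans ?_ (mul_le_mul_right key _)
  rw [Finset.mul_sum]
  refine Finset.sum_le_sum fun i _ => ?_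
  refine le_trans (lintegral_mono fun c => mul_le_mul_right (pow_le_pow_left' (hy i c) 2) _) ?_
  refine lintegral_mul_conv_sq_le hη (measurable_harnackWeight.pow_const 3)
    (((measurable_scaleMax _ _).mul (measurable_scaleMax _ _)).div (measurable_scaleMax _ _))
    (continuous_haarDiff hG.intervalIntegrable (r i)).measurable.enorm (r i) fun c u => ?_
  have h1 := scaleMax_harnack f' (hr0 i).le c u
  have h2 := scaleMax_harnack h' (hr0 i).le c u
  have h3 := scaleMax_harnack' G' (hr0 i).le c u
  set w := harnackWeight u
  have hw0 : w ≠ 0 := harnackWeight_ne_zero u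
  have hwt : w ≠ ∞ := ENNReal.ofReal_ne_top
  have h4 : (scaleMax G' (r i) c)⁻¹ ≤ w * (scaleMax G' (r i) (c - r i * u))⁻¹ := by
    have h5 := ENNReal.inv_le_inv.2 h3
    rw [ENNReal.mul_inv (Or.inl hw0) (Or.inl hwt)] at h5
    calc (scaleMax G' (r i) c)⁻¹ = w * (w⁻¹ * (scaleMax G' (r i) c)⁻¹) := by
          rw [← mul_assoc, ENNReal.mul_inv_cancel hw0 hwt, one_mul]
      _ ≤ _ := mul_le_mul_right h5 _
  simp only [div_eq_mul_inv, Pi.mul_apply, Pi.inv_apply]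
  calc _ ≤ (w * scaleMax f' (r i) (c - r i * u)) * (w * scaleMax h' (r i) (c - r i * u))
        * (w * (scaleMax G' (r i) (c - r i * u))⁻¹) := by gcongr
    _ = _ := by ring

lemma sum_range_le_sum_range_sub {X : ℤ → ℝ≥0∞} {P : ℝ≥0∞} (hP : ∀ k, X k ≤ P) (k : ℤ)
    (n j : ℕ) :
    ∑ i ∈ Finset.range n, X (k + i) ≤ ∑ i ∈ Finset.range n, X (k + i - j) + j * P := by
  induction j with
  | zero => simp
  | succ j ih =>
    refine ih.trans ?_
    have h1 : ∑ i ∈ Finset.range n, X (k + i - j) + X (k - (j + 1 : ℕ))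
        = ∑ i ∈ Finset.range n, X (k + i - (j + 1 : ℕ)) + X (k + n - (j + 1 : ℕ)) := by
      rw [← Finset.sum_range_succ (fun i : ℕ => X (k + i - (j + 1 : ℕ))),
        Finset.sum_range_succ']
      simp only [Nat.cast_zero, add_zero]
      congr 1
      refine Finset.sum_congr rfl fun i _ => congrArg X ?_
      push_cast; ring
    have h2 : ∑ i ∈ Finset.range n, X (k + i - j)
        ≤ ∑ i ∈ Finset.range n, X (k + i - (j + 1 : ℕ)) + P :=
      le_self_add.trans (h1.le.trans (by gcongr; exact hP _))
    calc _ ≤ (∑ i ∈ Finset.range n, X (k + i - (j + 1 : ℕ)) + P) + j * P := by gcongr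
      _ = _ := by push_cast; ring

/-- Schur-type discrete estimate with monotone weights: the off-diagonal shift by `j` costs only
a factor linear in `j`. -/
lemma sum_mul_shift_le {f m h y z : ℤ → ℝ≥0∞} {L P : ℝ≥0∞} (hL : L ≠ ∞)
    (hf : Monotone f) (hm : Monotone m) (hh : Monotone h)
    (hft : ∀ k, f k ≠ ∞) (hm0 : ∀ k, m k ≠ 0) (hmt : ∀ k, m k ≠ ∞) (hh0 : ∀ k, h k ≠ 0)
    (hht : ∀ k, h k ≠ ∞) (hP : ∀ k, f k * m k * h k ≤ P) (hz : ∀ k, z k ^ 2 ≤ L * h k ^ 2)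
    (k : ℤ) (n j : ℕ) :
    ∑ i ∈ Finset.range n, f (k + i) * y (k + i) * z (k + i - j)
      ≤ ∑ i ∈ Finset.range n, f (k + i) * h (k + i) / m (k + i) * y (k + i) ^ 2
        + ∑ i ∈ Finset.range n, f (k + i - j) * m (k + i - j) / h (k + i - j) * z (k + i - j) ^ 2
        + L * (j * P) := by
  set A := ∑ i ∈ Finset.range n, f (k + i) * h (k + i) / m (k + i) * y (k + i) ^ 2
  set B := ∑ i ∈ Finset.range n,
    f (k + i - j) * m (k + i - j) / h (k + i - j) * z (k + i - j) ^ 2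
  set X := fun k => f k * m k * h k with hX
  have hXt : ∀ k, X k ≠ ∞ := fun k =>
    ENNReal.mul_ne_top (ENNReal.mul_ne_top (hft k) (hmt k)) (hht k)
  have hS : L * ∑ i ∈ Finset.range n, X (k + i - j) ≠ ∞ :=
    ENNReal.mul_ne_top hL (ENNReal.sum_ne_top.2 fun i _ => hXt _)
  have key : ∑ i ∈ Finset.range n, f (k + i) * y (k + i) * z (k + i - j)
      + L * ∑ i ∈ Finset.range n, X (k + i - j) ≤ A + B + L * ∑ i ∈ Finset.range n, X (k + i) := by
    simp only [A, B, Finset.mul_sum, ← Finset.sum_add_distrib]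
    refine Finset.sum_le_sum fun i _ => ?_
    have hle : k + i - j ≤ k + i := by omega
    set a := k + (i : ℤ)
    set b := a - (j : ℤ)
    have hl0 : h b / m a ≠ 0 := ENNReal.div_ne_zero.2 ⟨hh0 _, hmt _⟩
    have hlt : h b / m a ≠ ∞ := ENNReal.div_ne_top (hht _) (hm0 _)
    have h1 : f a * y a * z b ≤ f a * h a / m a * y a ^ 2 + f a * m a / h b * z b ^ 2 := by
      calc f a * y a * z b = f a * (y a * z b) := by ring
        _ ≤ f a * (h b / m a * y a ^ 2 + (h b / m a)⁻¹ * z b ^ 2) :=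
          mul_le_mul_right (ENNReal.mul_le_mul_sq_add hl0 hlt) _
        _ ≤ f a * (h a / m a * y a ^ 2 + (h b / m a)⁻¹ * z b ^ 2) := by
          gcongr; exact hh hle
        _ = _ := by
          rw [ENNReal.inv_div (Or.inl (hmt _)) (Or.inl (hm0 _))]
          simp only [div_eq_mul_inv]; ring
    have hfm : f b * m b ≤ f a * m a := mul_le_mul' (hf hle) (hm hle)
    have h2 : f a * m a / h b * z b ^ 2 + L * (f b * m b * h b)
        ≤ f b * m b / h b * z b ^ 2 + L * (f a * m a * h a) := by
      obtain ⟨d, hd⟩ := exists_add_of_le hfm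
      rw [hd]
      have h3 : d / h b * z b ^ 2 ≤ L * (d * h b) := by
        calc d / h b * z b ^ 2 ≤ d / h b * (L * h b ^ 2) := mul_le_mul_right (hz b) _
          _ = L * (d * h b) * ((h b)⁻¹ * h b) := by rw [div_eq_mul_inv]; ring
          _ = _ := by rw [ENNReal.inv_mul_cancel (hh0 _) (hht _), mul_one]
      calc (f b * m b + d) / h b * z b ^ 2 + L * (f b * m b * h b)
          = f b * m b / h b * z b ^ 2 + d / h b * z b ^ 2 + L * (f b * m b * h b) := by
            rw [ENNReal.add_div]; ring
        _ ≤ f b * m b / h b * z b ^ 2 + L * (d * h b) + L * (f b * m b * h b) := by gcongr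
        _ = f b * m b / h b * z b ^ 2 + L * ((f b * m b + d) * h b) := by ring
        _ ≤ _ := by gcongr; exact hh hle
    calc f a * y a * z b + L * X b
        ≤ f a * h a / m a * y a ^ 2 + f a * m a / h b * z b ^ 2 + L * X b := by gcongr
      _ = f a * h a / m a * y a ^ 2 + (f a * m a / h b * z b ^ 2 + L * X b) := by ring
      _ ≤ f a * h a / m a * y a ^ 2 + (f b * m b / h b * z b ^ 2 + L * X a) := by gcongr
      _ = _ := by ring
  have := sum_range_le_sum_range_sub hP k n j
  refine (ENNReal.add_le_add_iff_right hS).1 (key.trans ?_)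
  calc A + B + L * ∑ i ∈ Finset.range n, X (k + i)
      ≤ A + B + L * (∑ i ∈ Finset.range n, X (k + i - j) + j * P) := by gcongr
    _ = _ := by ring

/-- The dyadic scale `2 ^ (-k)`. -/
def dyadic (k : ℤ) : ℝ := (2 : ℝ) ^ (-k)

lemma dyadic_pos (k : ℤ) : 0 < dyadic k := by unfold dyadic; positivity

lemma dyadic_add_one (k : ℤ) : dyadic (k + 1) = dyadic k / 2 := by
  rw [dyadic, dyadic, neg_add, zpow_add₀ two_ne_zero]; norm_num [div_eq_mul_inv]

lemma dyadic_anti : Antitone dyadic := fun a b h => by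
  unfold dyadic; gcongr; norm_num

lemma measurable_lintegral_conv {η D : ℝ → ℝ≥0∞} (hη : Measurable η) (hD : Measurable D) (h : ℝ) :
    Measurable fun c => ∫⁻ u, η u * D (c - h * u) := by
  refine Measurable.lintegral_prod_right' (f := fun p : ℝ × ℝ => η p.2 * D (p.1 - h * p.2)) ?_
  exact (hη.comp measurable_snd).mul (hD.comp (by fun_prop))

/-- The constant of `sum_lintegral_trilinear_le`. -/
def trilinearConst (η κ : ℝ → ℝ≥0∞) : ℝ≥0∞ :=
  kernelConst η * 256 + kernelConst κ * 256 + (24 * ∫⁻ u, κ u * harnackWeight u) ^ 2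

lemma sum_lintegral_trilinear_le_of_isBddNonzero {f G H : ℝ → ℂ} (hf : IsBddNonzero f)
    (hG : IsBddNonzero G) (hH : IsBddNonzero H) {η κ : ℝ → ℝ≥0∞} (hη : Measurable η)
    (hκ : Measurable κ) (hL : ∫⁻ u, κ u * harnackWeight u ≠ ∞) {K : ℝ≥0∞}
    {x y z : ℤ → ℝ → ℝ≥0∞}
    (hx : ∀ k c, x k c ≤ K * scaleMax (fun y => ‖f y‖ₑ) (dyadic k) c)
    (hy : ∀ k c, y k c ≤ ∫⁻ u, η u * ‖haarDiff G (dyadic k) (c - dyadic k * u)‖ₑ)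
    (hz : ∀ k c, z k c ≤ ∫⁻ u, κ u * ‖haarDiff H (dyadic k) (c - dyadic k * u)‖ₑ)
    (k : ℤ) (n j : ℕ) :
    ∑ i ∈ Finset.range n, ∫⁻ c, x (k + i) c * y (k + i) c * z (k + i - j) c
      ≤ K * (trilinearConst η κ * (1 + j)) * ∫⁻ c, intervalMax volume (fun y => ‖f y‖ₑ) c
        * intervalMax volume (fun y => ‖G y‖ₑ) c * intervalMax volume (fun y => ‖H y‖ₑ) c := by
  set f' := fun y => ‖f y‖ₑ
  set G' := fun y => ‖G y‖ₑ
  set H' := fun y => ‖H y‖ₑ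
  set Y : ℤ → ℝ → ℝ≥0∞ := fun k c =>
    ∫⁻ u, η u * ‖haarDiff G (dyadic k) (c - dyadic k * u)‖ₑ with hY
  set Z : ℤ → ℝ → ℝ≥0∞ := fun k c =>
    ∫⁻ u, κ u * ‖haarDiff H (dyadic k) (c - dyadic k * u)‖ₑ with hZ
  set L := (24 * ∫⁻ u, κ u * harnackWeight u) ^ 2 with hLdef
  set P := fun c => intervalMax volume f' c * intervalMax volume G' c * intervalMax volume H' c
    with hPdef
  have hYm : ∀ k, Measurable (Y k) := fun k => measurable_lintegral_conv hη
    (continuous_haarDiff hG.intervalIntegrable _).measurable.enorm _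
  have hZm : ∀ k, Measurable (Z k) := fun k => measurable_lintegral_conv hκ
    (continuous_haarDiff hH.intervalIntegrable _).measurable.enorm _
  have hsm : ∀ φ k, Measurable (scaleMax φ (dyadic k)) := fun φ k => measurable_scaleMax _ _
  have hLt : L ≠ ∞ := ENNReal.pow_ne_top (ENNReal.mul_ne_top (by simp) hL)
  have hZL : ∀ k c, Z k c ^ 2 ≤ L * scaleMax H' (dyadic k) c ^ 2 := fun k c => by
    rw [hLdef, ← mul_pow]
    refine pow_le_pow_left' ?_ 2
    calc Z k c ≤ ∫⁻ u, (24 * scaleMax H' (dyadic k) c) * (κ u * harnackWeight u) := by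
          refine lintegral_mono fun u => ?_
          calc κ u * ‖haarDiff H (dyadic k) (c - dyadic k * u)‖ₑ
              ≤ κ u * (24 * (harnackWeight u * scaleMax H' (dyadic k) c)) := by
                refine mul_le_mul_right ((enorm_haarDiff_le H (dyadic_pos k) _).trans ?_) _
                exact mul_le_mul_right (scaleMax_harnack' H' (dyadic_pos k).le c u) _
            _ = _ := by ring
      _ = 24 * scaleMax H' (dyadic k) c * ∫⁻ u, κ u * harnackWeight u := by
          have hm : Measurable fun u => κ u * harnackWeight u := hκ.mul measurable_harnackWeight
          rw [lintegral_const_mul _ hm]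
      _ = _ := by ring
  have hmono : ∀ φ c, Monotone fun k => scaleMax φ (dyadic k) c := fun φ c a b hab =>
    scaleMax_anti φ (dyadic_pos b).le (dyadic_anti hab) c
  have hpt : ∀ c, ∑ i ∈ Finset.range n,
        scaleMax f' (dyadic (k + i)) c * Y (k + i) c * Z (k + i - j) c
      ≤ ∑ i ∈ Finset.range n, scaleMax f' (dyadic (k + i)) c * scaleMax H' (dyadic (k + i)) c
          / scaleMax G' (dyadic (k + i)) c * Y (k + i) c ^ 2
        + ∑ i ∈ Finset.range n, scaleMax f' (dyadic (k + i - j)) c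
          * scaleMax G' (dyadic (k + i - j)) c
          / scaleMax H' (dyadic (k + i - j)) c * Z (k + i - j) c ^ 2
        + L * (j * P c) := fun c =>
    sum_mul_shift_le (f := fun k => scaleMax f' (dyadic k) c)
      (m := fun k => scaleMax G' (dyadic k) c) (h := fun k => scaleMax H' (dyadic k) c)
      (y := fun k => Y k c) (z := fun k => Z k c)
      hLt (hmono _ _) (hmono _ _) (hmono _ _) (fun k => hf.scaleMax_ne_top _ _)
      (fun k => hG.scaleMax_ne_zero _ _) (fun k => hG.scaleMax_ne_top _ _)
      (fun k => hH.scaleMax_ne_zero _ _) (fun k => hH.scaleMax_ne_top _ _)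
      (fun k => mul_le_mul' (mul_le_mul' (scaleMax_le_intervalMax _ (dyadic_pos k).le _)
        (scaleMax_le_intervalMax _ (dyadic_pos k).le _))
        (scaleMax_le_intervalMax _ (dyadic_pos k).le _)) (fun k => hZL k c) k n j
  have hfin1 := sum_lintegral_weighted_sq_le hf hH hG hη (r := fun i => dyadic (k + i))
    (fun i => dyadic_pos _) (fun i => by
      show dyadic (k + (i + 1 : ℕ)) = _
      rw [← dyadic_add_one]; congr 1; push_cast; ring) (y := fun i => Y (k + i))
    (fun i c => le_rfl) n
  have hfin2 := sum_lintegral_weighted_sq_le hf hG hH hκ (r := fun i => dyadic (k + i - j))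
    (fun i => dyadic_pos _) (fun i => by
      show dyadic (k + (i + 1 : ℕ) - j) = _
      rw [← dyadic_add_one]; congr 1; push_cast; ring) (y := fun i => Z (k + i - j))
    (fun i c => le_rfl) n
  have hPm : Measurable P := ((measurable_intervalMax _ hf.measurable.enorm).mul
    (measurable_intervalMax _ hG.measurable.enorm)).mul (measurable_intervalMax _ hH.measurable.enorm)
  calc ∑ i ∈ Finset.range n, ∫⁻ c, x (k + i) c * y (k + i) c * z (k + i - j) c
      ≤ ∑ i ∈ Finset.range n, ∫⁻ c, K * (scaleMax f' (dyadic (k + i)) c * Y (k + i) c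
          * Z (k + i - j) c) := by
        refine Finset.sum_le_sum fun i _ => lintegral_mono fun c => ?_
        rw [← mul_assoc, ← mul_assoc]
        exact mul_le_mul' (mul_le_mul' (hx _ c) (hy _ c)) (hz _ c)
    _ = K * ∫⁻ c, ∑ i ∈ Finset.range n, scaleMax f' (dyadic (k + i)) c * Y (k + i) c
          * Z (k + i - j) c := by
        have hm : ∀ i : ℕ, Measurable fun c => scaleMax f' (dyadic (k + i)) c * Y (k + i) c
          * Z (k + i - j) c := fun i => ((hsm _ _).mul (hYm _)).mul (hZm _)
        rw [lintegral_finsetSum _ fun i _ => hm i, Finset.mul_sum]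
        exact Finset.sum_congr rfl fun i _ => lintegral_const_mul _ (hm i)
    _ ≤ K * (kernelConst η * 256 * (∫⁻ c, P c) + kernelConst κ * 256 * (∫⁻ c, P c)
          + L * (j * ∫⁻ c, P c)) := by
        refine mul_le_mul_right ((lintegral_mono hpt).trans ?_) K
        have hm1 : ∀ i : ℕ, Measurable fun c => scaleMax f' (dyadic (k + i)) c
          * scaleMax H' (dyadic (k + i)) c / scaleMax G' (dyadic (k + i)) c * Y (k + i) c ^ 2 :=
          fun i => (((hsm _ _).mul (hsm _ _)).div (hsm _ _)).mul ((hYm _).pow_const _)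
        have hm2 : ∀ i : ℕ, Measurable fun c => scaleMax f' (dyadic (k + i - j)) c
          * scaleMax G' (dyadic (k + i - j)) c / scaleMax H' (dyadic (k + i - j)) c
          * Z (k + i - j) c ^ 2 :=
          fun i => (((hsm _ _).mul (hsm _ _)).div (hsm _ _)).mul ((hZm _).pow_const _)
        rw [lintegral_add_right _ (by fun_prop),
          lintegral_add_right _ (Finset.measurable_fun_sum _ fun i _ => hm2 i),
          lintegral_finsetSum _ fun i _ => hm1 i, lintegral_finsetSum _ fun i _ => hm2 i,
          lintegral_const_mul _ (by fun_prop), lintegral_const_mul _ hPm]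
        refine add_le_add (add_le_add (hfin1.trans_eq ?_) hfin2) le_rfl
        congr 1
        exact lintegral_congr fun c => by simp only [hPdef]; ring
    _ = K * (kernelConst η * 256 + kernelConst κ * 256 + L * j) * ∫⁻ c, P c := by ring
    _ ≤ _ := by
        gcongr
        rw [trilinearConst, mul_add _ 1, mul_one, ← hLdef]
        refine add_le_add le_self_add ?_
        gcongr
        exact le_add_self

lemma scaleMax_eq_zero {f : ℝ → ℝ≥0∞} (hf : f =ᵐ[volume] 0) (h c : ℝ) : scaleMax f h c = 0 := by
  refine le_antisymm (scaleMax_le fun a b _ _ => ?_) zero_le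
  have : ∫⁻ y in Ioo (a : ℝ) b, f y = 0 := by
    rw [lintegral_congr_ae (ae_restrict_of_ae hf)]; simp
  rw [this]; simp

lemma haarDiff_eq_zero {G : ℝ → ℂ} (hG : G =ᵐ[volume] 0) (h c : ℝ) : haarDiff G h c = 0 := by
  have : ∀ h c, intervalAvg G h c = 0 := fun h c => by
    rw [intervalAvg, intervalIntegral.integral_congr_ae (g := 0) (by
      filter_upwards [hG] with y hy _ using hy)]
    simp
  simp [haarDiff, this]

theorem sum_lintegral_trilinear_le {f G H : ℝ → ℂ} (hf : Measurable f) (hG : Measurable G)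
    (hH : Measurable H) (hfb : ∃ B : ℝ≥0, ∀ x, ‖f x‖ₑ ≤ B) (hGb : ∃ B : ℝ≥0, ∀ x, ‖G x‖ₑ ≤ B)
    (hHb : ∃ B : ℝ≥0, ∀ x, ‖H x‖ₑ ≤ B) {η κ : ℝ → ℝ≥0∞} (hη : Measurable η)
    (hκ : Measurable κ) (hL : ∫⁻ u, κ u * harnackWeight u ≠ ∞) {K : ℝ≥0∞}
    {x y z : ℤ → ℝ → ℝ≥0∞}
    (hx : ∀ k c, x k c ≤ K * scaleMax (fun y => ‖f y‖ₑ) (dyadic k) c)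
    (hy : ∀ k c, y k c ≤ ∫⁻ u, η u * ‖haarDiff G (dyadic k) (c - dyadic k * u)‖ₑ)
    (hz : ∀ k c, z k c ≤ ∫⁻ u, κ u * ‖haarDiff H (dyadic k) (c - dyadic k * u)‖ₑ)
    (k : ℤ) (n j : ℕ) :
    ∑ i ∈ Finset.range n, ∫⁻ c, x (k + i) c * y (k + i) c * z (k + i - j) c
      ≤ K * (trilinearConst η κ * (1 + j)) * ∫⁻ c, intervalMax volume (fun y => ‖f y‖ₑ) c
        * intervalMax volume (fun y => ‖G y‖ₑ) c * intervalMax volume (fun y => ‖H y‖ₑ) c := by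
  by_cases hf0 : f =ᵐ[volume] 0
  · have : ∀ k c, x k c = 0 := fun k c => by
      have h0 : (fun y => ‖f y‖ₑ) =ᵐ[volume] 0 := by
        filter_upwards [hf0] with y hy; simp [hy]
      simpa [scaleMax_eq_zero h0] using hx k c
    simp [this]
  by_cases hG0 : G =ᵐ[volume] 0
  · have : ∀ k c, y k c = 0 := fun k c => by
      simpa [haarDiff_eq_zero hG0] using hy k c
    simp [this]
  by_cases hH0 : H =ᵐ[volume] 0
  · have : ∀ k c, z k c = 0 := fun k c => by
      simpa [haarDiff_eq_zero hH0] using hz k c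
    simp [this]
  exact sum_lintegral_trilinear_le_of_isBddNonzero ⟨hf, hfb, hf0⟩ ⟨hG, hGb, hG0⟩ ⟨hH, hHb, hH0⟩
    hη hκ hL hx hy hz k n j

lemma kernelConst_ne_top {η : ℝ → ℝ≥0∞} (h : ∫⁻ u, η u * harnackWeight u ^ 3 ≠ ∞) :
    kernelConst η ≠ ∞ := by
  refine ENNReal.mul_ne_top (ne_top_of_le_ne_top h (lintegral_mono fun u => ?_)) h
  have : 1 ≤ harnackWeight u := by
    rw [harnackWeight, ENNReal.one_le_ofReal]; linarith [abs_nonneg u]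
  exact le_mul_of_one_le_right' (one_le_pow₀ this)

lemma lintegral_mul_harnackWeight_ne_top {η : ℝ → ℝ≥0∞}
    (h : ∫⁻ u, η u * harnackWeight u ^ 3 ≠ ∞) : ∫⁻ u, η u * harnackWeight u ≠ ∞ := by
  refine ne_top_of_le_ne_top h (lintegral_mono fun u => ?_)
  have : 1 ≤ harnackWeight u := by
    rw [harnackWeight, ENNReal.one_le_ofReal]; linarith [abs_nonneg u]
  exact mul_le_mul_right (le_self_pow₀ this (by norm_num)) _

lemma trilinearConst_ne_top {η κ : ℝ → ℝ≥0∞} (hη : ∫⁻ u, η u * harnackWeight u ^ 3 ≠ ∞)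
    (hκ : ∫⁻ u, κ u * harnackWeight u ^ 3 ≠ ∞) : trilinearConst η κ ≠ ∞ := by
  have h1 := kernelConst_ne_top hη
  have h2 := kernelConst_ne_top hκ
  have h3 := lintegral_mul_harnackWeight_ne_top hκ
  exact ENNReal.add_ne_top.2 ⟨ENNReal.add_ne_top.2 ⟨ENNReal.mul_ne_top h1 (by simp),
    ENNReal.mul_ne_top h2 (by simp)⟩, ENNReal.pow_ne_top (ENNReal.mul_ne_top (by simp) h3)⟩

lemma lintegral_schwartz_mul_harnackWeight_ne_top (η : SchwartzMap ℝ ℂ) :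
    ∫⁻ u, ‖η u‖ₑ * harnackWeight u ^ 3 ≠ ∞ := by
  have hint : Integrable (fun u : ℝ => 27 * (‖u‖ ^ 0 * ‖η u‖) + 54 * (‖u‖ ^ 1 * ‖η u‖)
      + 36 * (‖u‖ ^ 2 * ‖η u‖) + 8 * (‖u‖ ^ 3 * ‖η u‖)) :=
    ((((η.integrable_pow_mul volume 0).const_mul _).add
      ((η.integrable_pow_mul volume 1).const_mul _)).add
      ((η.integrable_pow_mul volume 2).const_mul _)).add
      ((η.integrable_pow_mul volume 3).const_mul _)
  refine ne_top_of_le_ne_top hint.hasFiniteIntegral.ne (lintegral_mono fun u => ?_)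
  rw [harnackWeight, ← ofReal_norm, ← ENNReal.ofReal_pow (by positivity),
    ← ENNReal.ofReal_mul (norm_nonneg _), ← ofReal_norm]
  refine ENNReal.ofReal_le_ofReal ((le_of_eq ?_).trans (le_abs_self _))
  simp only [Real.norm_eq_abs]
  ring

/-- A Schwartz function is dominated by the integrable kernel of
`lintegral_mul_comp_le_scaleMax`. -/
lemma exists_enorm_schwartz_le (φ : SchwartzMap ℝ ℂ) :
    ∃ K : ℝ≥0, ∀ y, ‖φ y‖ₑ ≤ K * ENNReal.ofReal ((1 + |y|) ^ (-2 : ℤ)) := by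
  obtain ⟨C, hC⟩ := φ.decay 0 0
  obtain ⟨D, hD⟩ := φ.decay 2 0
  refine ⟨(2 * (C + D)).toNNReal, fun y => ?_⟩
  have h1 := hC.2 y
  have h2 := hD.2 y
  simp only [pow_zero, one_mul, norm_iteratedFDeriv_zero, Real.norm_eq_abs] at h1 h2
  have h0 : (0 : ℝ) < (1 + |y|) ^ 2 := by positivity
  have h3 : (1 + |y|) ^ 2 * ‖φ y‖ ≤ 2 * (C + D) := by
    nlinarith [sq_nonneg (1 - |y|), norm_nonneg (φ y)]
  rw [← ofReal_norm, ← ENNReal.ofReal.eq_1, ← ENNReal.ofReal_mul (by linarith [hC.1, hD.1])]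
  refine ENNReal.ofReal_le_ofReal ?_
  rw [zpow_neg, ← div_eq_mul_inv, le_div_iff₀ (by positivity), mul_comm]
  exact_mod_cast h3

/-- The character `t ↦ e^{2πit}`. -/
def char (t : ℝ) : ℂ := Complex.exp ((2 * π * t : ℝ) * Complex.I)

lemma char_add (s t : ℝ) : char (s + t) = char s * char t := by
  rw [char, char, char, ← Complex.exp_add]; congr 1; push_cast; ring

@[simp] lemma norm_char (t : ℝ) : ‖char t‖ = 1 := Complex.norm_exp_ofReal_mul_I _

@[fun_prop] lemma continuous_char : Continuous char := by unfold char; fun_prop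

lemma fourierInv_eq_integral_char (f : ℝ → ℂ) (x : ℝ) : 𝓕⁻ f x = ∫ ξ, char (x * ξ) * f ξ := by
  rw [Real.fourierInv_eq']
  refine integral_congr_ae (Eventually.of_forall fun ξ => ?_)
  simp only [char, smul_eq_mul, RCLike.inner_apply, conj_trivial]

lemma fourier_eq_integral_char (f : ℝ → ℂ) (x : ℝ) : 𝓕 f x = ∫ ξ, char (-(x * ξ)) * f ξ := by
  rw [Real.fourier_eq']
  refine integral_congr_ae (Eventually.of_forall fun ξ => ?_)
  simp only [char, smul_eq_mul, RCLike.inner_apply, conj_trivial, mul_neg, neg_mul]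

lemma Integrable.char_mul {f : ℝ → ℂ} (hf : Integrable f) {φ : ℝ → ℝ} (hφ : Continuous φ) :
    Integrable fun ξ => char (φ ξ) * f ξ :=
  hf.bdd_mul (c := 1) (by fun_prop) (by simp)

lemma norm_fourierInv_le (f : ℝ → ℂ) (x : ℝ) : ‖𝓕⁻ f x‖ ≤ ∫ ξ, ‖f ξ‖ := by
  rw [fourierInv_eq_integral_char]
  refine (norm_integral_le_integral_norm _).trans_eq ?_
  simp

lemma continuous_fourierInv {f : ℝ → ℂ} (hf : Integrable f) : Continuous (𝓕⁻ f) := by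
  have : 𝓕⁻ f = fun x => ∫ ξ, char (x * ξ) * f ξ := funext (fourierInv_eq_integral_char f)
  rw [this]
  refine continuous_of_dominated (bound := fun ξ => ‖f ξ‖)
    (fun x => (Integrable.char_mul hf (by fun_prop)).aestronglyMeasurable) (by simp) hf.norm ?_
  exact Eventually.of_forall fun ξ => by fun_prop

lemma integral_fourierInv_mul_eq {W G : ℝ → ℂ} (hW : Integrable W) (hG : Integrable G) :
    ∫ x, 𝓕⁻ W x * G x = ∫ ξ, W ξ * 𝓕⁻ G ξ := by
  simp only [fourierInv_eq_integral_char, ← integral_mul_const, ← integral_const_mul]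
  have hint : Integrable (Function.uncurry fun x ξ : ℝ => char (x * ξ) * W ξ * G x)
      (volume.prod volume) := by
    have := (hG.mul_prod hW).bdd_mul (c := 1) (f := fun p : ℝ × ℝ => char (p.1 * p.2))
      (by fun_prop) (by simp)
    refine this.congr (Eventually.of_forall fun p => ?_)
    simp only [Function.uncurry_def]; ring
  rw [integral_integral_swap hint]
  refine integral_congr_ae (Eventually.of_forall fun ξ => ?_)
  refine integral_congr_ae (Eventually.of_forall fun x => ?_)
  simp only [mul_comm x ξ]; ring

lemma fourierInv_char_mul (H : ℝ → ℂ) (η ζ : ℝ) :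
    𝓕⁻ (fun x => char (η * x) * H x) ζ = 𝓕⁻ H (η + ζ) := by
  simp only [fourierInv_eq_integral_char, ← mul_assoc, ← char_add, ← add_mul, add_comm ζ η]

lemma integral_mul_fourierInv_mul_fourierInv {W₁ W₂ H : ℝ → ℂ} (h₁ : Integrable W₁)
    (h₂ : Integrable W₂) (hH : Integrable H) :
    ∫ x, H x * 𝓕⁻ W₁ x * 𝓕⁻ W₂ x = ∫ η, ∫ ζ, W₁ η * W₂ ζ * 𝓕⁻ H (η + ζ) := by
  have hG : Integrable fun x => 𝓕⁻ W₂ x * H x :=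
    hH.bdd_mul (continuous_fourierInv h₂).aestronglyMeasurable
      (Eventually.of_forall (norm_fourierInv_le W₂))
  calc ∫ x, H x * 𝓕⁻ W₁ x * 𝓕⁻ W₂ x = ∫ x, 𝓕⁻ W₁ x * (𝓕⁻ W₂ x * H x) := by
        congr 1; ext x; ring
    _ = ∫ η, W₁ η * 𝓕⁻ (fun x => 𝓕⁻ W₂ x * H x) η := integral_fourierInv_mul_eq h₁ hG
    _ = ∫ η, W₁ η * ∫ ζ, W₂ ζ * 𝓕⁻ H (η + ζ) := by
        congr 1; ext η; congr 1
        rw [fourierInv_eq_integral_char]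
        calc _ = ∫ x, 𝓕⁻ W₂ x * (char (η * x) * H x) := by congr 1; ext x; ring
          _ = _ := by
            rw [integral_fourierInv_mul_eq h₂ (Integrable.char_mul hH (by fun_prop))]
            simp only [fourierInv_char_mul]
    _ = _ := by simp only [← integral_const_mul, mul_assoc]

/-- Averaging of translates: convolution with the `L¹`-normalised dilate of `θ` at scale `s`. -/
def dil (θ : ℝ → ℂ) (s : ℝ) (G : ℝ → ℂ) (c : ℝ) : ℂ := ∫ y, θ y * G (c - s * y)

lemma fourierInv_fourier_mul {d W : ℝ → ℂ} (hd : Integrable d) (hW : Integrable W) (s c : ℝ) :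
    𝓕⁻ (fun ξ => 𝓕 d (s * ξ) * W ξ) c = dil d s (𝓕⁻ W) c := by
  simp only [dil, fourierInv_eq_integral_char, fourier_eq_integral_char, ← integral_mul_const,
    ← integral_const_mul]
  have hint : Integrable (Function.uncurry fun ξ y : ℝ =>
      char (c * ξ) * (char (-(s * ξ * y)) * d y * W ξ)) (volume.prod volume) := by
    have := (hW.mul_prod hd).bdd_mul (c := 1)
      (f := fun p : ℝ × ℝ => char (c * p.1) * char (-(s * p.1 * p.2)))
      (by fun_prop) (by simp)
    refine this.congr (Eventually.of_forall fun p => ?_)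
    simp only [Function.uncurry_def]; ring
  rw [integral_integral_swap hint]
  refine integral_congr_ae (Eventually.of_forall fun y => ?_)
  refine integral_congr_ae (Eventually.of_forall fun ξ => ?_)
  have : (c - s * y) * ξ = c * ξ + -(s * ξ * y) := by ring
  simp only [this, char_add]; ring

lemma integrable_dil_prod {K h : ℝ → ℂ} (hK : Integrable K) (hh : Integrable h) (s : ℝ) :
    Integrable (Function.uncurry fun x y : ℝ => K y * h (x - s * y)) (volume.prod volume) := by
  have h1 := hh.mul_prod hK
  have hmp : MeasurePreserving (fun p : ℝ × ℝ => (p.1 - s * p.2, p.2))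
      (volume.prod volume) (volume.prod volume) := by
    have : MeasurePreserving (fun p : ℝ × ℝ => (p.1, p.2 - s * p.1))
        (volume.prod volume) (volume.prod volume) :=
      (MeasurePreserving.id volume).skew_product (g := fun y x => x - s * y) (by fun_prop)
        (Eventually.of_forall fun y => (measurePreserving_sub_right volume (s * y)).map_eq)
    exact (Measure.measurePreserving_swap.comp this).comp Measure.measurePreserving_swap
  refine (hmp.integrable_comp_of_integrable h1).congr (Eventually.of_forall fun p => ?_)
  simp only [Function.uncurry_def, Function.comp, mul_comm]

lemma integrable_dil {K h : ℝ → ℂ} (hK : Integrable K) (hh : Integrable h) (s : ℝ) :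
    Integrable (dil K s h) :=
  (integrable_dil_prod hK hh s).integral_prod_left

lemma fourierInv_dil {K h : ℝ → ℂ} (hK : Integrable K) (hh : Integrable h) (s ξ : ℝ) :
    𝓕⁻ (dil K s h) ξ = 𝓕⁻ K (s * ξ) * 𝓕⁻ h ξ := by
  rw [fourierInv_eq_integral_char]
  simp only [dil, ← integral_const_mul]
  have hint : Integrable (Function.uncurry fun x y : ℝ =>
      char (ξ * x) * (K y * h (x - s * y))) (volume.prod volume) :=
    (integrable_dil_prod hK hh s).bdd_mul (c := 1) (f := fun p : ℝ × ℝ => char (ξ * p.1))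
      (by fun_prop) (by simp)
  rw [integral_integral_swap hint, fourierInv_eq_integral_char K, ← integral_mul_const]
  refine integral_congr_ae (Eventually.of_forall fun y => ?_)
  simp only
  rw [fourierInv_eq_integral_char, ← integral_const_mul,
    ← integral_sub_right_eq_self (fun x => char (s * ξ * y) * K y * (char (ξ * x) * h x)) (s * y)]
  refine integral_congr_ae (Eventually.of_forall fun x => ?_)
  have : ξ * x = s * ξ * y + ξ * (x - s * y) := by ring
  simp only
  rw [this, char_add]; ring_nf

/-- The kernel of `haarDiff`. -/
def haarKernel : ℝ → ℂ := fun y =>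
  (Ioc (-2⁻¹) 0).indicator 1 y - (Ioc (-1) (-2⁻¹)).indicator 1 y

lemma integrable_haarKernel : Integrable haarKernel := by
  refine Integrable.sub ?_ ?_ <;>
  exact (integrable_indicator_iff measurableSet_Ioc).2 (integrableOn_const (by simp))

lemma integral_haarKernel_mul {φ : ℝ → ℂ} (hφ : ∀ a b, IntervalIntegrable φ volume a b) :
    ∫ y, haarKernel y * φ y = (∫ y in (-2⁻¹)..0, φ y) - ∫ y in (-1)..(-2⁻¹), φ y := by
  have h1 : ∀ a b : ℝ, a ≤ b → Integrable ((Ioc a b).indicator φ) := fun a b hab =>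
    (integrable_indicator_iff measurableSet_Ioc).2
      ((intervalIntegrable_iff_integrableOn_Ioc_of_le hab).1 (hφ a b))
  have h2 : ∀ y, haarKernel y * φ y
      = (Ioc (-2⁻¹) 0).indicator φ y - (Ioc (-1) (-2⁻¹)).indicator φ y := fun y => by
    rw [haarKernel, sub_mul]
    congr 1 <;> simp only [indicator] <;> split_ifs <;> simp
  simp only [h2]
  rw [integral_sub (h1 _ _ (by norm_num)) (h1 _ _ (by norm_num)),
    integral_indicator measurableSet_Ioc, integral_indicator measurableSet_Ioc,
    intervalIntegral.integral_of_le (by norm_num), intervalIntegral.integral_of_le (by norm_num)]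

lemma dil_haarKernel {G : ℝ → ℂ} (hG : ∀ a b, IntervalIntegrable G volume a b) {h : ℝ}
    (hh : 0 < h) (c : ℝ) : dil haarKernel h G c = haarDiff G h c := by
  have hint : ∀ a b, IntervalIntegrable (fun y => G (c - h * y)) volume a b := fun a b => by
    have := ((hG (c - h * a) (c - h * b)).comp_sub_left c).comp_mul_left (c := h)
    simpa [hh.ne'] using this
  rw [dil, integral_haarKernel_mul hint, intervalIntegral.integral_comp_sub_mul _ hh.ne',
    intervalIntegral.integral_comp_sub_mul _ hh.ne', haarDiff, intervalAvg, intervalAvg]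
  have e1 : c - h * 0 = c := by ring
  have e2 : c - h * -2⁻¹ = c + h / 2 := by ring
  have e3 : c - h * -1 = c + h / 2 + h / 2 := by ring
  rw [e1, e2, e3, ← smul_sub, ← smul_sub, smul_smul]
  congr 1
  field_simp

lemma fourier_haarKernel {ξ : ℝ} (hξ : ξ ≠ 0) : 𝓕 haarKernel ξ
    = -(1 - Complex.exp (π * ξ * Complex.I)) ^ 2 / (2 * π * ξ * Complex.I) := by
  rw [fourier_eq_integral_char]
  have hc : (-(2 * π * ξ * Complex.I) : ℂ) ≠ 0 := by
    simp [hξ, Real.pi_ne_zero]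
  have hchar : ∀ y : ℝ, char (-(ξ * y)) * haarKernel y
      = haarKernel y * Complex.exp (-(2 * π * ξ * Complex.I) * y) := fun y => by
    rw [char, mul_comm]; congr 2; push_cast; ring
  simp only [hchar]
  rw [integral_haarKernel_mul fun a b => (by fun_prop : Continuous _).intervalIntegrable a b,
    integral_exp_mul_complex hc, integral_exp_mul_complex hc]
  have e1 : -(2 * π * ξ * Complex.I) * ((-2⁻¹ : ℝ) : ℂ) = π * ξ * Complex.I := by
    push_cast; ring
  have e2 : -(2 * π * ξ * Complex.I) * ((-1 : ℝ) : ℂ) = π * ξ * Complex.I + π * ξ * Complex.I := by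
    push_cast; ring
  rw [e1, e2, Complex.exp_add]
  simp only [Complex.ofReal_zero, mul_zero, Complex.exp_zero]
  field_simp
  ring

lemma one_sub_exp_ne_zero {ξ : ℝ} (hξ : ξ ≠ 0) (h2 : |ξ| < 2) :
    1 - Complex.exp (π * ξ * Complex.I) ≠ 0 := by
  intro h
  obtain ⟨n, hn⟩ := Complex.exp_eq_one_iff.1 (sub_eq_zero.1 h).symm
  have h1 : (π * ξ * Complex.I : ℂ) = ((π * (2 * n) : ℝ) : ℂ) * Complex.I := by
    rw [hn]; push_cast; ring
  have h3 : π * ξ = π * (2 * n) := by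
    have := mul_right_cancel₀ Complex.I_ne_zero h1
    exact_mod_cast this
  have h4 : ξ = 2 * n := mul_left_cancel₀ Real.pi_ne_zero h3
  rw [h4, abs_mul, abs_two] at h2
  have h5 : |(n : ℝ)| < 1 := by linarith
  have h6 : n = 0 := Int.abs_lt_one_iff.1 (by exact_mod_cast h5)
  exact hξ (by rw [h4, h6]; simp)

/-- Division by the Haar symbol on an annulus where it does not vanish. -/
lemma exists_schwartz_fourier_haarKernel_mul {m : ℝ → ℂ} (hm : ContDiff ℝ ((⊤ : ℕ∞) : WithTop ℕ∞) m) {δ ρ : ℝ}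
    (hδ : 0 < δ) (hρ : ρ < 2) (hsupp : ∀ ξ, m ξ ≠ 0 → δ ≤ |ξ| ∧ |ξ| ≤ ρ) :
    ∃ η : SchwartzMap ℝ ℂ, ∀ ξ, 𝓕 haarKernel ξ * η ξ = m ξ := by
  have hcl : IsClosed {ξ : ℝ | δ ≤ |ξ| ∧ |ξ| ≤ ρ} :=
    (isClosed_le continuous_const continuous_abs).inter
      (isClosed_le continuous_abs continuous_const)
  have hts : tsupport m ⊆ {ξ : ℝ | δ ≤ |ξ| ∧ |ξ| ≤ ρ} := closure_minimal hsupp hcl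
  set q : ℝ → ℂ := fun ξ =>
    m ξ * (-(2 * π * ξ * Complex.I) * ((1 - Complex.exp (π * ξ * Complex.I)) ^ 2)⁻¹) with hq
  have hqm : ∀ ξ, m ξ = 0 → q ξ = 0 := fun ξ h => by simp [hq, h]
  have hsm : ContDiff ℝ ((⊤ : ℕ∞) : WithTop ℕ∞) q := by
    rw [contDiff_iff_contDiffAt]
    intro ξ
    by_cases hξ : ξ ∈ tsupport m
    · obtain ⟨h1, h2⟩ := hts hξ
      have h0 : ξ ≠ 0 := fun h => by simp [h] at h1; linarith
      refine hm.contDiffAt.mul (ContDiffAt.mul ?_ (ContDiffAt.inv ?_ ?_))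
      · exact ((((contDiffAt_const.mul contDiffAt_const).mul
          Complex.ofRealCLM.contDiff.contDiffAt).mul contDiffAt_const)).neg
      · exact (contDiffAt_const.sub ((contDiffAt_const.mul
          Complex.ofRealCLM.contDiff.contDiffAt).mul contDiffAt_const).cexp).pow 2
      · exact pow_ne_zero _ (one_sub_exp_ne_zero h0 (h2.trans_lt hρ))
    · have : q =ᶠ[𝓝 ξ] fun _ => 0 := by
        filter_upwards [notMem_tsupport_iff_eventuallyEq.1 hξ] with y hy
        exact hqm y hy
      exact contDiffAt_const.congr_of_eventuallyEq this
  have hcs : HasCompactSupport q := by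
    refine HasCompactSupport.of_support_subset_isCompact (isCompact_Icc (a := -ρ) (b := ρ)) ?_
    intro ξ hξ
    exact abs_le.1 (hsupp ξ fun h => hξ (hqm ξ h)).2
  refine ⟨hcs.toSchwartzMap hsm, fun ξ => ?_⟩
  rw [show (hcs.toSchwartzMap hsm) ξ = q ξ from rfl]
  by_cases hmξ : m ξ = 0
  · simp [hqm ξ hmξ, hmξ]
  obtain ⟨h1, h2⟩ := hsupp ξ hmξ
  have h0 : ξ ≠ 0 := fun h => by simp [h] at h1; linarith
  have h3 := one_sub_exp_ne_zero h0 (h2.trans_lt hρ)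
  have h4 : (ξ : ℂ) ≠ 0 := by exact_mod_cast h0
  rw [fourier_haarKernel h0]
  simp only [hq]
  field_simp

lemma dil_fourierInv_eq {η : SchwartzMap ℝ ℂ} {m : ℝ → ℂ}
    (hm : ∀ ξ, 𝓕 haarKernel ξ * η ξ = m ξ) {G : ℝ → ℂ} (hG : Measurable G)
    (hGb : ∃ B : ℝ≥0, ∀ x, ‖G x‖ₑ ≤ B) {s : ℝ} (hs : 0 < s) (c : ℝ) :
    dil (𝓕⁻ m) s G c = ∫ u, 𝓕⁻ (η : ℝ → ℂ) u * haarDiff G s (c - s * u) := by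
  set E : ℝ → ℂ := 𝓕⁻ (η : ℝ → ℂ) with hE
  have hEint : Integrable E := by
    have : E = (𝓕⁻ η : SchwartzMap ℝ ℂ) := (SchwartzMap.fourierInv_coe η).symm
    rw [this]; exact SchwartzMap.integrable _
  obtain ⟨B, hB⟩ := hGb
  have hB' : ∀ x, ‖G x‖ ≤ B := fun x => by
    have := hB x
    rwa [← ofReal_norm, ENNReal.ofReal_le_coe] at this
  have hGi : ∀ a b, IntervalIntegrable G volume a b := fun a b =>
    (Measure.integrableOn_of_bounded (s := uIcc a b) (M := B) (by simp) hG.aestronglyMeasurable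
      (Eventually.of_forall hB')).intervalIntegrable
  have h1 : ∀ y, 𝓕⁻ m y = ∫ v, haarKernel v * E (y - v) := fun y => by
    have := fourierInv_fourier_mul integrable_haarKernel η.integrable 1 y
    simp only [one_mul, dil] at this
    rw [← this]
    rw [show m = fun ξ => 𝓕 haarKernel ξ * η ξ from funext fun ξ => (hm ξ).symm]
  have hK := integrable_dil_prod integrable_haarKernel hEint 1
  simp only [dil, h1, ← integral_mul_const]
  have hint1 : Integrable (Function.uncurry fun y v : ℝ =>
      haarKernel v * E (y - v) * G (c - s * y)) (volume.prod volume) := by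
    refine (hK.bdd_mul (c := B) (f := fun p : ℝ × ℝ => G (c - s * p.1))
      (hG.comp (by fun_prop)).aestronglyMeasurable
      (Eventually.of_forall fun p => hB' _)).congr (Eventually.of_forall fun p => ?_)
    simp only [Function.uncurry_def, one_mul]; ring
  rw [integral_integral_swap hint1]
  have h2 : ∀ v : ℝ, ∫ y, haarKernel v * E (y - v) * G (c - s * y)
      = ∫ u, haarKernel v * E u * G (c - s * u - s * v) := fun v => by
    rw [← integral_sub_right_eq_self (fun u => haarKernel v * E u * G (c - s * u - s * v)) v]
    refine integral_congr_ae (Eventually.of_forall fun y => ?_)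
    simp only
    congr 2; ring
  simp only [h2]
  have hint2 : Integrable (Function.uncurry fun v u : ℝ =>
      haarKernel v * E u * G (c - s * u - s * v)) (volume.prod volume) := by
    refine ((integrable_haarKernel.mul_prod hEint).bdd_mul (c := B)
      (f := fun p : ℝ × ℝ => G (c - s * p.2 - s * p.1))
      (hG.comp (by fun_prop)).aestronglyMeasurable
      (Eventually.of_forall fun p => hB' _)).congr (Eventually.of_forall fun p => ?_)
    simp only [Function.uncurry_def]; ring
  rw [integral_integral_swap hint2]
  refine integral_congr_ae (Eventually.of_forall fun u => ?_)
  simp only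
  rw [← dil_haarKernel hGi hs, dil, ← integral_const_mul]
  refine integral_congr_ae (Eventually.of_forall fun v => ?_)
  simp only; ring

/-- A dilated average whose symbol is supported in an annulus is an average of Haar
differences, with a rapidly decreasing weight. -/
lemma exists_enorm_dil_fourierInv_le {m : ℝ → ℂ} (hm : ContDiff ℝ ((⊤ : ℕ∞) : WithTop ℕ∞) m)
    {δ ρ : ℝ} (hδ : 0 < δ) (hρ : ρ < 2) (hsupp : ∀ ξ, m ξ ≠ 0 → δ ≤ |ξ| ∧ |ξ| ≤ ρ) :
    ∃ η : SchwartzMap ℝ ℂ, ∀ G : ℝ → ℂ, Measurable G → (∃ B : ℝ≥0, ∀ x, ‖G x‖ₑ ≤ B) →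
      ∀ s, 0 < s → ∀ c,
        ‖dil (𝓕⁻ m) s G c‖ₑ ≤ ∫⁻ u, ‖η u‖ₑ * ‖haarDiff G s (c - s * u)‖ₑ := by
  obtain ⟨η, hη⟩ := exists_schwartz_fourier_haarKernel_mul hm hδ hρ hsupp
  refine ⟨𝓕⁻ η, fun G hG hGb s hs c => ?_⟩
  rw [dil_fourierInv_eq hη hG hGb hs]
  refine (enorm_integral_le_lintegral_enorm _).trans_eq ?_
  simp only [enorm_mul, SchwartzMap.fourierInv_coe]

/-- A smooth even cutoff, equal to `1` on `[-1/8, 1/8]` and supported in `[-1/4, 1/4]`. -/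
def cutoffBump : ContDiffBump (0 : ℝ) := ⟨1 / 8, 1 / 4, by norm_num, by norm_num⟩

/-- The low-frequency cutoff. -/
def cutoff (ξ : ℝ) : ℝ := cutoffBump ξ

lemma contDiff_cutoff : ContDiff ℝ ((⊤ : ℕ∞) : WithTop ℕ∞) cutoff := cutoffBump.contDiff

lemma cutoff_nonneg (ξ : ℝ) : 0 ≤ cutoff ξ := cutoffBump.nonneg

lemma cutoff_le_one (ξ : ℝ) : cutoff ξ ≤ 1 := cutoffBump.le_one

lemma cutoff_eq_one {ξ : ℝ} (h : |ξ| ≤ 1 / 8) : cutoff ξ = 1 :=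
  cutoffBump.one_of_mem_closedBall (by simpa [cutoffBump] using h)

lemma cutoff_eq_zero {ξ : ℝ} (h : 1 / 4 ≤ |ξ|) : cutoff ξ = 0 :=
  cutoffBump.zero_of_le_dist (by simpa [cutoffBump] using h)

/-- The annular cutoff. -/
def annulus (ξ : ℝ) : ℝ := cutoff ξ - cutoff (2 * ξ)

lemma annulus_eq_zero_of_le {ξ : ℝ} (h : |ξ| ≤ 1 / 16) : annulus ξ = 0 := by
  rw [annulus, cutoff_eq_one (by linarith), cutoff_eq_one, sub_self]
  rw [abs_mul, abs_two]; linarith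

lemma annulus_eq_zero_of_ge {ξ : ℝ} (h : 1 / 4 ≤ |ξ|) : annulus ξ = 0 := by
  rw [annulus, cutoff_eq_zero h, cutoff_eq_zero, sub_self]
  rw [abs_mul, abs_two]; linarith

lemma contDiff_annulus : ContDiff ℝ ((⊤ : ℕ∞) : WithTop ℕ∞) annulus :=
  contDiff_cutoff.sub (contDiff_cutoff.comp (contDiff_const.mul contDiff_id))

/-- The annular symbol of homogeneity `β`, at unit scale dilated by `r`. -/
def annulusSymbol (β r : ℝ) (ξ : ℝ) : ℂ := ((|ξ| ^ β * annulus (r * ξ) : ℝ) : ℂ)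

lemma annulusSymbol_support {β r ξ : ℝ} (hr : 0 < r) (h : annulusSymbol β r ξ ≠ 0) :
    1 / 16 / r ≤ |ξ| ∧ |ξ| ≤ 1 / 4 / r := by
  constructor
  · by_contra! hc
    apply h
    rw [annulusSymbol, annulus_eq_zero_of_le, mul_zero, Complex.ofReal_zero]
    rw [abs_mul, abs_of_pos hr, mul_comm]
    exact ((lt_div_iff₀ hr).1 hc).le
  · by_contra! hc
    apply h
    rw [annulusSymbol, annulus_eq_zero_of_ge, mul_zero, Complex.ofReal_zero]
    rw [abs_mul, abs_of_pos hr, mul_comm]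
    exact ((div_lt_iff₀ hr).1 hc).le

lemma contDiff_annulusSymbol (β : ℝ) {r : ℝ} (hr : 0 < r) :
    ContDiff ℝ ((⊤ : ℕ∞) : WithTop ℕ∞) (annulusSymbol β r) := by
  refine Complex.ofRealCLM.contDiff.comp (contDiff_iff_contDiffAt.2 fun ξ => ?_)
  by_cases hξ : ξ = 0
  · have : (fun ξ => |ξ| ^ β * annulus (r * ξ)) =ᶠ[𝓝 ξ] fun _ => 0 := by
      have : ∀ᶠ y in 𝓝 ξ, |y| < 1 / 16 / r :=
        continuous_abs.continuousAt.eventually_lt_const (by rw [hξ, abs_zero]; positivity)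
      filter_upwards [this] with y hy
      rw [annulus_eq_zero_of_le, mul_zero]
      rw [abs_mul, abs_of_pos hr, mul_comm]
      exact ((lt_div_iff₀ hr).1 hy).le
    exact contDiffAt_const.congr_of_eventuallyEq this
  · refine ContDiffAt.mul ?_ (contDiff_annulus.contDiffAt.comp ξ
      (contDiffAt_const.mul contDiffAt_id))
    exact (contDiffAt_abs hξ).rpow_const_of_ne (by simpa using hξ)

lemma hasCompactSupport_annulusSymbol (β : ℝ) {r : ℝ} (hr : 0 < r) :
    HasCompactSupport (annulusSymbol β r) := by
  refine HasCompactSupport.of_support_subset_isCompact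
    (isCompact_Icc (a := -(1 / 4 / r)) (b := 1 / 4 / r)) ?_
  intro ξ hξ
  exact abs_le.1 (annulusSymbol_support hr hξ).2

/-- The cutoff as a Schwartz function, dilated by `r`. -/
lemma exists_schwartz_cutoff {r : ℝ} (hr : 0 < r) :
    ∃ φ : SchwartzMap ℝ ℂ, ∀ ξ, φ ξ = (cutoff (r * ξ) : ℂ) := by
  have h1 : HasCompactSupport fun ξ : ℝ => (cutoff (r * ξ) : ℂ) := by
    refine HasCompactSupport.of_support_subset_isCompact
      (isCompact_Icc (a := -(1 / 4 / r)) (b := 1 / 4 / r)) ?_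
    intro ξ hξ
    refine abs_le.1 ?_
    by_contra! hc
    apply hξ
    simp only
    rw [cutoff_eq_zero, Complex.ofReal_zero]
    rw [abs_mul, abs_of_pos hr, mul_comm]
    exact ((div_lt_iff₀ hr).1 hc).le
  have h2 : ContDiff ℝ ((⊤ : ℕ∞) : WithTop ℕ∞) fun ξ : ℝ => (cutoff (r * ξ) : ℂ) :=
    Complex.ofRealCLM.contDiff.comp (contDiff_cutoff.comp (contDiff_const.mul contDiff_id))
  exact ⟨h1.toSchwartzMap h2, fun ξ => rfl⟩

lemma cutoff_neg (ξ : ℝ) : cutoff (-ξ) = cutoff ξ := cutoffBump.neg ξ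

lemma annulusSymbol_neg (β r ξ : ℝ) : annulusSymbol β r (-ξ) = annulusSymbol β r ξ := by
  simp only [annulusSymbol, annulus, abs_neg, mul_neg, cutoff_neg]

/-- The annular symbol as a Schwartz function. -/
def annulusSchwartz (β : ℝ) {r : ℝ} (hr : 0 < r) : SchwartzMap ℝ ℂ :=
  (hasCompactSupport_annulusSymbol β hr).toSchwartzMap (contDiff_annulusSymbol β hr)

lemma coe_annulusSchwartz (β : ℝ) {r : ℝ} (hr : 0 < r) :
    (annulusSchwartz β hr : ℝ → ℂ) = annulusSymbol β r := rfl

lemma integrable_fourierInv_schwartz (φ : SchwartzMap ℝ ℂ) : Integrable (𝓕⁻ (φ : ℝ → ℂ)) := by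
  rw [← SchwartzMap.fourierInv_coe]; exact SchwartzMap.integrable _

lemma fourier_fourierInv_schwartz (φ : SchwartzMap ℝ ℂ) : 𝓕 (𝓕⁻ (φ : ℝ → ℂ)) = φ := by
  refine φ.continuous.fourier_fourierInv_eq φ.integrable ?_
  rw [← SchwartzMap.fourier_coe]; exact SchwartzMap.integrable _

lemma fourierInv_fourierInv_annulusSymbol (β : ℝ) {r : ℝ} (hr : 0 < r) (ξ : ℝ) :
    𝓕⁻ (𝓕⁻ (annulusSymbol β r)) ξ = annulusSymbol β r ξ := by
  rw [Real.fourierInv_eq_fourier_neg, ← coe_annulusSchwartz β hr, fourier_fourierInv_schwartz,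
    coe_annulusSchwartz, annulusSymbol_neg]

/-- Littlewood–Paley truncation to frequencies at most about `2 ^ k`. -/
def lowCut (k : ℤ) (ξ : ℝ) : ℝ := cutoff (dyadic k * ξ)

lemma lowCut_nonneg (k : ℤ) (ξ : ℝ) : 0 ≤ lowCut k ξ := cutoff_nonneg _

lemma lowCut_le_one (k : ℤ) (ξ : ℝ) : lowCut k ξ ≤ 1 := cutoff_le_one _

@[fun_prop] lemma continuous_lowCut (k : ℤ) : Continuous (lowCut k) :=
  contDiff_cutoff.continuous.comp (by fun_prop)

/-- Littlewood–Paley block at frequency about `2 ^ k`. -/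
def block (k : ℤ) (ξ : ℝ) : ℝ := lowCut k ξ - lowCut (k - 1) ξ

@[fun_prop] lemma continuous_block (k : ℤ) : Continuous (block k) := by
  unfold block; fun_prop

lemma abs_block_le (k : ℤ) (ξ : ℝ) : |block k ξ| ≤ 1 := by
  rw [block, abs_le]
  constructor <;> linarith [lowCut_nonneg k ξ, lowCut_nonneg (k - 1) ξ, lowCut_le_one k ξ,
    lowCut_le_one (k - 1) ξ]

lemma dyadic_sub_one (k : ℤ) : dyadic (k - 1) = 2 * dyadic k := by
  have := dyadic_add_one (k - 1)
  rw [sub_add_cancel] at this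
  linarith

lemma dyadic_add_two (k : ℤ) : dyadic (k + 2) = dyadic k / 4 := by
  have h1 := dyadic_add_one k
  have h2 := dyadic_add_one (k + 1)
  rw [show k + 2 = k + 1 + 1 by ring, h2, h1]; ring

lemma lowCut_sub_one (k : ℤ) (ξ : ℝ) : lowCut (k - 1) ξ = cutoff (2 * (dyadic k * ξ)) := by
  rw [lowCut, dyadic_sub_one, mul_assoc]

lemma block_eq_annulus (k : ℤ) (ξ : ℝ) : block k ξ = annulus (dyadic k * ξ) := by
  rw [block, lowCut_sub_one, annulus, lowCut]

lemma dyadic_sub (k j : ℤ) : dyadic (k - j) = (2 : ℝ) ^ j * dyadic k := by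
  rw [dyadic, dyadic, ← zpow_add₀ two_ne_zero]; congr 1; ring

lemma dyadic_mul_abs_lt_of_lowCut_ne_zero {k : ℤ} {ξ : ℝ} (h : lowCut k ξ ≠ 0) :
    dyadic k * |ξ| < 1 / 4 := by
  by_contra! hc
  exact h (cutoff_eq_zero (by rwa [abs_mul, abs_of_pos (dyadic_pos k)]))

lemma lowCut_eq_one {k : ℤ} {ξ : ℝ} (h : dyadic k * |ξ| ≤ 1 / 8) : lowCut k ξ = 1 :=
  cutoff_eq_one (by rwa [abs_mul, abs_of_pos (dyadic_pos k)])

lemma tendsto_dyadic_atTop : Tendsto (fun n : ℕ => dyadic n) atTop (𝓝 0) := by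
  have : (fun n : ℕ => dyadic n) = fun n : ℕ => (2⁻¹ : ℝ) ^ n := by
    ext n; simp [dyadic]
  rw [this]
  exact tendsto_pow_atTop_nhds_zero_of_lt_one (by norm_num) (by norm_num)

lemma eventually_lowCut_add_eq_one (ξ : ℝ) : ∀ᶠ n : ℕ in atTop, lowCut n ξ = 1 := by
  have : Tendsto (fun n : ℕ => dyadic n * |ξ|) atTop (𝓝 (0 * |ξ|)) :=
    tendsto_dyadic_atTop.mul_const _
  filter_upwards [this.eventually_le_const (u := 1 / 8) (by norm_num)] with n hn
  exact lowCut_eq_one hn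

lemma eventually_lowCut_sub_eq_zero {ξ : ℝ} (hξ : ξ ≠ 0) (k : ℤ) :
    ∀ᶠ n : ℕ in atTop, lowCut (k - n) ξ = 0 := by
  have h1 : Tendsto (fun n : ℕ => (2 : ℝ) ^ n * (dyadic k * |ξ|)) atTop atTop :=
    (tendsto_pow_atTop_atTop_of_one_lt one_lt_two).atTop_mul_const
      (mul_pos (dyadic_pos k) (abs_pos.2 hξ))
  filter_upwards [h1.eventually_ge_atTop (1 / 4)] with n hn
  refine cutoff_eq_zero ?_
  rw [abs_mul, abs_of_pos (dyadic_pos _), dyadic_sub, zpow_natCast, mul_assoc]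
  exact hn

/-- The high-low and low-high interactions at frequency `2 ^ k`. -/
def interaction (k : ℤ) (p : ℝ × ℝ) : ℝ :=
  block k p.1 * lowCut k p.2 + lowCut (k - 1) p.1 * block k p.2

@[fun_prop] lemma continuous_interaction (k : ℤ) : Continuous (interaction k) := by
  unfold interaction; fun_prop

lemma interaction_eq (k : ℤ) (p : ℝ × ℝ) : interaction k p
    = lowCut k p.1 * lowCut k p.2 - lowCut (k - 1) p.1 * lowCut (k - 1) p.2 := by
  rw [interaction, block, block]; ring

lemma abs_interaction_le (k : ℤ) (p : ℝ × ℝ) : |interaction k p| ≤ 2 := by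
  have h : ∀ x y : ℝ, |x| ≤ 1 → |y| ≤ 1 → |x * y| ≤ 1 := fun x y hx hy => by
    rw [abs_mul]; exact mul_le_one₀ hx (abs_nonneg _) hy
  have hl : ∀ k ξ, |lowCut k ξ| ≤ 1 := fun k ξ =>
    abs_le.2 ⟨by linarith [lowCut_nonneg k ξ], lowCut_le_one k ξ⟩
  have := abs_add_le (block k p.1 * lowCut k p.2) (lowCut (k - 1) p.1 * block k p.2)
  have h1 := h _ _ (abs_block_le k p.1) (hl k p.2)
  have h2 := h _ _ (hl (k - 1) p.1) (abs_block_le k p.2)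
  rw [interaction]; linarith

lemma lowCut_mul_interaction (k : ℤ) (p : ℝ × ℝ) :
    lowCut (k + 2) (p.1 + p.2) * interaction k p = interaction k p := by
  have key : ∀ i j : ℤ, k - 1 ≤ i → i ≤ k → k - 1 ≤ j → j ≤ k →
      lowCut (k + 2) (p.1 + p.2) * (lowCut i p.1 * lowCut j p.2)
        = lowCut i p.1 * lowCut j p.2 := fun i j _ hi _ hj => by
    by_cases h1 : lowCut i p.1 = 0
    · simp [h1]
    by_cases h2 : lowCut j p.2 = 0
    · simp [h2]
    rw [lowCut_eq_one, one_mul]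
    have h3 := dyadic_mul_abs_lt_of_lowCut_ne_zero h1
    have h4 := dyadic_mul_abs_lt_of_lowCut_ne_zero h2
    have h5 : dyadic k * |p.1| ≤ dyadic i * |p.1| := by gcongr; exact dyadic_anti hi
    have h6 : dyadic k * |p.2| ≤ dyadic j * |p.2| := by gcongr; exact dyadic_anti hj
    have h7 := mul_le_mul_of_nonneg_left (abs_add_le p.1 p.2) (dyadic_pos k).le
    rw [dyadic_add_two]; linarith
  rw [interaction_eq, mul_sub, key k k (by simp) le_rfl (by simp) le_rfl,
    key (k - 1) (k - 1) le_rfl (by simp) le_rfl (by simp)]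

lemma sum_interaction (N : ℕ) (p : ℝ × ℝ) :
    ∑ i ∈ Finset.range (2 * N + 1), interaction (-N + i) p
      = lowCut N p.1 * lowCut N p.2 - lowCut (-1 - N) p.1 * lowCut (-1 - N) p.2 := by
  have h : ∀ n : ℕ, ∑ i ∈ Finset.range n, interaction (-N + i) p
      = lowCut (-1 - N + n) p.1 * lowCut (-1 - N + n) p.2
        - lowCut (-1 - N) p.1 * lowCut (-1 - N) p.2 := fun n => by
    induction n with
    | zero => simp
    | succ n ih =>
      rw [Finset.sum_range_succ, ih, interaction_eq]
      have e1 : -(N : ℤ) + n - 1 = -1 - N + n := by ring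
      have e2 : -(N : ℤ) + n = -1 - N + (n + 1 : ℕ) := by push_cast; ring
      rw [e1, e2]; ring
  rw [h]
  have : (-1 - N + (2 * N + 1 : ℕ) : ℤ) = N := by push_cast; ring
  rw [this]

lemma sum_block (k : ℤ) (J : ℕ) (ξ : ℝ) :
    ∑ j ∈ Finset.range J, block (k - j) ξ = lowCut k ξ - lowCut (k - J) ξ := by
  induction J with
  | zero => simp
  | succ J ih =>
    rw [Finset.sum_range_succ, ih, block]
    have : k - J - 1 = k - (J + 1 : ℕ) := by push_cast; ring
    rw [this]; ring

/-- The doubly truncated paraproduct symbol. -/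
def paraSymbol (N J : ℕ) (p : ℝ × ℝ) : ℝ :=
  ∑ i ∈ Finset.range (2 * N + 1), ∑ j ∈ Finset.range J,
    block (-N + i + 2 - j) (p.1 + p.2) * interaction (-N + i) p

lemma eventually_paraSymbol_eq (N : ℕ) {p : ℝ × ℝ} (hp : p.1 + p.2 ≠ 0) :
    ∀ᶠ J in atTop, paraSymbol N J p
      = lowCut N p.1 * lowCut N p.2 - lowCut (-1 - N) p.1 * lowCut (-1 - N) p.2 := by
  have h : ∀ᶠ J : ℕ in atTop, ∀ i ∈ Finset.range (2 * N + 1),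
      lowCut (-N + i + 2 - J) (p.1 + p.2) = 0 := by
    rw [Filter.eventually_all_finset]
    exact fun i _ => eventually_lowCut_sub_eq_zero hp _
  filter_upwards [h] with J hJ
  rw [paraSymbol, ← sum_interaction]
  refine Finset.sum_congr rfl fun i hi => ?_
  rw [← Finset.sum_mul, sum_block, hJ i hi, sub_zero, lowCut_mul_interaction]

lemma abs_paraSymbol_le (N J : ℕ) (p : ℝ × ℝ) : |paraSymbol N J p| ≤ (2 * N + 1) * 2 := by
  refine (Finset.abs_sum_le_sum_abs _ _).trans ?_
  refine (Finset.sum_le_card_nsmul _ _ 2 fun i _ => ?_).trans_eq (by simp)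
  rw [← Finset.sum_mul, sum_block, abs_mul]
  refine (mul_le_mul (abs_le.2 ⟨?_, ?_⟩) (abs_interaction_le _ _) (abs_nonneg _)
    zero_le_one).trans_eq (one_mul 2) <;>
  linarith [lowCut_nonneg (-N + i + 2) (p.1 + p.2), lowCut_le_one (-N + i + 2) (p.1 + p.2),
    lowCut_nonneg (-N + i + 2 - J) (p.1 + p.2), lowCut_le_one (-N + i + 2 - J) (p.1 + p.2)]

lemma eventually_lowCut_mul_lowCut_sub_eq_one {p : ℝ × ℝ} (hp : p.1 + p.2 ≠ 0) :
    ∀ᶠ N : ℕ in atTop, lowCut N p.1 * lowCut N p.2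
      - lowCut (-1 - N) p.1 * lowCut (-1 - N) p.2 = 1 := by
  have h0 : ∀ᶠ N : ℕ in atTop, lowCut (-1 - N) p.1 * lowCut (-1 - N) p.2 = 0 := by
    by_cases h1 : p.1 = 0
    · have h2 : p.2 ≠ 0 := fun h2 => hp (by rw [h1, h2, add_zero])
      filter_upwards [eventually_lowCut_sub_eq_zero h2 (-1)] with N hN
      rw [hN, mul_zero]
    · filter_upwards [eventually_lowCut_sub_eq_zero h1 (-1)] with N hN
      rw [hN, zero_mul]
  filter_upwards [h0, eventually_lowCut_add_eq_one p.1, eventually_lowCut_add_eq_one p.2]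
    with N h1 h2 h3
  rw [h1, h2, h3]; norm_num

lemma integrable_one_add_abs_rpow_mul (φ : SchwartzMap ℝ ℂ) (α : ℝ) :
    Integrable fun ξ : ℝ => (((1 + |ξ|) ^ α : ℝ) : ℂ) * φ ξ := by
  obtain ⟨n, hn⟩ := exists_nat_ge α
  have h0 := φ.integrable_pow_mul volume 0
  have h1 := φ.integrable_pow_mul volume n
  refine ((h0.add h1).const_mul (2 ^ (n - 1))).mono' ?_ (Eventually.of_forall fun ξ => ?_)
  · have : Measurable fun ξ : ℝ => (((1 + |ξ|) ^ α : ℝ) : ℂ) := by fun_prop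
    exact this.aestronglyMeasurable.mul φ.continuous.aestronglyMeasurable
  · have h2 : (1 + |ξ|) ^ α ≤ (1 + |ξ|) ^ n := by
      rw [← Real.rpow_natCast]
      exact Real.rpow_le_rpow_of_exponent_le (by linarith [abs_nonneg ξ]) hn
    have h3 := add_pow_le zero_le_one (abs_nonneg ξ) n
    have h4 : 0 ≤ (1 + |ξ|) ^ α := by positivity
    simp only [norm_mul, Complex.norm_real, Real.norm_eq_abs, abs_of_nonneg h4, Pi.add_apply,
      ← add_mul, ← mul_assoc, pow_zero]
    rw [one_pow] at h3
    gcongr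
    exact h2.trans h3

lemma fourierInv_fourier_schwartz (φ : SchwartzMap ℝ ℂ) : 𝓕⁻ (𝓕 (φ : ℝ → ℂ)) = φ := by
  refine φ.continuous.fourierInv_fourier_eq φ.integrable ?_
  rw [← SchwartzMap.fourier_coe]; exact SchwartzMap.integrable _

lemma integrable_fourier_schwartz (φ : SchwartzMap ℝ ℂ) : Integrable (𝓕 (φ : ℝ → ℂ)) := by
  rw [← SchwartzMap.fourier_coe]; exact SchwartzMap.integrable _

lemma continuous_fourier_schwartz (φ : SchwartzMap ℝ ℂ) : Continuous (𝓕 (φ : ℝ → ℂ)) := by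
  rw [← SchwartzMap.fourier_coe]; exact SchwartzMap.continuous _

lemma fourier_mul_schwartz (f g : SchwartzMap ℝ ℂ) (ξ : ℝ) :
    𝓕 (fun x => f x * g x) ξ = ∫ η, 𝓕 (f : ℝ → ℂ) η * 𝓕 (g : ℝ → ℂ) (ξ - η) := by
  have h := integral_fourierInv_mul_eq (integrable_fourier_schwartz f)
    (Integrable.char_mul g.integrable (φ := fun x => -ξ * x) (by fun_prop))
  simp only [fourierInv_char_mul, fourierInv_fourier_schwartz] at h
  rw [fourier_eq_integral_char]
  calc _ = ∫ x, f x * (char (-ξ * x) * g x) := by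
        congr 1; ext x; rw [show -ξ * x = -(ξ * x) by ring]; ring
    _ = _ := by
        rw [h]; congr 1; ext η
        rw [Real.fourierInv_eq_fourier_neg, show -(-ξ + η) = ξ - η by ring]

/-- The pointwise product of two Schwartz functions. -/
def schwartzMul (f g : SchwartzMap ℝ ℂ) : SchwartzMap ℝ ℂ :=
  SchwartzMap.pairing (ContinuousLinearMap.mul ℂ ℂ) f g

lemma coe_schwartzMul (f g : SchwartzMap ℝ ℂ) :
    (schwartzMul f g : ℝ → ℂ) = fun x => f x * g x := rfl

lemma integrable_abs_rpow_mul_fourier (f : SchwartzMap ℝ ℂ) {α : ℝ} (hα : 0 ≤ α) :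
    Integrable fun ξ : ℝ => ((|ξ| ^ α : ℝ) : ℂ) * 𝓕 (f : ℝ → ℂ) ξ := by
  refine (integrable_one_add_abs_rpow_mul (𝓕 f) α).mono ?_ (Eventually.of_forall fun ξ => ?_)
  · have : Measurable fun ξ : ℝ => ((|ξ| ^ α : ℝ) : ℂ) := by fun_prop
    exact this.aestronglyMeasurable.mul (continuous_fourier_schwartz f).aestronglyMeasurable
  · have h1 : 0 ≤ |ξ| ^ α := by positivity
    have h2 : 0 ≤ (1 + |ξ|) ^ α := by positivity
    rw [norm_mul, norm_mul, Complex.norm_real, Complex.norm_real, Real.norm_of_nonneg h1,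
      Real.norm_of_nonneg h2, SchwartzMap.fourier_coe]
    gcongr
    linarith

/-- The bilinear Fourier multiplier form with symbol `m`, tested against `h`. -/
def leibnizForm (f g : SchwartzMap ℝ ℂ) (h : ℝ → ℂ) (m : ℝ × ℝ → ℝ) : ℂ :=
  ∫ p : ℝ × ℝ, (m p : ℂ) * (𝓕 (f : ℝ → ℂ) p.1 * 𝓕 (g : ℝ → ℂ) p.2 * 𝓕⁻ h (p.1 + p.2))

lemma integrable_fourier_mul_fourier (f g : SchwartzMap ℝ ℂ) {h : ℝ → ℂ} (hh : Integrable h)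
    {α : ℝ} (hα : 0 ≤ α) :
    Integrable fun p : ℝ × ℝ => ((|p.1 + p.2| ^ α : ℝ) : ℂ)
      * (𝓕 (f : ℝ → ℂ) p.1 * 𝓕 (g : ℝ → ℂ) p.2 * 𝓕⁻ h (p.1 + p.2)) := by
  have h1 := ((integrable_one_add_abs_rpow_mul (𝓕 f) α).mul_prod
    (integrable_one_add_abs_rpow_mul (𝓕 g) α)).bdd_mul (c := ∫ x, ‖h x‖)
    (f := fun p : ℝ × ℝ => 𝓕⁻ h (p.1 + p.2))
    ((continuous_fourierInv hh).comp (by fun_prop)).aestronglyMeasurable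
    (Eventually.of_forall fun p => norm_fourierInv_le h _)
  refine h1.mono ?_ (Eventually.of_forall fun p => ?_)
  · have : Measurable fun p : ℝ × ℝ => ((|p.1 + p.2| ^ α : ℝ) : ℂ) := by fun_prop
    refine this.aestronglyMeasurable.mul ?_
    exact ((((continuous_fourier_schwartz f).comp continuous_fst).mul
      ((continuous_fourier_schwartz g).comp continuous_snd)).mul
      ((continuous_fourierInv hh).comp
        (continuous_fst.add continuous_snd))).aestronglyMeasurable
  · have h2 : |p.1 + p.2| ^ α ≤ (1 + |p.1|) ^ α * (1 + |p.2|) ^ α := by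
      rw [← Real.mul_rpow (by positivity) (by positivity)]
      refine Real.rpow_le_rpow (abs_nonneg _) ?_ hα
      have := abs_add_le p.1 p.2
      nlinarith [abs_nonneg p.1, abs_nonneg p.2, mul_nonneg (abs_nonneg p.1) (abs_nonneg p.2)]
    have e1 : 0 ≤ |p.1 + p.2| ^ α := by positivity
    have e2 : 0 ≤ (1 + |p.1|) ^ α := by positivity
    have e3 : 0 ≤ (1 + |p.2|) ^ α := by positivity
    simp only [norm_mul, Complex.norm_real, Real.norm_of_nonneg e1, Real.norm_of_nonneg e2,
      Real.norm_of_nonneg e3, SchwartzMap.fourier_coe]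
    calc _ ≤ ((1 + |p.1|) ^ α * (1 + |p.2|) ^ α)
        * (‖𝓕 (f : ℝ → ℂ) p.1‖ * ‖𝓕 (g : ℝ → ℂ) p.2‖ * ‖𝓕⁻ h (p.1 + p.2)‖) := by gcongr
      _ = _ := by ring

lemma integral_Dop_mul (f g : SchwartzMap ℝ ℂ) {h : ℝ → ℂ} (hh : Integrable h)
    {α : ℝ} (hα : 0 ≤ α) :
    ∫ x, Dop α (fun x => f x * g x) x * h x
      = leibnizForm f g h fun p => |p.1 + p.2| ^ α := by
  have hint := integrable_fourier_mul_fourier f g hh hα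
  have hW := integrable_abs_rpow_mul_fourier (schwartzMul f g) hα
  rw [coe_schwartzMul] at hW
  have h1 := integral_fourierInv_mul_eq hW hh
  have hmp := measurePreserving_prod_sub_swap (G := ℝ) volume volume
  set Φ : ℝ × ℝ → ℂ := fun p => ((|p.1 + p.2| ^ α : ℝ) : ℂ)
      * (𝓕 (f : ℝ → ℂ) p.1 * 𝓕 (g : ℝ → ℂ) p.2 * 𝓕⁻ h (p.1 + p.2)) with hΦ
  have hint' : Integrable (fun z : ℝ × ℝ => Φ (z.2, z.1 - z.2)) (volume.prod volume) :=
    hmp.integrable_comp_of_integrable hint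
  calc ∫ x, Dop α (fun x => f x * g x) x * h x
      = ∫ ξ, ((|ξ| ^ α : ℝ) : ℂ) * 𝓕 (fun x => f x * g x) ξ * 𝓕⁻ h ξ := h1
    _ = ∫ ξ, ∫ η, Φ (η, ξ - η) := by
        congr 1; ext ξ
        rw [fourier_mul_schwartz, mul_assoc, ← integral_mul_const, ← integral_const_mul]
        congr 1; ext η
        simp only [hΦ, add_sub_cancel]
    _ = ∫ z : ℝ × ℝ, Φ (z.2, z.1 - z.2) := (integral_prod _ hint').symm
    _ = ∫ p, Φ p := by
        rw [Measure.volume_eq_prod, ← hmp.map_eq] at hint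
        have := integral_map hmp.measurable.aemeasurable hint.aestronglyMeasurable
        rw [hmp.map_eq] at this
        exact this.symm

lemma leibnizForm_swap (f g : SchwartzMap ℝ ℂ) (h : ℝ → ℂ) (m : ℝ × ℝ → ℝ) :
    leibnizForm f g h m = leibnizForm g f h fun p => m p.swap := by
  rw [leibnizForm, leibnizForm]
  have := (Measure.measurePreserving_swap (μ := (volume : Measure ℝ))
    (ν := (volume : Measure ℝ))).integral_comp MeasurableEquiv.prodComm.measurableEmbedding
    (fun p : ℝ × ℝ => (m p : ℂ) * (𝓕 (f : ℝ → ℂ) p.1 * 𝓕 (g : ℝ → ℂ) p.2 * 𝓕⁻ h (p.1 + p.2)))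
  refine this.symm.trans ?_
  congr 1; ext p
  simp only [Prod.fst_swap, Prod.snd_swap, add_comm p.2]
  ring

lemma integrable_leibnizForm (f g : SchwartzMap ℝ ℂ) {h : ℝ → ℂ} (hh : Integrable h)
    {α : ℝ} (hα : 0 ≤ α) {m : ℝ × ℝ → ℝ} (hm : Measurable m) {B : ℝ} (hB : ∀ p, |m p| ≤ B) :
    Integrable fun p : ℝ × ℝ => ((|p.1 + p.2| ^ α * m p : ℝ) : ℂ)
      * (𝓕 (f : ℝ → ℂ) p.1 * 𝓕 (g : ℝ → ℂ) p.2 * 𝓕⁻ h (p.1 + p.2)) := by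
  have := (integrable_fourier_mul_fourier f g hh hα).bdd_mul (c := B)
    (f := fun p => ((m p : ℝ) : ℂ)) (by fun_prop) (Eventually.of_forall fun p => by
      rw [Complex.norm_real]; exact hB p)
  refine this.congr (Eventually.of_forall fun p => ?_)
  simp only [Complex.ofReal_mul]; ring

lemma enorm_leibnizForm_le_of_tendsto (f g : SchwartzMap ℝ ℂ) {h : ℝ → ℂ} (hh : Integrable h)
    {α : ℝ} (hα : 0 < α) {m : ℕ → ℝ × ℝ → ℝ} {m₀ : ℝ × ℝ → ℝ} (hm : ∀ n, Measurable (m n))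
    {B : ℝ} (hB : ∀ n p, |m n p| ≤ B)
    (hlim : ∀ p : ℝ × ℝ, p.1 + p.2 ≠ 0 → ∀ᶠ n in atTop, m n p = m₀ p) {R : ℝ≥0∞}
    (hR : ∀ n, ‖leibnizForm f g h fun p => |p.1 + p.2| ^ α * m n p‖ₑ ≤ R) :
    ‖leibnizForm f g h fun p => |p.1 + p.2| ^ α * m₀ p‖ₑ ≤ R := by
  have hbound := (integrable_fourier_mul_fourier f g hh hα.le).norm.const_mul B
  have hT : Tendsto (fun n => leibnizForm f g h fun p => |p.1 + p.2| ^ α * m n p) atTop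
      (𝓝 (leibnizForm f g h fun p => |p.1 + p.2| ^ α * m₀ p)) := by
    refine tendsto_integral_of_dominated_convergence _
      (fun n => (integrable_leibnizForm f g hh hα.le (hm n) (hB n)).aestronglyMeasurable)
      hbound (fun n => Eventually.of_forall fun p => ?_) (Eventually.of_forall fun p => ?_)
    · rw [Complex.ofReal_mul, mul_comm _ ((m n p : ℝ) : ℂ), mul_assoc, norm_mul,
        Complex.norm_real]
      exact mul_le_mul_of_nonneg_right (hB n p) (norm_nonneg _)
    · by_cases hp : p.1 + p.2 = 0
      · simp [hp, Real.zero_rpow hα.ne']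
      · refine tendsto_const_nhds.congr' ?_
        filter_upwards [hlim p hp] with n hn
        rw [hn]
  exact le_of_tendsto' ((continuous_enorm.tendsto _).comp hT) hR

lemma measurable_paraSymbol (N J : ℕ) : Measurable (paraSymbol N J) := by
  unfold paraSymbol
  exact Continuous.measurable (by fun_prop)

lemma enorm_integral_Dop_mul_le (f g : SchwartzMap ℝ ℂ) {h : ℝ → ℂ} (hh : Integrable h)
    {α : ℝ} (hα : 0 < α) {R : ℝ≥0∞}
    (hR : ∀ N J, ‖leibnizForm f g h fun p => |p.1 + p.2| ^ α * paraSymbol N J p‖ₑ ≤ R) :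
    ‖∫ x, Dop α (fun x => f x * g x) x * h x‖ₑ ≤ R := by
  have hc : ∀ (k : ℤ) (p : ℝ × ℝ), 0 ≤ lowCut k p.1 * lowCut k p.2
      ∧ lowCut k p.1 * lowCut k p.2 ≤ 1 := fun k p =>
    ⟨mul_nonneg (lowCut_nonneg _ _) (lowCut_nonneg _ _),
      mul_le_one₀ (lowCut_le_one _ _) (lowCut_nonneg _ _) (lowCut_le_one _ _)⟩
  have h1 := fun N => enorm_leibnizForm_le_of_tendsto f g hh hα (m := paraSymbol N)
    (measurable_paraSymbol N) (abs_paraSymbol_le N)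
    (fun p hp => eventually_paraSymbol_eq N hp) (hR N)
  have h2 := enorm_leibnizForm_le_of_tendsto f g hh hα (B := 1)
    (m₀ := fun _ => 1) (fun N => Continuous.measurable (by fun_prop)) (fun N p => by
      have a := hc N p
      have b := hc (-1 - N) p
      rw [abs_le]; constructor <;> linarith [a.1, a.2, b.1, b.2])
    (fun p hp => eventually_lowCut_mul_lowCut_sub_eq_one hp) h1
  rw [integral_Dop_mul f g hh hα.le]
  simpa using h2

/-- The localised paraproduct symbol with output frequency `2 ^ (k - j)`, first input frequency
`2 ^ k` and second input frequency at most `2 ^ k / r`. -/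
def pieceSymbol (r : ℝ) (k : ℤ) (j : ℕ) (p : ℝ × ℝ) : ℝ :=
  block (k + 2 - j) (p.1 + p.2) * (block k p.1 * cutoff (r * (dyadic k * p.2)))

lemma continuous_cutoff : Continuous cutoff := contDiff_cutoff.continuous

lemma continuous_pieceSymbol (r : ℝ) (k : ℤ) (j : ℕ) : Continuous (pieceSymbol r k j) := by
  have := continuous_cutoff
  unfold pieceSymbol; fun_prop

lemma abs_pieceSymbol_le (r : ℝ) (k : ℤ) (j : ℕ) (p : ℝ × ℝ) : |pieceSymbol r k j p| ≤ 1 := by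
  have h := cutoff_nonneg (r * (dyadic k * p.2))
  rw [pieceSymbol, abs_mul, abs_mul, abs_of_nonneg h]
  exact mul_le_one₀ (abs_block_le _ _) (by positivity)
    (mul_le_one₀ (abs_block_le _ _) h (cutoff_le_one _))

lemma paraSymbol_eq_sum_pieceSymbol (N J : ℕ) (p : ℝ × ℝ) :
    paraSymbol N J p = ∑ i ∈ Finset.range (2 * N + 1), ∑ j ∈ Finset.range J,
      (pieceSymbol 1 (-N + i) j p + pieceSymbol 2 (-N + i) j p.swap) := by
  refine Finset.sum_congr rfl fun i _ => Finset.sum_congr rfl fun j _ => ?_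
  simp only [pieceSymbol, interaction, one_mul, Prod.fst_swap, Prod.snd_swap, lowCut_sub_one,
    add_comm p.2 p.1]
  simp only [lowCut]
  ring

lemma annulus_zero : annulus 0 = 0 := annulus_eq_zero_of_le (by norm_num)

lemma annulusSymbol_neg_dyadic_mul (α : ℝ) (k : ℤ) (η : ℝ) :
    annulusSymbol (-α) 1 (dyadic k * η) * ((|η| ^ α : ℝ) : ℂ)
      = ((dyadic k ^ (-α) * block k η : ℝ) : ℂ) := by
  rw [annulusSymbol, ← Complex.ofReal_mul, block_eq_annulus, one_mul]
  congr 1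
  rcases eq_or_ne η 0 with rfl | h
  · simp [annulus_zero]
  · have h1 : |η| ^ (-α) * |η| ^ α = 1 := by
      rw [← Real.rpow_add (abs_pos.2 h)]; simp
    rw [abs_mul, abs_of_pos (dyadic_pos k), Real.mul_rpow (dyadic_pos k).le (abs_nonneg _)]
    calc _ = dyadic k ^ (-α) * annulus (dyadic k * η) * (|η| ^ (-α) * |η| ^ α) := by ring
      _ = _ := by rw [h1, mul_one]

lemma annulusSymbol_quarter_dyadic_mul (α : ℝ) (k : ℤ) (ξ : ℝ) :
    annulusSymbol α (1 / 4) (dyadic k * ξ)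
      = ((dyadic k ^ α * (|ξ| ^ α * block (k + 2) ξ) : ℝ) : ℂ) := by
  rw [annulusSymbol, block_eq_annulus, dyadic_add_two, abs_mul, abs_of_pos (dyadic_pos k),
    Real.mul_rpow (dyadic_pos k).le (abs_nonneg _),
    show 1 / 4 * (dyadic k * ξ) = dyadic k / 4 * ξ by ring, mul_assoc]

lemma integral_dil_mul_dil_mul_dil (α : ℝ) (hα : 0 < α) (f g : SchwartzMap ℝ ℂ) {h : ℝ → ℂ}
    (hh : Integrable h) {r : ℝ} {φ : SchwartzMap ℝ ℂ}
    (hφ : ∀ ξ, φ ξ = (cutoff (r * ξ) : ℂ)) (k : ℤ) (j : ℕ) :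
    ∫ x, dil (𝓕⁻ (annulusSymbol α (1 / 4))) (dyadic (k - j)) h x
        * dil (𝓕⁻ (annulusSymbol (-α) 1)) (dyadic k) (Dop α f) x
        * dil (𝓕⁻ (φ : ℝ → ℂ)) (dyadic k) g x
      = (((2 : ℝ) ^ j) ^ α : ℝ)
        * leibnizForm f g h fun p => |p.1 + p.2| ^ α * pieceSymbol r k j p := by
  have hα4 : (0 : ℝ) < 1 / 4 := by norm_num
  have hK : Integrable (𝓕⁻ (annulusSymbol α (1 / 4))) :=
    integrable_fourierInv_schwartz (annulusSchwartz α hα4)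
  have hθ : Integrable (𝓕⁻ (annulusSymbol (-α) 1)) :=
    integrable_fourierInv_schwartz (annulusSchwartz (-α) one_pos)
  have hθ' : 𝓕 (𝓕⁻ (annulusSymbol (-α) 1)) = annulusSymbol (-α) 1 :=
    fourier_fourierInv_schwartz (annulusSchwartz (-α) one_pos)
  have e1 : ∀ x, dil (𝓕⁻ (annulusSymbol (-α) 1)) (dyadic k) (Dop α f) x
      = 𝓕⁻ (fun η => ((dyadic k ^ (-α) * block k η : ℝ) : ℂ) * 𝓕 (f : ℝ → ℂ) η) x := fun x => by
    rw [Dop, FMul, ← fourierInv_fourier_mul hθ (integrable_abs_rpow_mul_fourier f hα.le), hθ']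
    simp only [← mul_assoc, annulusSymbol_neg_dyadic_mul]
  have e2 : ∀ x, dil (𝓕⁻ (φ : ℝ → ℂ)) (dyadic k) g x
      = 𝓕⁻ (fun ζ => (cutoff (r * (dyadic k * ζ)) : ℂ) * 𝓕 (g : ℝ → ℂ) ζ) x := fun x => by
    rw [← fourierInv_fourier_schwartz g, ← fourierInv_fourier_mul
      (integrable_fourierInv_schwartz φ) (integrable_fourier_schwartz g),
      fourier_fourierInv_schwartz, fourierInv_fourier_schwartz]
    simp only [hφ]
  have i1 : Integrable fun η => ((dyadic k ^ (-α) * block k η : ℝ) : ℂ) * 𝓕 (f : ℝ → ℂ) η := by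
    refine (integrable_fourier_schwartz f).bdd_mul (c := dyadic k ^ (-α))
      (Continuous.aestronglyMeasurable (by fun_prop)) (Eventually.of_forall fun η => ?_)
    rw [Complex.norm_real, norm_mul, Real.norm_of_nonneg (by have := dyadic_pos k; positivity)]
    exact mul_le_of_le_one_right (by have := dyadic_pos k; positivity) (abs_block_le k η)
  have i2 : Integrable fun ζ => (cutoff (r * (dyadic k * ζ)) : ℂ) * 𝓕 (g : ℝ → ℂ) ζ := by
    have := continuous_cutoff
    refine (integrable_fourier_schwartz g).bdd_mul (c := 1)
      (Continuous.aestronglyMeasurable (by fun_prop)) (Eventually.of_forall fun η => ?_)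
    rw [Complex.norm_real, Real.norm_of_nonneg (cutoff_nonneg _)]
    exact cutoff_le_one _
  simp only [e1, e2]
  rw [integral_mul_fourierInv_mul_fourierInv i1 i2 (integrable_dil hK hh _), leibnizForm,
    Measure.volume_eq_prod, integral_prod]
  · simp only [← integral_const_mul]
    refine integral_congr_ae (Eventually.of_forall fun η => integral_congr_ae
      (Eventually.of_forall fun ζ => ?_))
    have e3 : dyadic (k - j) ^ α = (2 ^ j) ^ α * dyadic k ^ α := by
      rw [dyadic_sub, zpow_natCast, Real.mul_rpow (by positivity) (dyadic_pos k).le]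
    have e4 : dyadic k ^ α * dyadic k ^ (-α) = 1 := by
      rw [← Real.rpow_add (dyadic_pos k)]; simp
    have e5 : ((dyadic k ^ α : ℝ) : ℂ) * ((dyadic k ^ (-α) : ℝ) : ℂ) = 1 := by
      rw [← Complex.ofReal_mul, e4, Complex.ofReal_one]
    simp only [fourierInv_dil hK hh, fourierInv_fourierInv_annulusSymbol α hα4,
      annulusSymbol_quarter_dyadic_mul, e3, pieceSymbol,
      show k - (j : ℤ) + 2 = k + 2 - j by ring, Complex.ofReal_mul]
    linear_combination (((2 ^ j) ^ α : ℝ) : ℂ) * ((|η + ζ| ^ α : ℝ) : ℂ)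
      * (block (k + 2 - j) (η + ζ) : ℂ) * (block k η : ℂ) * (cutoff (r * (dyadic k * ζ)) : ℂ)
      * 𝓕 (f : ℝ → ℂ) η * 𝓕 (g : ℝ → ℂ) ζ * 𝓕⁻ h (η + ζ) * e5
  · exact integrable_leibnizForm f g hh hα.le (continuous_pieceSymbol r k j).measurable
      (abs_pieceSymbol_le r k j)

lemma continuous_Dop (f : SchwartzMap ℝ ℂ) {α : ℝ} (hα : 0 ≤ α) : Continuous (Dop α f) :=
  continuous_fourierInv (integrable_abs_rpow_mul_fourier f hα)

lemma exists_enorm_Dop_le (f : SchwartzMap ℝ ℂ) (α : ℝ) :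
    ∃ B : ℝ≥0, ∀ x, ‖Dop α f x‖ₑ ≤ B :=
  ⟨(∫ ξ : ℝ, ‖((|ξ| ^ α : ℝ) : ℂ) * 𝓕 (f : ℝ → ℂ) ξ‖).toNNReal, fun x => by
    rw [← ofReal_norm]
    exact ENNReal.ofReal_le_ofReal (norm_fourierInv_le _ x)⟩

lemma exists_enorm_schwartz_le_const (f : SchwartzMap ℝ ℂ) : ∃ B : ℝ≥0, ∀ x, ‖f x‖ₑ ≤ B := by
  obtain ⟨C, hC⟩ := f.decay 0 0
  refine ⟨C.toNNReal, fun x => ?_⟩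
  rw [← ofReal_norm]
  exact ENNReal.ofReal_le_ofReal (by simpa using hC.2 x)

/-- The integral of the product of three maximal functions. -/
def maxIntegral (f g h : ℝ → ℝ≥0∞) : ℝ≥0∞ :=
  ∫⁻ c, intervalMax volume f c * intervalMax volume g c * intervalMax volume h c

lemma exists_sum_enorm_leibnizForm_le {α : ℝ} (hα : 0 < α) {r : ℝ} (hr : 0 < r) :
    ∃ C : ℝ≥0∞, C ≠ ∞ ∧ ∀ (f g : SchwartzMap ℝ ℂ) (h : ℝ → ℂ), Measurable h → Integrable h →
      (∃ B : ℝ≥0, ∀ x, ‖h x‖ₑ ≤ B) → ∀ (k : ℤ) (n J : ℕ),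
      ∑ i ∈ Finset.range n, ∑ j ∈ Finset.range J,
        ‖leibnizForm f g h fun p => |p.1 + p.2| ^ α * pieceSymbol r (k + i) j p‖ₑ
      ≤ C * maxIntegral (‖g ·‖ₑ) (‖Dop α f ·‖ₑ) (‖h ·‖ₑ) := by
  obtain ⟨φ, hφ⟩ := exists_schwartz_cutoff hr
  obtain ⟨K, hK⟩ := exists_enorm_schwartz_le (𝓕⁻ φ)
  obtain ⟨η, hη⟩ := exists_enorm_dil_fourierInv_le (contDiff_annulusSymbol (-α) one_pos)
    (by norm_num : (0 : ℝ) < 1 / 16 / 1) (by norm_num : (1 : ℝ) / 4 / 1 < 2)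
    (fun ξ hξ => annulusSymbol_support one_pos hξ)
  obtain ⟨κ, hκ⟩ := exists_enorm_dil_fourierInv_le
    (contDiff_annulusSymbol α (by norm_num : (0 : ℝ) < 1 / 4))
    (by norm_num : (0 : ℝ) < 1 / 16 / (1 / 4)) (by norm_num : (1 : ℝ) / 4 / (1 / 4) < 2)
    (fun ξ hξ => annulusSymbol_support (by norm_num) hξ)
  set A := trilinearConst (fun u => ‖η u‖ₑ) (fun u => ‖κ u‖ₑ) with hA
  have hη3 := lintegral_schwartz_mul_harnackWeight_ne_top η
  have hκ3 := lintegral_schwartz_mul_harnackWeight_ne_top κ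
  have hAt : A ≠ ∞ := trilinearConst_ne_top hη3 hκ3
  set S : ℝ≥0∞ := ∑' j : ℕ, (ENNReal.ofReal ((2 ^ j) ^ α))⁻¹ * (1 + j) with hS
  have hSt : S ≠ ∞ := by
    have hρ : ‖(2 : ℝ) ^ (-α)‖ < 1 := by
      rw [Real.norm_of_nonneg (by positivity)]
      exact Real.rpow_lt_one_of_one_lt_of_neg one_lt_two (by linarith)
    have hs := (summable_geometric_of_norm_lt_one hρ).add
      (summable_pow_mul_geometric_of_norm_lt_one 1 hρ)
    refine ne_top_of_le_ne_top hs.tsum_ofReal_ne_top (ENNReal.tsum_le_tsum fun j => ?_)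
    have h2 : ((2 : ℝ) ^ (-α)) ^ j = ((2 ^ j) ^ α)⁻¹ := by
      rw [Real.rpow_neg two_pos.le, inv_pow, ← Real.rpow_natCast, ← Real.rpow_natCast,
        ← Real.rpow_mul two_pos.le, ← Real.rpow_mul two_pos.le, mul_comm α]
    rw [h2, ← ENNReal.ofReal_inv_of_pos (by positivity), show (1 + j : ℝ≥0∞)
      = ENNReal.ofReal (1 + j) by rw [ENNReal.ofReal_add (by simp) (by simp)]; simp,
      ← ENNReal.ofReal_mul (by positivity)]
    refine (congrArg ENNReal.ofReal ?_).le
    ring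
  refine ⟨S * (32 * K * A), ENNReal.mul_ne_top hSt (ENNReal.mul_ne_top
    (ENNReal.mul_ne_top (by simp) (by simp)) hAt), fun f g h hhm hh hhb k n J => ?_⟩
  set x : ℤ → ℝ → ℝ≥0∞ := fun k c => ‖dil (𝓕⁻ (φ : ℝ → ℂ)) (dyadic k) g c‖ₑ with hx
  set y : ℤ → ℝ → ℝ≥0∞ := fun k c =>
    ‖dil (𝓕⁻ (annulusSymbol (-α) 1)) (dyadic k) (Dop α f) c‖ₑ with hy
  set z : ℤ → ℝ → ℝ≥0∞ := fun k c =>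
    ‖dil (𝓕⁻ (annulusSymbol α (1 / 4))) (dyadic k) h c‖ₑ with hz
  have hD := (continuous_Dop f hα.le).measurable
  have hDb := exists_enorm_Dop_le f α
  have hxb : ∀ k c, x k c ≤ 32 * K * scaleMax (fun y => ‖g y‖ₑ) (dyadic k) c := fun k c => by
    refine (enorm_integral_le_lintegral_enorm _).trans ?_
    simp only [enorm_mul]
    refine lintegral_mul_comp_le_scaleMax g.continuous.measurable.enorm (fun y => ?_)
      (dyadic_pos k) c
    rw [← SchwartzMap.fourierInv_coe]; exact hK y
  have key : ∀ j : ℕ, ∑ i ∈ Finset.range n,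
      ‖leibnizForm f g h fun p => |p.1 + p.2| ^ α * pieceSymbol r (k + i) j p‖ₑ
      ≤ (ENNReal.ofReal ((2 ^ j) ^ α))⁻¹ * (1 + j) * (32 * K * A * maxIntegral (‖g ·‖ₑ) (‖Dop α f ·‖ₑ) (‖h ·‖ₑ)) := by
    intro j
    have hpos : (0 : ℝ) < (2 ^ j) ^ α := by positivity
    have h1 : ∀ i : ℕ,
        ‖leibnizForm f g h fun p => |p.1 + p.2| ^ α * pieceSymbol r (k + i) j p‖ₑ
        ≤ (ENNReal.ofReal ((2 ^ j) ^ α))⁻¹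
          * ∫⁻ c, x (k + i) c * y (k + i) c * z (k + i - j) c := fun i => by
      rw [← ENNReal.mul_le_iff_le_inv (by simpa using hpos) (by simp)]
      have := integral_dil_mul_dil_mul_dil α hα f g hh hφ (k + i) j
      calc _ = ‖(((2 : ℝ) ^ j) ^ α : ℝ) * leibnizForm f g h fun p =>
            |p.1 + p.2| ^ α * pieceSymbol r (k + i) j p‖ₑ := by
            rw [enorm_mul, ← ofReal_norm ((((2 : ℝ) ^ j) ^ α : ℝ) : ℂ), Complex.norm_real,
              Real.norm_of_nonneg hpos.le]
        _ ≤ _ := by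
            rw [← this]
            refine (enorm_integral_le_lintegral_enorm _).trans_eq ?_
            refine lintegral_congr fun c => ?_
            simp only [enorm_mul, hx, hy, hz]; ring
    refine (Finset.sum_le_sum fun i _ => h1 i).trans ?_
    rw [← Finset.mul_sum]
    have h2 := sum_lintegral_trilinear_le g.continuous.measurable hD hhm
      (exists_enorm_schwartz_le_const g) hDb hhb η.continuous.measurable.enorm
      κ.continuous.measurable.enorm (lintegral_mul_harnackWeight_ne_top hκ3) hxb
      (fun k c => hη _ hD hDb _ (dyadic_pos k) c) (fun k c => hκ _ hhm hhb _ (dyadic_pos k) c)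
      k n j
    refine (mul_le_mul_right h2 _).trans_eq ?_
    rw [maxIntegral]; ring
  rw [Finset.sum_comm]
  calc _ ≤ ∑ j ∈ Finset.range J, (ENNReal.ofReal ((2 ^ j) ^ α))⁻¹ * (1 + j)
        * (32 * K * A * maxIntegral (‖g ·‖ₑ) (‖Dop α f ·‖ₑ) (‖h ·‖ₑ)) := Finset.sum_le_sum fun j _ => key j
    _ ≤ _ := by
      rw [← Finset.sum_mul, mul_assoc S]
      exact mul_le_mul_left (ENNReal.sum_le_tsum _) _

/-- **Fractional Leibniz rule at fixed time**, in dual maximal-function form. -/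
theorem exists_enorm_integral_Dop_mul_le {α : ℝ} (hα : 0 < α) :
    ∃ C : ℝ≥0∞, C ≠ ∞ ∧ ∀ (f g : SchwartzMap ℝ ℂ) (h : ℝ → ℂ), Measurable h → Integrable h →
      (∃ B : ℝ≥0, ∀ x, ‖h x‖ₑ ≤ B) →
      ‖∫ x, Dop α (fun x => f x * g x) x * h x‖ₑ
        ≤ C * (maxIntegral (‖g ·‖ₑ) (‖Dop α f ·‖ₑ) (‖h ·‖ₑ) + maxIntegral (‖f ·‖ₑ) (‖Dop α g ·‖ₑ) (‖h ·‖ₑ)) := by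
  obtain ⟨C₁, hC₁, H₁⟩ := exists_sum_enorm_leibnizForm_le hα one_pos
  obtain ⟨C₂, hC₂, H₂⟩ := exists_sum_enorm_leibnizForm_le hα two_pos
  refine ⟨C₁ + C₂, by simp [hC₁, hC₂], fun f g h hhm hh hhb => ?_⟩
  refine enorm_integral_Dop_mul_le f g hh hα fun N J => ?_
  have i1 := fun (i j : ℕ) => integrable_leibnizForm f g hh hα.le
    (continuous_pieceSymbol 1 (-N + i) j).measurable (abs_pieceSymbol_le 1 (-N + i) j)
  have i2 := fun (i j : ℕ) => integrable_leibnizForm f g hh hα.le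
    (m := fun p => pieceSymbol 2 (-N + i) j p.swap)
    ((continuous_pieceSymbol 2 (-N + i) j).measurable.comp measurable_swap)
    (fun p => abs_pieceSymbol_le 2 (-N + i) j p.swap)
  have e : (leibnizForm f g h fun p => |p.1 + p.2| ^ α * paraSymbol N J p)
      = ∑ i ∈ Finset.range (2 * N + 1), ∑ j ∈ Finset.range J,
        ((leibnizForm f g h fun p => |p.1 + p.2| ^ α * pieceSymbol 1 (-N + i) j p)
          + leibnizForm g f h fun p => |p.1 + p.2| ^ α * pieceSymbol 2 (-N + i) j p) := by
    have e2 : ∀ i j : ℕ, (leibnizForm g f h fun p => |p.1 + p.2| ^ α * pieceSymbol 2 (-N + i) j p)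
        = leibnizForm f g h fun p => |p.1 + p.2| ^ α * pieceSymbol 2 (-N + i) j p.swap :=
      fun i j => by
        rw [leibnizForm_swap]; congr 1; ext p
        simp only [Prod.fst_swap, Prod.snd_swap, add_comm]
    have e3 := fun i j : ℕ => integral_add (i1 i j) (i2 i j)
    simp only [leibnizForm] at e2 ⊢
    simp only [e2]
    simp only [← e3]
    rw [integral_congr_ae (Eventually.of_forall fun p => ?_), integral_finsetSum]
    · refine Finset.sum_congr rfl fun i _ => ?_
      rw [integral_finsetSum]
      exact fun j _ => (i1 i j).add (i2 i j)
    · exact fun i _ => integrable_finsetSum _ fun j _ => (i1 i j).add (i2 i j)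
    · simp only [paraSymbol_eq_sum_pieceSymbol, Finset.mul_sum, Complex.ofReal_sum,
        Finset.sum_mul, mul_add, Complex.ofReal_add, add_mul]
  rw [e]
  calc _ ≤ ∑ i ∈ Finset.range (2 * N + 1), ∑ j ∈ Finset.range J,
        (‖leibnizForm f g h fun p => |p.1 + p.2| ^ α * pieceSymbol 1 (-N + i) j p‖ₑ
          + ‖leibnizForm g f h fun p => |p.1 + p.2| ^ α * pieceSymbol 2 (-N + i) j p‖ₑ) :=
        (enorm_sum_le _ _).trans (Finset.sum_le_sum fun i _ =>
          (enorm_sum_le _ _).trans (Finset.sum_le_sum fun j _ => enorm_add_le _ _))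
    _ ≤ C₁ * maxIntegral (‖g ·‖ₑ) (‖Dop α f ·‖ₑ) (‖h ·‖ₑ) + C₂ * maxIntegral (‖f ·‖ₑ) (‖Dop α g ·‖ₑ) (‖h ·‖ₑ) := by
        simp only [Finset.sum_add_distrib]
        exact add_le_add (H₁ f g h hhm hh hhb _ _ _) (H₂ g f h hhm hh hhb _ _ _)
    _ ≤ _ := by
        rw [mul_add]
        exact add_le_add (mul_le_mul_left (by simp) _) (mul_le_mul_left (by simp) _)

section MixedNorm

variable {X : Type*} [MeasurableSpace X] {μ : Measure X}

lemma eLpNorm_top_mul_le (p : ℝ≥0∞) (u : X → ℝ≥0∞) {v : X → ℝ≥0∞} (hv : AEMeasurable v μ) :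
    eLpNorm (fun x => u x * v x) p μ ≤ eLpNorm u ∞ μ * eLpNorm v p μ := by
  obtain (rfl | rfl | hp) := ENNReal.trichotomy p
  · simp
  · simp_rw [eLpNorm_exponent_top, eLpNormEssSup_eq_essSup_enorm, enorm_eq_self]
    exact ENNReal.essSup_mul_le u v
  obtain ⟨hp₁, hp₂⟩ := ENNReal.toReal_pos_iff.mp hp
  simp_rw [eLpNorm_eq_lintegral_rpow_enorm_toReal hp₁.ne' hp₂.ne, eLpNorm_exponent_top,
    one_div, ENNReal.rpow_inv_le_iff hp, enorm_eq_self]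
  rw [ENNReal.mul_rpow_of_nonneg (hz := hp.le), ENNReal.rpow_inv_rpow hp.ne',
    ← lintegral_const_mul'' _ (by fun_prop)]
  simp only [← ENNReal.mul_rpow_of_nonneg (hz := hp.le)]
  apply lintegral_mono_ae
  filter_upwards [enorm_ae_le_eLpNormEssSup u μ] with x hf
  gcongr
  exact hf

/-- Hölder's inequality for `ℝ≥0∞`-valued functions. -/
theorem eLpNorm_mul_le_mul_eLpNorm {p q r : ℝ≥0∞} [hpqr : ENNReal.HolderTriple p q r]
    {u v : X → ℝ≥0∞} (hu : AEMeasurable u μ) (hv : AEMeasurable v μ) :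
    eLpNorm (fun x => u x * v x) r μ ≤ eLpNorm u p μ * eLpNorm v q μ := by
  have hpqr := hpqr.one_div_eq
  obtain (rfl | rfl | hp) := ENNReal.trichotomy p
  · simp_all
  · have : r = q := by simpa using hpqr
    exact this ▸ eLpNorm_top_mul_le r u hv
  obtain (rfl | rfl | hq) := ENNReal.trichotomy q
  · simp_all
  · have : r = p := by simpa using hpqr
    subst this
    simp_rw [mul_comm (u _)]
    rw [mul_comm]
    exact eLpNorm_top_mul_le r v hu
  obtain ⟨hp₁, hp₂⟩ := ENNReal.toReal_pos_iff.mp hp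
  obtain ⟨hq₁, hq₂⟩ := ENNReal.toReal_pos_iff.mp hq
  have hpqr' : 1 / r.toReal = 1 / p.toReal + 1 / q.toReal := by
    have := congrArg ENNReal.toReal hpqr
    rw [ENNReal.toReal_add (by simpa using hp₁.ne') (by simpa using hq₁.ne')] at this
    simpa
  have hr : 0 < r.toReal := one_div_pos.mp <| by rw [hpqr']; positivity
  obtain ⟨hr₁, hr₂⟩ := ENNReal.toReal_pos_iff.mp hr
  have hrp : r.toReal < p.toReal := lt_of_one_div_lt_one_div hp <|
    hpqr' ▸ lt_add_of_pos_right _ (by positivity)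
  rw [eLpNorm_eq_lintegral_rpow_enorm_toReal hr₁.ne' hr₂.ne,
    eLpNorm_eq_lintegral_rpow_enorm_toReal hp₁.ne' hp₂.ne,
    eLpNorm_eq_lintegral_rpow_enorm_toReal hq₁.ne' hq₂.ne]
  simpa only [enorm_eq_self] using!
    ENNReal.lintegral_Lp_mul_le_Lq_mul_Lr hr hrp hpqr' μ hu hv

/-- The mixed norm `L^p_x L^q_μ` of a nonnegative function. -/
def mixedNorm (p q : ℝ≥0∞) (μ : Measure ℝ) (F : ℝ → ℝ → ℝ≥0∞) : ℝ≥0∞ :=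
  eLpNorm (fun x => eLpNorm (F x) q μ) p volume

lemma mixedNorm_one_one (μ : Measure ℝ) (F : ℝ → ℝ → ℝ≥0∞) :
    mixedNorm 1 1 μ F = ∫⁻ x, ∫⁻ t, F x t ∂μ := by
  simp [mixedNorm, eLpNorm_one_eq_lintegral_enorm]

lemma measurable_eLpNorm_right {q : ℝ≥0∞} (hq : q ≠ 0) (hq' : q ≠ ∞) {μ : Measure ℝ} [SFinite μ]
    {F : ℝ → ℝ → ℝ≥0∞} (hF : Measurable (Function.uncurry F)) :
    Measurable fun x => eLpNorm (F x) q μ := by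
  simp_rw [eLpNorm_eq_lintegral_rpow_enorm_toReal hq hq', enorm_eq_self]
  exact ((hF.pow_const q.toReal).lintegral_prod_right' (ν := μ)).pow_const _

lemma mixedNorm_eq_lintegral {p q : ℝ≥0∞} (hp : p ≠ 0) (hp' : p ≠ ∞) (hq : q ≠ 0) (hq' : q ≠ ∞)
    (μ : Measure ℝ) (F : ℝ → ℝ → ℝ≥0∞) :
    mixedNorm p q μ F
      = (∫⁻ x, (∫⁻ t, F x t ^ q.toReal ∂μ) ^ (p.toReal / q.toReal)) ^ (1 / p.toReal) := by
  simp_rw [mixedNorm, eLpNorm_eq_lintegral_rpow_enorm_toReal hq hq',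
    eLpNorm_eq_lintegral_rpow_enorm_toReal hp hp', enorm_eq_self, ← ENNReal.rpow_mul]
  simp only [one_div, inv_mul_eq_div]

/-- Hölder's inequality in mixed norms. -/
theorem mixedNorm_mul_le {p₁ p₂ p q₁ q₂ q : ℝ≥0∞} [ENNReal.HolderTriple p₁ p₂ p]
    [ENNReal.HolderTriple q₁ q₂ q] {μ : Measure ℝ} {F G : ℝ → ℝ → ℝ≥0∞}
    (hF : Measurable (Function.uncurry F)) (hG : Measurable (Function.uncurry G))
    (hF' : Measurable fun x => eLpNorm (F x) q₁ μ) (hG' : Measurable fun x => eLpNorm (G x) q₂ μ) :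
    mixedNorm p q μ (fun x t => F x t * G x t) ≤ mixedNorm p₁ q₁ μ F * mixedNorm p₂ q₂ μ G := by
  refine le_trans ?_ (eLpNorm_mul_le_mul_eLpNorm (p := p₁) (q := p₂) (r := p)
    hF'.aemeasurable hG'.aemeasurable)
  refine eLpNorm_mono_enorm fun x => ?_
  simp only [enorm_eq_self]
  exact eLpNorm_mul_le_mul_eLpNorm hF.of_uncurry_left.aemeasurable hG.of_uncurry_left.aemeasurable

end MixedNorm

/-- The maximal function in the first variable. -/
def sliceMax (F : ℝ → ℝ → ℝ≥0∞) (x t : ℝ) : ℝ≥0∞ :=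
  intervalMax volume (fun y => F y t) x

lemma measurable_sliceMax {F : ℝ → ℝ → ℝ≥0∞} (hF : Measurable (Function.uncurry F)) :
    Measurable (Function.uncurry (sliceMax F)) :=
  measurable_intervalMax_prod volume hF

/-- Boundedness of the maximal function in the first variable on mixed norms. -/
theorem exists_mixedNorm_sliceMax_le {p q : ℝ≥0∞} (hp : 1 < p) (hp' : p ≠ ∞) (hq : 1 < q)
    (hq' : q ≠ ∞) :
    ∃ C : ℝ≥0∞, C ≠ ∞ ∧ ∀ (μ : Measure ℝ) [SFinite μ] (F : ℝ → ℝ → ℝ≥0∞),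
      Measurable (Function.uncurry F) →
      mixedNorm p q μ (sliceMax F) ≤ C * mixedNorm p q μ F := by
  have h1 : ∀ {r : ℝ≥0∞}, 1 < r → r ≠ ∞ → 1 < r.toReal := fun h h' => by
    simpa using (ENNReal.toReal_lt_toReal ENNReal.one_ne_top h').2 h
  obtain ⟨C, hC, H⟩ := exists_lintegral_mixed_intervalMax_le (h1 hp hp') (h1 hq hq')
  refine ⟨C ^ (1 / p.toReal), ENNReal.rpow_ne_top_of_nonneg (by positivity) hC,
    fun μ _ F hF => ?_⟩
  rw [mixedNorm_eq_lintegral (by positivity) hp' (by positivity) hq',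
    mixedNorm_eq_lintegral (by positivity) hp' (by positivity) hq',
    ← ENNReal.mul_rpow_of_nonneg _ _ (by positivity)]
  exact ENNReal.rpow_le_rpow (H μ F hF) (by positivity)

lemma intervalMax_le_eLpNorm_top {f : ℝ → ℝ≥0∞} (x : ℝ) :
    intervalMax volume f x ≤ eLpNorm f ∞ volume := by
  refine intervalMax_le fun a b hx => ?_
  have hab : (a : ℝ) < b := hx.1.trans hx.2
  refine ENNReal.div_le_of_le_mul ?_
  calc ∫⁻ y in Ioo (a : ℝ) b, f y ≤ ∫⁻ _ in Ioo (a : ℝ) b, eLpNorm f ∞ volume := by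
        refine lintegral_mono_ae (ae_restrict_of_ae ?_)
        rw [eLpNorm_exponent_top]
        simpa using enorm_ae_le_eLpNormEssSup f volume
    _ = _ := by simp

lemma exists_eLpNorm_intervalMax_le {p : ℝ≥0∞} (hp : 1 < p) :
    ∃ C : ℝ≥0∞, C ≠ ∞ ∧ ∀ f : ℝ → ℝ≥0∞, Measurable f →
      eLpNorm (intervalMax volume f) p volume ≤ C * eLpNorm f p volume := by
  by_cases hp' : p = ∞
  · subst hp'
    refine ⟨1, by simp, fun f _ => ?_⟩
    rw [one_mul, eLpNorm_exponent_top (f := intervalMax volume f), eLpNormEssSup_eq_essSup_enorm]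
    exact essSup_le_of_ae_le _ (Eventually.of_forall fun x => by
      simpa using intervalMax_le_eLpNorm_top x)
  have h1 : 1 < p.toReal := by
    simpa using (ENNReal.toReal_lt_toReal ENNReal.one_ne_top hp').2 hp
  refine ⟨maxConst p.toReal ^ (1 / p.toReal), ENNReal.rpow_ne_top_of_nonneg (by positivity)
    (maxConst_ne_top h1), fun f hf => ?_⟩
  rw [eLpNorm_eq_lintegral_rpow_enorm_toReal (by positivity) hp',
    eLpNorm_eq_lintegral_rpow_enorm_toReal (by positivity) hp',
    ← ENNReal.mul_rpow_of_nonneg _ _ (by positivity)]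
  simp only [enorm_eq_self]
  exact ENNReal.rpow_le_rpow (lintegral_intervalMax_rpow_le volume h1 hf) (by positivity)

lemma mixedNorm_const_le {p : ℝ≥0∞} (μ : Measure ℝ) (S : ℝ → ℝ≥0∞) :
    mixedNorm p ∞ μ (fun x _ => S x) ≤ eLpNorm S p volume := by
  refine eLpNorm_mono_enorm fun x => ?_
  simp only [enorm_eq_self, eLpNorm_exponent_top, eLpNormEssSup_eq_essSup_enorm]
  exact essSup_le_of_ae_le _ (Eventually.of_forall fun _ => le_rfl)

lemma le_eLpNorm_top_of_continuous {T : ℝ} {u : ℝ → ℝ≥0∞} (hu : Continuous u) {t : ℝ}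
    (ht : t ∈ Ioc 0 T) : u t ≤ eLpNorm u ∞ (volume.restrict (Ioc (0:ℝ) T)) := by
  by_contra! h
  set c := eLpNorm u ∞ (volume.restrict (Ioc (0:ℝ) T)) with hc
  have hU : IsOpen {s | c < u s} := isOpen_lt continuous_const hu
  have htc : t ∈ closure (Ioo (0:ℝ) T) := by
    rw [closure_Ioo (ht.1.trans_le ht.2).ne]
    exact ⟨ht.1.le, ht.2⟩
  have hne := mem_closure_iff.1 htc _ hU h
  have hpos := (hU.inter isOpen_Ioo).measure_pos volume hne
  have hae := enorm_ae_le_eLpNormEssSup u (volume.restrict (Ioc (0:ℝ) T))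
  rw [ae_restrict_iff' measurableSet_Ioc] at hae
  refine hpos.ne' (measure_mono_null (fun s hs => ?_) hae)
  simp only [mem_compl_iff, mem_ofPred_eq, enorm_eq_self, not_forall, not_le]
  exact ⟨⟨hs.2.1, hs.2.2.le⟩, hs.1⟩

lemma measurable_eLpNorm_top_right (T : ℝ) {F : ℝ → ℝ → ℝ≥0∞}
    (hF : Continuous (Function.uncurry F)) :
    Measurable fun x => eLpNorm (F x) ∞ (volume.restrict (Ioc (0:ℝ) T)) := by
  have e : (fun x => eLpNorm (F x) ∞ (volume.restrict (Ioc (0:ℝ) T)))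
      = fun x => ⨆ t ∈ Ioc (0:ℝ) T, F x t := by
    ext x
    apply le_antisymm
    · rw [eLpNorm_exponent_top, eLpNormEssSup_eq_essSup_enorm]
      refine essSup_le_of_ae_le _ ?_
      filter_upwards [ae_restrict_mem measurableSet_Ioc] with t ht
      exact le_iSup₂_of_le t ht le_rfl
    · exact iSup₂_le fun t ht =>
        le_eLpNorm_top_of_continuous (hF.comp (Continuous.prodMk_right x)) ht
  rw [e]
  refine LowerSemicontinuous.measurable (lowerSemicontinuous_biSup fun t _ => ?_)
  exact (hF.comp (Continuous.prodMk_left t)).lowerSemicontinuous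

/-- A majorant of the maximal function, bounded on mixed norms up to the endpoint `q = ∞`. -/
theorem exists_sliceMax_majorant {p q : ℝ≥0∞} (h : (1 < p ∧ p ≠ ∞ ∧ 1 < q) ∨ (p = ∞ ∧ q = ∞)) :
    ∃ C : ℝ≥0∞, C ≠ ∞ ∧ ∀ (T : ℝ) (F : ℝ → ℝ → ℝ≥0∞), Continuous (Function.uncurry F) →
      ∃ A : ℝ → ℝ → ℝ≥0∞, Measurable (Function.uncurry A) ∧
        (Measurable fun x => eLpNorm (A x) q (volume.restrict (Ioc (0:ℝ) T))) ∧
        (∀ t ∈ Ioc 0 T, ∀ x, sliceMax F x t ≤ A x t) ∧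
        mixedNorm p q (volume.restrict (Ioc (0:ℝ) T)) A
          ≤ C * mixedNorm p q (volume.restrict (Ioc (0:ℝ) T)) F := by
  by_cases hq : q = ∞
  · subst hq
    have hp : 1 < p := by
      rcases h with h | h
      · exact h.1
      · simp [h.1]
    obtain ⟨C, hC, H⟩ := exists_eLpNorm_intervalMax_le hp
    refine ⟨C, hC, fun T F hF => ?_⟩
    set S : ℝ → ℝ≥0∞ := fun x => eLpNorm (F x) ∞ (volume.restrict (Ioc (0:ℝ) T)) with hS
    have hSm : Measurable S := measurable_eLpNorm_top_right T hF
    have hMS : Measurable (intervalMax volume S) := measurable_intervalMax volume hSm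
    refine ⟨fun x _ => intervalMax volume S x, hMS.comp measurable_fst, ?_, fun t ht x => ?_, ?_⟩
    · by_cases h0 : volume.restrict (Ioc (0:ℝ) T) = 0
      · simp [h0]
      · have e : (fun x => eLpNorm (fun _ : ℝ => intervalMax volume S x) ∞
            (volume.restrict (Ioc (0:ℝ) T))) = intervalMax volume S := by
          ext x
          rw [eLpNorm_const _ (by simp) h0]
          simp
        rw [e]
        exact hMS
    · exact intervalMax_mono (Eventually.of_forall fun y =>
        le_eLpNorm_top_of_continuous (hF.comp (Continuous.prodMk_right y)) ht) x
    · exact (mixedNorm_const_le _ _).trans (H S hSm)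
  · obtain ⟨h1, h2, h3⟩ := h.resolve_right fun h => hq h.2
    obtain ⟨C, hC, H⟩ := exists_mixedNorm_sliceMax_le h1 h2 h3 hq
    refine ⟨C, hC, fun T F hF => ⟨sliceMax F, measurable_sliceMax hF.measurable,
      measurable_eLpNorm_right (by positivity) hq (measurable_sliceMax hF.measurable),
      fun _ _ _ => le_rfl, H _ F hF.measurable⟩⟩

/-- Hölder's inequality for the product of three maximal functions. -/
theorem exists_lintegral_maxIntegral_le {p q p₁ q₁ p₂ q₂ p' q' : ℝ≥0∞}
    (h₁ : (1 < p₁ ∧ p₁ ≠ ∞ ∧ 1 < q₁) ∨ (p₁ = ∞ ∧ q₁ = ∞))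
    (h₂ : 1 < p₂ ∧ p₂ ≠ ∞ ∧ 1 < q₂ ∧ q₂ ≠ ∞) (h' : 1 < p' ∧ p' ≠ ∞ ∧ 1 < q' ∧ q' ≠ ∞)
    [ENNReal.HolderTriple p₁ p₂ p] [ENNReal.HolderTriple q₁ q₂ q]
    [ENNReal.HolderTriple p p' 1] [ENNReal.HolderTriple q q' 1]
    (hq0 : q ≠ 0) (hq : q ≠ ∞) :
    ∃ C : ℝ≥0∞, C ≠ ∞ ∧ ∀ (T : ℝ) (F G W : ℝ → ℝ → ℝ≥0∞), Continuous (Function.uncurry F) →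
      Measurable (Function.uncurry G) → Measurable (Function.uncurry W) →
      ∫⁻ t in Ioc 0 T, maxIntegral (fun x => F x t) (fun x => G x t) (fun x => W x t)
        ≤ C * (mixedNorm p₁ q₁ (volume.restrict (Ioc (0:ℝ) T)) F
          * mixedNorm p₂ q₂ (volume.restrict (Ioc (0:ℝ) T)) G
          * mixedNorm p' q' (volume.restrict (Ioc (0:ℝ) T)) W) := by
  obtain ⟨C₁, hC₁, H₁⟩ := exists_sliceMax_majorant h₁
  obtain ⟨C₂, hC₂, H₂⟩ := exists_mixedNorm_sliceMax_le h₂.1 h₂.2.1 h₂.2.2.1 h₂.2.2.2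
  obtain ⟨C₃, hC₃, H₃⟩ := exists_mixedNorm_sliceMax_le h'.1 h'.2.1 h'.2.2.1 h'.2.2.2
  refine ⟨C₁ * C₂ * C₃, by finiteness, fun T F G W hF hG hW => ?_⟩
  obtain ⟨A, hA, hAn, hFA, hAC⟩ := H₁ T F hF
  set μ := volume.restrict (Ioc (0:ℝ) T) with hμ
  have hMG := measurable_sliceMax hG
  have hMW := measurable_sliceMax hW
  have hAG : Measurable (Function.uncurry fun x t => A x t * sliceMax G x t) := hA.mul hMG
  have hAGW : Measurable (Function.uncurry fun x t => A x t * sliceMax G x t * sliceMax W x t) :=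
    hAG.mul hMW
  calc ∫⁻ t, maxIntegral (fun x => F x t) (fun x => G x t) (fun x => W x t) ∂μ
      ≤ ∫⁻ t, ∫⁻ x, A x t * sliceMax G x t * sliceMax W x t ∂volume ∂μ := by
        refine lintegral_mono_ae ?_
        filter_upwards [ae_restrict_mem measurableSet_Ioc] with t ht
        refine lintegral_mono fun x => ?_
        exact mul_le_mul_left (mul_le_mul_left (hFA t ht x) _) _
    _ = mixedNorm 1 1 μ fun x t => A x t * sliceMax G x t * sliceMax W x t := by
        rw [mixedNorm_one_one, lintegral_lintegral_swap]
        exact hAGW.comp measurable_swap |>.aemeasurable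
    _ ≤ mixedNorm p q μ (fun x t => A x t * sliceMax G x t) * mixedNorm p' q' μ (sliceMax W) :=
        mixedNorm_mul_le hAG hMW (measurable_eLpNorm_right hq0 hq hAG)
          (measurable_eLpNorm_right (zero_lt_one.trans h'.2.2.1).ne' h'.2.2.2 hMW)
    _ ≤ (mixedNorm p₁ q₁ μ A * mixedNorm p₂ q₂ μ (sliceMax G)) * mixedNorm p' q' μ (sliceMax W) :=
        mul_le_mul_left (mixedNorm_mul_le hA hMG hAn
          (measurable_eLpNorm_right (zero_lt_one.trans h₂.2.2.1).ne' h₂.2.2.2 hMG)) _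
    _ ≤ ((C₁ * mixedNorm p₁ q₁ μ F) * (C₂ * mixedNorm p₂ q₂ μ G)) * (C₃ * mixedNorm p' q' μ W) :=
        mul_le_mul' (mul_le_mul' hAC (H₂ μ G hG)) (H₃ μ W hW)
    _ = _ := by ring

lemma hasTemperateGrowth_prodMk (t : ℝ) :
    Function.HasTemperateGrowth fun y : ℝ => ((y, t) : ℝ × ℝ) := by
  have e : (fun y : ℝ => ((y, t) : ℝ × ℝ))
      = (⇑(ContinuousLinearMap.inl ℝ ℝ ℝ)) + fun _ => ((0, t) : ℝ × ℝ) := by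
    ext y <;> simp
  rw [e]
  exact (ContinuousLinearMap.hasTemperateGrowth _).add (.const _)

/-- The slice `y ↦ F (y, t)` of a Schwartz function on the plane. -/
def schwartzSlice (F : SchwartzMap (ℝ × ℝ) ℂ) (t : ℝ) : SchwartzMap ℝ ℂ :=
  SchwartzMap.compCLM ℂ (hasTemperateGrowth_prodMk t)
    ⟨1, 1, fun x => by
      have : ‖x‖ ≤ ‖(x, t)‖ := by rw [Prod.norm_mk]; exact le_max_left _ _
      linarith⟩ F

@[simp] lemma schwartzSlice_apply (F : SchwartzMap (ℝ × ℝ) ℂ) (t y : ℝ) :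
    schwartzSlice F t y = F (y, t) := rfl

lemma coe_schwartzSlice (F : SchwartzMap (ℝ × ℝ) ℂ) (t : ℝ) :
    ⇑(schwartzSlice F t) = fun y => F (y, t) := rfl

lemma integrable_one_add_abs_neg_two : Integrable fun y : ℝ => (1 + |y|) ^ (-2 : ℝ) := by
  simpa using integrable_one_add_norm (E := ℝ) (μ := volume) (r := 2) (by simp)

lemma exists_norm_fourier_schwartzSlice_le (F : SchwartzMap (ℝ × ℝ) ℂ) :
    ∃ B : ℝ, ∀ t ξ, ‖𝓕 ⇑(schwartzSlice F t) ξ‖ ≤ B := by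
  set C := 2 ^ 2 * ((Finset.Iic (2, 0)).sup fun m => SchwartzMap.seminorm ℝ m.1 m.2) F with hC
  have hF : ∀ t y, ‖F (y, t)‖ ≤ C * (1 + |y|) ^ (-2 : ℝ) := fun t y => by
    have h := SchwartzMap.one_add_le_sup_seminorm_apply (𝕜 := ℝ) (m := (2, 0)) le_rfl le_rfl F (y, t)
    rw [norm_iteratedFDeriv_zero] at h
    have hy : |y| ≤ ‖(y, t)‖ := by
      rw [Prod.norm_mk, ← Real.norm_eq_abs]; exact le_max_left _ _
    rw [Real.rpow_neg (by positivity), ← div_eq_mul_inv, le_div_iff₀ (by positivity), mul_comm]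
    refine le_trans ?_ h
    norm_cast
    gcongr
  refine ⟨∫ y : ℝ, C * (1 + |y|) ^ (-2 : ℝ), fun t ξ => ?_⟩
  rw [fourier_eq_integral_char]
  refine norm_integral_le_of_norm_le (integrable_one_add_abs_neg_two.const_mul C)
    (Eventually.of_forall fun y => ?_)
  rw [norm_mul, norm_char, one_mul]
  exact hF t y

open scoped LineDeriv in
lemma deriv_schwartzSlice (F : SchwartzMap (ℝ × ℝ) ℂ) (t : ℝ) :
    deriv ⇑(schwartzSlice F t) = ⇑(schwartzSlice (∂_{((1, 0) : ℝ × ℝ)} F) t) := by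
  ext y
  rw [schwartzSlice_apply, SchwartzMap.lineDerivOp_apply, F.differentiableAt.lineDeriv_eq_fderiv,
    coe_schwartzSlice]
  have h1 : HasDerivAt (fun y : ℝ => ((y, t) : ℝ × ℝ)) (1, 0) y :=
    (hasDerivAt_id y).prodMk (hasDerivAt_const y t)
  exact (F.differentiableAt.hasFDerivAt.comp_hasDerivAt y h1).deriv

open scoped LineDeriv in
lemma exists_pow_mul_norm_fourier_schwartzSlice_le (n : ℕ) (F : SchwartzMap (ℝ × ℝ) ℂ) :
    ∃ B : ℝ, ∀ t ξ, |ξ| ^ n * ‖𝓕 ⇑(schwartzSlice F t) ξ‖ ≤ B := by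
  induction n generalizing F with
  | zero => simpa using exists_norm_fourier_schwartzSlice_le F
  | succ n ih =>
    obtain ⟨B, hB⟩ := ih (∂_{((1, 0) : ℝ × ℝ)} F)
    refine ⟨B, fun t ξ => le_trans ?_ (hB t ξ)⟩
    have h := Real.fourier_deriv (schwartzSlice F t).integrable (schwartzSlice F t).differentiable
      (by rw [deriv_schwartzSlice]; exact SchwartzMap.integrable _)
    rw [← deriv_schwartzSlice, h]
    simp only [smul_eq_mul, norm_mul, Complex.norm_I, Complex.norm_real, Complex.norm_ofNat,
      Real.norm_eq_abs, abs_of_pos pi_pos]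
    have : 1 ≤ 2 * π := by linarith [pi_gt_three]
    have h0 : 0 ≤ |ξ| ^ (n + 1) * ‖𝓕 ⇑(schwartzSlice F t) ξ‖ := by positivity
    calc _ ≤ (2 * π) * (|ξ| ^ (n + 1) * ‖𝓕 ⇑(schwartzSlice F t) ξ‖) := by nlinarith
      _ = _ := by rw [pow_succ]; ring

lemma exists_enorm_Dop_schwartzSlice_le (F : SchwartzMap (ℝ × ℝ) ℂ) {α : ℝ} (hα : 0 ≤ α) :
    ∃ B : ℝ≥0, ∀ t x, ‖Dop α (fun y => F (y, t)) x‖ₑ ≤ B := by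
  obtain ⟨n, hn⟩ := exists_nat_ge (α + 2)
  obtain ⟨B₀, hB₀⟩ := exists_pow_mul_norm_fourier_schwartzSlice_le 0 F
  obtain ⟨B, hB⟩ := exists_pow_mul_norm_fourier_schwartzSlice_le n F
  set C := 2 ^ (n - 1) * (B₀ + B)
  have key : ∀ t ξ, ‖((|ξ| ^ α : ℝ) : ℂ) * 𝓕 (fun y => F (y, t)) ξ‖ ≤ C * (1 + |ξ|) ^ (-2 : ℝ) := by
    intro t ξ
    rw [norm_mul, Complex.norm_real, Real.norm_of_nonneg (by positivity),
      Real.rpow_neg (by positivity), ← div_eq_mul_inv, le_div_iff₀ (by positivity)]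
    have h1 : |ξ| ^ α * (1 + |ξ|) ^ (2 : ℝ) ≤ (1 + |ξ|) ^ n := by
      calc |ξ| ^ α * (1 + |ξ|) ^ (2 : ℝ) ≤ (1 + |ξ|) ^ α * (1 + |ξ|) ^ (2 : ℝ) := by
            gcongr; linarith
        _ = (1 + |ξ|) ^ (α + 2) := (Real.rpow_add (by positivity) _ _).symm
        _ ≤ (1 + |ξ|) ^ (n : ℝ) :=
            Real.rpow_le_rpow_of_exponent_le (by linarith [abs_nonneg ξ]) hn
        _ = _ := Real.rpow_natCast _ _
    have h2 := add_pow_le zero_le_one (abs_nonneg ξ) n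
    rw [one_pow] at h2
    have h3 := hB₀ t ξ
    have h4 := hB t ξ
    rw [coe_schwartzSlice] at h3 h4
    set a := ‖𝓕 (fun y => F (y, t)) ξ‖
    have ha : 0 ≤ a := norm_nonneg _
    calc |ξ| ^ α * a * (1 + |ξ|) ^ (2 : ℝ) = (|ξ| ^ α * (1 + |ξ|) ^ (2 : ℝ)) * a := by ring
      _ ≤ (2 ^ (n - 1) * (1 + |ξ| ^ n)) * a := mul_le_mul_of_nonneg_right (h1.trans h2) ha
      _ = 2 ^ (n - 1) * (|ξ| ^ 0 * a + |ξ| ^ n * a) := by ring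
      _ ≤ C := by unfold C; gcongr
  refine ⟨(∫ ξ : ℝ, C * (1 + |ξ|) ^ (-2 : ℝ)).toNNReal, fun t x => ?_⟩
  rw [← ofReal_norm]
  refine ENNReal.ofReal_le_ofReal ((norm_fourierInv_le _ x).trans ?_)
  refine integral_mono_of_nonneg (Eventually.of_forall fun _ => norm_nonneg _)
    (integrable_one_add_abs_neg_two.const_mul C) (Eventually.of_forall (key t))

lemma measurable_Dop_schwartzSlice (F : SchwartzMap (ℝ × ℝ) ℂ) (α : ℝ) :
    Measurable (Function.uncurry fun x t => Dop α (fun y => F (y, t)) x) := by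
  have h1 : StronglyMeasurable fun z : ℝ × ℝ => 𝓕 (fun y => F (y, z.1)) z.2 := by
    simp_rw [fourier_eq_integral_char]
    refine StronglyMeasurable.integral_prod_right ?_
    have : Continuous fun w : (ℝ × ℝ) × ℝ => char (-(w.1.2 * w.2)) * F (w.2, w.1.1) := by
      have := F.continuous
      fun_prop
    exact this.stronglyMeasurable
  have h2 : StronglyMeasurable fun z : ℝ × ℝ => Dop α (fun y => F (y, z.2)) z.1 := by
    simp_rw [Dop, FMul, fourierInv_eq_integral_char]
    refine StronglyMeasurable.integral_prod_right ?_
    have h3 : Measurable fun w : (ℝ × ℝ) × ℝ => char (w.1.1 * w.2) := by fun_prop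
    have h4 : Measurable fun w : (ℝ × ℝ) × ℝ => ((|w.2| ^ α : ℝ) : ℂ) := by fun_prop
    exact (h3.mul (h4.mul (h1.measurable.comp
      ((measurable_snd.comp measurable_fst).prodMk measurable_snd)))).stronglyMeasurable
  exact h2.measurable

lemma lintegral_mixed_le_of_dual {p q p' q' : ℝ} (hp : p.HolderConjugate p')
    (hq : q.HolderConjugate q') (μ : Measure ℝ) [IsFiniteMeasure μ] {U : ℝ → ℝ → ℝ≥0∞}
    (hU : Measurable (Function.uncurry U)) {B : ℝ≥0} (hB : ∀ x t, U x t ≤ B) {K : ℝ≥0∞}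
    (H : ∀ W : ℝ → ℝ → ℝ≥0∞, Measurable (Function.uncurry W) → (∃ B' : ℝ≥0, ∀ x t, W x t ≤ B') →
      (∃ n : ℕ, ∀ x t, (n : ℝ) < |x| → W x t = 0) →
      ∫⁻ x, ∫⁻ t, U x t * W x t ∂μ
        ≤ K * (∫⁻ x, (∫⁻ t, W x t ^ q' ∂μ) ^ (p' / q')) ^ (1 / p')) :
    (∫⁻ x, (∫⁻ t, U x t ^ q ∂μ) ^ (p / q)) ^ (1 / p) ≤ K := by
  have hp0 := hp.pos
  have hq0 := hq.pos
  have hp'0 := hp.symm.pos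
  have hq'0 := hq.symm.pos
  have hq1 : 0 < q - 1 := hq.sub_one_pos
  set N : ℝ → ℝ≥0∞ := fun x => ∫⁻ t, U x t ^ q ∂μ with hN
  have hNm : Measurable N := (hU.pow_const q).lintegral_prod_right' (ν := μ)
  have hNB : ∀ x, N x ≤ (B : ℝ≥0∞) ^ q * μ univ := fun x => by
    rw [← lintegral_const]
    exact lintegral_mono fun t => ENNReal.rpow_le_rpow (hB x t) hq0.le
  have hBt : (B : ℝ≥0∞) ^ q * μ univ ≠ ∞ :=
    ENNReal.mul_ne_top (ENNReal.rpow_ne_top_of_nonneg hq0.le (by simp)) (by simp)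
  set a := p / q with ha
  have ha0 : 0 < a := by positivity
  set E : ℕ → Set ℝ := fun n => {x | |x| ≤ n ∧ N x ^ (a - 1) ≤ n} with hE
  have hEm : ∀ n, MeasurableSet (E n) := fun n =>
    (measurableSet_le measurable_norm measurable_const).inter
      (measurableSet_le (hNm.pow_const _) measurable_const)
  have hmain : ∀ n, ∫⁻ x in E n, N x ^ a ≤ K ^ p := by
    intro n
    set Y := ∫⁻ x in E n, N x ^ a with hY
    have hYt : Y ≠ ∞ := by
      refine ne_top_of_le_ne_top (b := ((B : ℝ≥0∞) ^ q * μ univ) ^ a * volume (Icc (-(n : ℝ)) n))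
        (ENNReal.mul_ne_top (ENNReal.rpow_ne_top_of_nonneg ha0.le hBt) (by simp)) ?_
      rw [← setLIntegral_const]
      exact (lintegral_mono_set fun x hx => abs_le.1 hx.1).trans
        (lintegral_mono fun x => ENNReal.rpow_le_rpow (hNB x) ha0.le)
    set W : ℝ → ℝ → ℝ≥0∞ := fun x t =>
      (E n).indicator (fun x => N x ^ (a - 1)) x * U x t ^ (q - 1) with hW
    have hind : Measurable ((E n).indicator fun x => N x ^ (a - 1)) :=
      (hNm.pow_const _).indicator (hEm n)
    have hWm : Measurable (Function.uncurry W) :=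
      (hind.comp measurable_fst).mul (hU.pow_const _)
    have hUx : ∀ x, Measurable (U x) := fun x => hU.of_uncurry_left
    have h1 := H W hWm ⟨n * B ^ (q - 1), fun x t => by
        rw [ENNReal.coe_mul, ENNReal.coe_natCast, ENNReal.coe_rpow_of_nonneg _ hq1.le]
        refine mul_le_mul' (?_ : (E n).indicator (fun x => N x ^ (a - 1)) x ≤ n)
          (ENNReal.rpow_le_rpow (hB x t) hq1.le)
        exact indicator_apply_le' (fun hx => hx.2) fun _ => zero_le⟩
      ⟨n, fun x t hx => by
        have : x ∉ E n := fun h => (hx.trans_le h.1).false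
        simp [hW, this]⟩
    have hpow : ∀ u : ℝ≥0∞, u * u ^ (q - 1) = u ^ q := fun u => by
      conv_lhs => rw [← ENNReal.rpow_one u, ← ENNReal.rpow_mul,
        ← ENNReal.rpow_add_of_nonneg _ _ zero_le_one (by simpa using hq1.le)]
      congr 1; ring
    have hNt : ∀ x, N x ≠ ∞ := fun x => ne_top_of_le_ne_top hBt (hNB x)
    have e1 : ∫⁻ x, ∫⁻ t, U x t * W x t ∂μ = Y := by
      rw [hY, ← lintegral_indicator (hEm n)]
      refine lintegral_congr fun x => ?_
      have : ∀ t, U x t * W x t = (E n).indicator (fun x => N x ^ (a - 1)) x * U x t ^ q :=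
        fun t => by rw [← hpow]; simp only [hW]; ring
      simp_rw [this]
      rw [lintegral_const_mul _ ((hUx x).pow_const q)]
      by_cases hx : x ∈ E n
      · simp only [indicator_of_mem hx]
        change N x ^ (a - 1) * N x = _
        by_cases h0 : N x = 0
        · rw [h0, mul_zero, ENNReal.zero_rpow_of_pos ha0]
        · conv_lhs => rw [← ENNReal.rpow_one (N x), ← ENNReal.rpow_mul, one_mul,
            ← ENNReal.rpow_add _ _ h0 (hNt x)]
          congr 1; ring
      · simp [hx]
    have e2 : ∫⁻ x, (∫⁻ t, W x t ^ q' ∂μ) ^ (p' / q') = Y := by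
      rw [hY, ← lintegral_indicator (hEm n)]
      refine lintegral_congr fun x => ?_
      have hqq : (q - 1) * q' = q := by
        have := hq.sub_one_mul_conj; linarith
      have : ∀ t, W x t ^ q' = ((E n).indicator (fun x => N x ^ (a - 1)) x) ^ q' * U x t ^ q :=
        fun t => by
          simp only [hW]
          rw [ENNReal.mul_rpow_of_nonneg _ _ hq'0.le, ← ENNReal.rpow_mul, hqq]
      simp_rw [this]
      rw [lintegral_const_mul _ ((hUx x).pow_const q)]
      by_cases hx : x ∈ E n
      · simp only [indicator_of_mem hx]
        change ((N x ^ (a - 1)) ^ q' * N x) ^ (p' / q') = _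
        by_cases h0 : N x = 0
        · rw [h0, mul_zero, ENNReal.zero_rpow_of_pos ha0, ENNReal.zero_rpow_of_pos (by positivity)]
        · conv_lhs => rw [← ENNReal.rpow_one (N x), ← ENNReal.rpow_mul, ← ENNReal.rpow_mul, one_mul,
            ← ENNReal.rpow_add _ _ h0 (hNt x), ← ENNReal.rpow_mul]
          congr 1
          have h2 : (p - 1) * p' = p := by have := hp.sub_one_mul_conj; linarith
          have h3 : q + q' = q * q' := by have := hq.sub_one_mul_conj; linarith
          rw [ha]
          field_simp
          linear_combination q' * h2 + p' * h3
      · simp [hx, ENNReal.zero_rpow_of_pos hq'0, ENNReal.zero_rpow_of_pos (div_pos hp'0 hq'0)]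
    rw [e1, e2] at h1
    by_cases hY0 : Y = 0
    · simp [hY0]
    have h2 : Y ^ (1 / p) ≤ K := by
      have h3 : Y = Y ^ (1 / p) * Y ^ (1 / p') := by
        rw [← ENNReal.rpow_add _ _ hY0 hYt]
        have : 1 / p + 1 / p' = 1 := by simpa using hp.inv_add_inv_eq_one
        rw [this, ENNReal.rpow_one]
      nth_rw 1 [h3] at h1
      exact (ENNReal.mul_le_mul_iff_left
        (by simp [hY0, hYt, ENNReal.rpow_eq_zero_iff])
        (ENNReal.rpow_ne_top_of_nonneg (by positivity) hYt)).1 h1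
    calc Y = (Y ^ (1 / p)) ^ p := by rw [← ENNReal.rpow_mul]; simp [hp0.ne']
      _ ≤ K ^ p := ENNReal.rpow_le_rpow h2 hp0.le
  have hmono : Monotone fun n => (E n).indicator fun x => N x ^ a := by
    refine fun m n hmn => indicator_le_indicator_of_subset (fun x hx => ⟨hx.1.trans ?_, hx.2.trans ?_⟩)
      fun _ => zero_le
    · exact_mod_cast hmn
    · exact_mod_cast hmn
  have hsup : ∫⁻ x, N x ^ a ≤ K ^ p := by
    calc ∫⁻ x, N x ^ a ≤ ∫⁻ x, ⨆ n, (E n).indicator (fun x => N x ^ a) x := by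
          refine lintegral_mono fun x => ?_
          by_cases h0 : N x = 0
          · simp [h0, ENNReal.zero_rpow_of_pos ha0]
          · have ht : N x ^ (a - 1) ≠ ∞ := by
              have := ne_top_of_le_ne_top hBt (hNB x)
              simp [ENNReal.rpow_eq_top_iff, h0, this]
            obtain ⟨m, hm⟩ := ENNReal.exists_nat_gt ht
            obtain ⟨k, hk⟩ := exists_nat_ge |x|
            refine le_iSup_of_le (max m k) (le_of_eq ?_)
            rw [indicator_of_mem]
            refine ⟨hk.trans ?_, hm.le.trans ?_⟩
            · exact_mod_cast le_max_right m k
            · exact_mod_cast le_max_left m k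
      _ = ⨆ n, ∫⁻ x in E n, N x ^ a := by
          rw [lintegral_iSup (fun n => (hNm.pow_const a).indicator (hEm n)) hmono]
          simp_rw [lintegral_indicator (hEm _)]
      _ ≤ K ^ p := iSup_le hmain
  calc (∫⁻ x, N x ^ a) ^ (1 / p) ≤ (K ^ p) ^ (1 / p) :=
        ENNReal.rpow_le_rpow hsup (by positivity)
    _ = K := by rw [← ENNReal.rpow_mul]; simp [hp0.ne']

lemma maxIntegral_mono_right (f g : ℝ → ℝ≥0∞) {h w : ℝ → ℝ≥0∞} (hw : ∀ x, h x ≤ w x) :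
    maxIntegral f g h ≤ maxIntegral f g w :=
  lintegral_mono fun x => mul_le_mul_right (intervalMax_mono (Eventually.of_forall hw) x) _

/-- The fixed-time fractional Leibniz rule tested against a nonnegative function. -/
theorem exists_lintegral_enorm_Dop_mul_le {α : ℝ} (hα : 0 < α) :
    ∃ C : ℝ≥0∞, C ≠ ∞ ∧ ∀ (f g : SchwartzMap ℝ ℂ) (w : ℝ → ℝ≥0∞), Measurable w →
      (∃ B : ℝ≥0, ∀ x, w x ≤ B) → (∃ n : ℕ, ∀ x, (n : ℝ) < |x| → w x = 0) →
      ∫⁻ x, ‖Dop α (fun x => f x * g x) x‖ₑ * w x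
        ≤ C * (maxIntegral (‖g ·‖ₑ) (‖Dop α f ·‖ₑ) w + maxIntegral (‖f ·‖ₑ) (‖Dop α g ·‖ₑ) w) := by
  obtain ⟨C, hC, H⟩ := exists_enorm_integral_Dop_mul_le hα
  refine ⟨C, hC, fun f g w hw ⟨B, hB⟩ ⟨n, hn⟩ => ?_⟩
  set V : ℝ → ℂ := Dop α (fun x => f x * g x) with hV
  have hVc : Continuous V := continuous_Dop (schwartzMul f g) hα.le
  have hVm := hVc.measurable
  obtain ⟨D, hD⟩ := exists_enorm_Dop_le (schwartzMul f g) α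
  have hwt : ∀ x, w x ≠ ∞ := fun x => ne_top_of_le_ne_top ENNReal.coe_ne_top (hB x)
  set h : ℝ → ℂ := fun x => ((w x).toReal : ℂ) * (starRingEnd ℂ (V x) / (‖V x‖ : ℂ)) with hh
  have hhm : Measurable h := by
    have h1 : Measurable fun x => (starRingEnd ℂ) (V x) :=
      Complex.continuous_conj.measurable.comp hVm
    have h2 : Measurable fun x => ((w x).toReal : ℂ) :=
      Complex.measurable_ofReal.comp hw.ennreal_toReal
    have h3 : Measurable fun x => (‖V x‖ : ℂ) := Complex.measurable_ofReal.comp hVm.norm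
    exact h2.mul (h1.div h3)
  have hhw : ∀ x, ‖h x‖ₑ ≤ w x := fun x => by
    rw [← ofReal_norm, ← ENNReal.ofReal_toReal (hwt x)]
    refine ENNReal.ofReal_le_ofReal ?_
    simp only [hh, norm_mul, norm_div, Complex.norm_real, Complex.norm_conj, norm_norm,
      Real.norm_of_nonneg ENNReal.toReal_nonneg]
    exact mul_le_of_le_one_right ENNReal.toReal_nonneg (div_self_le_one _)
  have hint : Integrable h := by
    refine ⟨hhm.aestronglyMeasurable, ?_⟩
    calc ∫⁻ x, ‖h x‖ₑ ≤ ∫⁻ x, (Icc (-(n : ℝ)) n).indicator (fun _ => (B : ℝ≥0∞)) x := by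
          refine lintegral_mono fun x => (hhw x).trans ?_
          by_cases hx : x ∈ Icc (-(n : ℝ)) n
          · simpa [hx] using hB x
          · rw [hn x (by rw [mem_Icc, ← abs_le] at hx; exact not_le.1 hx)]
            exact zero_le
      _ < ∞ := by
          rw [lintegral_indicator measurableSet_Icc, setLIntegral_const]
          exact ENNReal.mul_lt_top (by simp) (by simp)
  have hVh : ∀ x, V x * h x = ((‖V x‖ * (w x).toReal : ℝ) : ℂ) := fun x => by
    by_cases h0 : V x = 0
    · simp [h0]
    · have h1 : (‖V x‖ : ℂ) ≠ 0 := by simpa using h0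
      simp only [hh]
      push_cast
      field_simp
      rw [mul_right_comm, Complex.mul_conj', mul_comm]
  have hVhi : Integrable fun x => ‖V x‖ * (w x).toReal := by
    have h1 : Integrable fun x => V x * h x := by
      refine hint.bdd_mul (c := D) hVm.aestronglyMeasurable (Eventually.of_forall fun x => ?_)
      have := hD x
      rw [enorm_eq_nnnorm] at this
      exact_mod_cast this
    simp_rw [hVh] at h1
    simpa using h1.re
  have e : ‖∫ x, V x * h x‖ₑ = ∫⁻ x, ‖V x‖ₑ * w x := by
    simp_rw [hVh]
    rw [integral_complex_ofReal, ← ofReal_norm, Complex.norm_real, Real.norm_of_nonneg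
      (integral_nonneg fun x => by positivity), ofReal_integral_eq_lintegral_ofReal hVhi
      (Eventually.of_forall fun x => by positivity)]
    refine lintegral_congr fun x => ?_
    rw [ENNReal.ofReal_mul (norm_nonneg _), ofReal_norm, ENNReal.ofReal_toReal (hwt x)]
  rw [← e]
  refine (H f g h hhm hint ⟨B, fun x => (hhw x).trans (hB x)⟩).trans ?_
  exact mul_le_mul_right (add_le_add (maxIntegral_mono_right _ _ hhw)
    (maxIntegral_mono_right _ _ hhw)) _

lemma LpLq_le_mixedNorm (p q : ℝ≥0∞) (T : ℝ) (f : ℝ → ℝ → ℂ) :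
    LpLq p q T f ≤ mixedNorm p q (volume.restrict (Ioc (0:ℝ) T)) fun x t => ‖f x t‖ₑ := by
  refine eLpNorm_mono_enorm fun x => ?_
  rw [enorm_eq_self, eLpNorm_enorm, Real.enorm_eq_ofReal ENNReal.toReal_nonneg]
  exact ENNReal.ofReal_toReal_le

lemma LpLq_eq_mixedNorm (p q : ℝ≥0∞) (T : ℝ) {f : ℝ → ℝ → ℂ} {B : ℝ≥0}
    (hB : ∀ x t, ‖f x t‖ₑ ≤ B) :
    LpLq p q T f = mixedNorm p q (volume.restrict (Ioc (0:ℝ) T)) fun x t => ‖f x t‖ₑ := by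
  refine eLpNorm_congr_enorm_ae (Eventually.of_forall fun x => ?_)
  rw [enorm_eq_self, eLpNorm_enorm, Real.enorm_eq_ofReal ENNReal.toReal_nonneg,
    ENNReal.ofReal_toReal]
  refine ne_top_of_le_ne_top ?_ (eLpNorm_mono_enorm (g := fun _ => (B : ℝ≥0∞)) fun t => hB x t)
  exact (memLp_const_enorm (by simp)).2.ne

lemma exists_holderConjugate {p : ℝ≥0∞} (hp : 1 < p) (hp' : p ≠ ∞) :
    ∃ p' : ℝ≥0∞, 1 < p' ∧ p' ≠ ∞ ∧ p.HolderConjugate p' ∧ p.toReal.HolderConjugate p'.toReal := by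
  have h1 : 1 < p.toReal := by
    simpa using (ENNReal.toReal_lt_toReal ENNReal.one_ne_top hp').2 hp
  have h := Real.HolderConjugate.conjExponent h1
  have h' : p.toReal.HolderConjugate (ENNReal.ofReal (Real.conjExponent p.toReal)).toReal := by
    rwa [ENNReal.toReal_ofReal h.symm.nonneg]
  refine ⟨ENNReal.ofReal (Real.conjExponent p.toReal), ?_, by simp, .of_toReal h', h'⟩
  simpa using h.symm.lt

lemma exists_enorm_schwartz_prod_le_const (f : SchwartzMap (ℝ × ℝ) ℂ) :
    ∃ B : ℝ≥0, ∀ x t, ‖f (x, t)‖ₑ ≤ B := by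
  obtain ⟨C, _, hC⟩ := f.decay 0 0
  refine ⟨C.toNNReal, fun x t => ?_⟩
  rw [← ofReal_norm]
  exact ENNReal.ofReal_le_ofReal (by simpa using hC (x, t))

lemma measurable_maxIntegral {F G W : ℝ → ℝ → ℝ≥0∞} (hF : Measurable (Function.uncurry F))
    (hG : Measurable (Function.uncurry G)) (hW : Measurable (Function.uncurry W)) :
    Measurable fun t => maxIntegral (fun x => F x t) (fun x => G x t) (fun x => W x t) := by
  have hF' := (measurable_sliceMax hF).comp measurable_swap
  have hG' := (measurable_sliceMax hG).comp measurable_swap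
  have hW' := (measurable_sliceMax hW).comp measurable_swap
  exact ((hF'.mul hG').mul hW').lintegral_prod_right'

/-- **Fractional Leibniz rule in mixed norms** (Lemma 2.9 of the paper).
For `α > 0`, `1 < p,q < ∞` and Hölder-compatible exponents (with
`(p₁,q₁) = (∞,∞)` and `(p̃₁,q̃₁) = (∞,∞)` allowed),
`‖D_x^α(fg)‖_{L^p_x L^q_T} ≲ ‖f‖_{L^{p₁}_x L^{q₁}_T} ‖D_x^α g‖_{L^{p₂}_x L^{q₂}_T}
 + ‖g‖_{L^{p̃₁}_x L^{q̃₁}_T} ‖D_x^α f‖_{L^{p̃₂}_x L^{q̃₂}_T}`. -/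
theorem fractional_leibniz_mixed
    (α : ℝ) (hα : 0 < α) (p q p₁ q₁ p₂ q₂ p₁' q₁' p₂' q₂' : ℝ≥0∞)
    (hp : 1 < p) (hp' : p ≠ ∞) (hq : 1 < q) (hq' : q ≠ ∞)
    (h₁ : (1 < p₁ ∧ p₁ ≠ ∞ ∧ 1 < q₁) ∨ (p₁ = ∞ ∧ q₁ = ∞))
    (h₂ : 1 < p₂ ∧ p₂ ≠ ∞ ∧ 1 < q₂ ∧ q₂ ≠ ∞)
    (h₁' : (1 < p₁' ∧ p₁' ≠ ∞ ∧ 1 < q₁') ∨ (p₁' = ∞ ∧ q₁' = ∞))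
    (h₂' : 1 < p₂' ∧ p₂' ≠ ∞ ∧ 1 < q₂' ∧ q₂' ≠ ∞)
    (hpsum : 1/p₁ + 1/p₂ = 1/p) (hqsum : 1/q₁ + 1/q₂ = 1/q)
    (hpsum' : 1/p₁' + 1/p₂' = 1/p) (hqsum' : 1/q₁' + 1/q₂' = 1/q) :
    ∃ C : ℝ≥0, 0 < C ∧ ∀ (T : ℝ), 0 < T → ∀ f g : SchwartzMap (ℝ × ℝ) ℂ,
      LpLq p q T (sliceOp (Dop α) (fun x t => f (x, t) * g (x, t)))
        ≤ C * (LpLq p₁ q₁ T (fun x t => f (x, t))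
                * LpLq p₂ q₂ T (sliceOp (Dop α) (fun x t => g (x, t)))
              + LpLq p₁' q₁' T (fun x t => g (x, t))
                * LpLq p₂' q₂' T (sliceOp (Dop α) (fun x t => f (x, t)))) := by
  have i₁ : ENNReal.HolderTriple p₁ p₂ p := ⟨by simpa using hpsum⟩
  have i₂ : ENNReal.HolderTriple q₁ q₂ q := ⟨by simpa using hqsum⟩
  have i₃ : ENNReal.HolderTriple p₁' p₂' p := ⟨by simpa using hpsum'⟩
  have i₄ : ENNReal.HolderTriple q₁' q₂' q := ⟨by simpa using hqsum'⟩
  obtain ⟨r, hr1, hrt, hr, hrR⟩ := exists_holderConjugate hp hp'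
  obtain ⟨s, hs1, hst, hs, hsR⟩ := exists_holderConjugate hq hq'
  have hp0 : p ≠ 0 := (zero_lt_one.trans hp).ne'
  have hq0 : q ≠ 0 := (zero_lt_one.trans hq).ne'
  have hr0 : r ≠ 0 := (zero_lt_one.trans hr1).ne'
  have hs0 : s ≠ 0 := (zero_lt_one.trans hs1).ne'
  obtain ⟨C₀, hC₀, H₀⟩ := exists_lintegral_enorm_Dop_mul_le hα
  obtain ⟨C₁, hC₁, H₁⟩ := exists_lintegral_maxIntegral_le (p := p) (q := q) h₁ h₂
    ⟨hr1, hrt, hs1, hst⟩ hq0 hq'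
  obtain ⟨C₂, hC₂, H₂⟩ := exists_lintegral_maxIntegral_le (p := p) (q := q) h₁' h₂'
    ⟨hr1, hrt, hs1, hst⟩ hq0 hq'
  have hCt : C₀ * (C₁ + C₂) + 1 ≠ ∞ := by finiteness
  refine ⟨(C₀ * (C₁ + C₂) + 1).toNNReal, ENNReal.toNNReal_pos (by simp) hCt, fun T _ f g => ?_⟩
  rw [ENNReal.coe_toNNReal hCt]
  set μ := volume.restrict (Ioc (0:ℝ) T) with hμ
  obtain ⟨Bf, hBf⟩ := exists_enorm_schwartz_prod_le_const f
  obtain ⟨Bg, hBg⟩ := exists_enorm_schwartz_prod_le_const g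
  obtain ⟨Df, hDf⟩ := exists_enorm_Dop_schwartzSlice_le f hα.le
  obtain ⟨Dg, hDg⟩ := exists_enorm_Dop_schwartzSlice_le g hα.le
  set P : SchwartzMap (ℝ × ℝ) ℂ := SchwartzMap.pairing (ContinuousLinearMap.mul ℂ ℂ) f g with hP
  obtain ⟨B, hB⟩ := exists_enorm_Dop_schwartzSlice_le P hα.le
  rw [LpLq_eq_mixedNorm p₁ q₁ T hBf, LpLq_eq_mixedNorm p₁' q₁' T hBg,
    LpLq_eq_mixedNorm p₂ q₂ T (f := sliceOp (Dop α) fun x t => g (x, t)) (B := Dg) (fun x t => hDg t x),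
    LpLq_eq_mixedNorm p₂' q₂' T (f := sliceOp (Dop α) fun x t => f (x, t)) (B := Df) (fun x t => hDf t x)]
  refine (LpLq_le_mixedNorm p q T _).trans ?_
  set F : ℝ → ℝ → ℝ≥0∞ := fun x t => ‖f (x, t)‖ₑ with hF
  set G : ℝ → ℝ → ℝ≥0∞ := fun x t => ‖g (x, t)‖ₑ with hG
  set F' : ℝ → ℝ → ℝ≥0∞ := fun x t => ‖sliceOp (Dop α) (fun x t => f (x, t)) x t‖ₑ with hF'
  set G' : ℝ → ℝ → ℝ≥0∞ := fun x t => ‖sliceOp (Dop α) (fun x t => g (x, t)) x t‖ₑ with hG'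
  set U : ℝ → ℝ → ℝ≥0∞ :=
    fun x t => ‖sliceOp (Dop α) (fun x t => f (x, t) * g (x, t)) x t‖ₑ with hU
  have hFc : Continuous (Function.uncurry F) := f.continuous.enorm
  have hGc : Continuous (Function.uncurry G) := g.continuous.enorm
  have hFm : Measurable (Function.uncurry F') := (measurable_Dop_schwartzSlice f α).enorm
  have hGm : Measurable (Function.uncurry G') := (measurable_Dop_schwartzSlice g α).enorm
  have hUm : Measurable (Function.uncurry U) := (measurable_Dop_schwartzSlice P α).enorm
  set R := mixedNorm p₁ q₁ μ F * mixedNorm p₂ q₂ μ G' + mixedNorm p₁' q₁' μ G * mixedNorm p₂' q₂' μ F'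
    with hR
  rw [mixedNorm_eq_lintegral hp0 hp' hq0 hq']
  refine lintegral_mixed_le_of_dual hrR hsR μ hUm (fun x t => hB t x) fun W hW ⟨B', hB'⟩ ⟨n, hn⟩ => ?_
  rw [← mixedNorm_eq_lintegral hr0 hrt hs0 hst]
  set Z := mixedNorm r s μ W
  calc ∫⁻ x, ∫⁻ t, U x t * W x t ∂μ = ∫⁻ t, ∫⁻ x, U x t * W x t ∂volume ∂μ :=
        lintegral_lintegral_swap (hUm.mul hW).aemeasurable
    _ ≤ ∫⁻ t, C₀ * (maxIntegral (fun x => G x t) (fun x => F' x t) (fun x => W x t)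
          + maxIntegral (fun x => F x t) (fun x => G' x t) (fun x => W x t)) ∂μ :=
        lintegral_mono fun t => H₀ (schwartzSlice f t) (schwartzSlice g t) (fun x => W x t)
          hW.of_uncurry_right ⟨B', fun x => hB' x t⟩ ⟨n, fun x => hn x t⟩
    _ = C₀ * ((∫⁻ t, maxIntegral (fun x => G x t) (fun x => F' x t) (fun x => W x t) ∂μ)
          + ∫⁻ t, maxIntegral (fun x => F x t) (fun x => G' x t) (fun x => W x t) ∂μ) := by
        rw [lintegral_const_mul' _ _ hC₀, lintegral_add_left
          (measurable_maxIntegral hGc.measurable hFm hW)]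
    _ ≤ C₀ * (C₂ * (mixedNorm p₁' q₁' μ G * mixedNorm p₂' q₂' μ F' * Z)
          + C₁ * (mixedNorm p₁ q₁ μ F * mixedNorm p₂ q₂ μ G' * Z)) :=
        mul_le_mul_right (add_le_add (H₂ T G F' W hGc hFm hW) (H₁ T F G' W hFc hGm hW)) _
    _ ≤ C₀ * (C₂ * (R * Z) + C₁ * (R * Z)) := by
        refine mul_le_mul_right (add_le_add (mul_le_mul_right (mul_le_mul_left ?_ _) _)
          (mul_le_mul_right (mul_le_mul_left ?_ _) _)) _
        · exact le_add_self
        · exact le_self_add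
    _ = C₀ * (C₁ + C₂) * R * Z := by ring
    _ ≤ (C₀ * (C₁ + C₂) + 1) * R * Z := mul_le_mul_left (mul_le_mul_left le_self_add _) _

end
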